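/- If X is a nondegenerate unicoherent Peano continuum that is π-n-Euclidean for some n with 2 ≤ n < ∞, then C(X) \ CB(X) is an F_σ-absorber in the Hilbert cube C(X): it is an F_σ-set, it is strongly F_σ-universal, and it is contained in a σZ-set in C(X). -/

import Mathlib

open Set Topology Metric

noncomputable section

/-- The hyperspace `2^X` of nonempty compact (= closed, for compact `X`) subsets of `X`,
with the Hausdorff metric. -/
abbrev Hyper (X : Type*) [MetricSpace X] := TopologicalSpace.NonemptyCompacts X

/-- `C(X)`: the subcontinua of `X`, i.e. the connected members of the hyperspace. -/
def CSet (X : Type*) [MetricSpace X] : Set (Hyper X) :=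
  {A | IsConnected (A : Set X)}

/-- `CB(X)`: proper subcontinua of `X` with connected boundary. -/
def CBSet (X : Type*) [MetricSpace X] : Set (Hyper X) :=
  {A | IsConnected (A : Set X) ∧ (A : Set X) ≠ Set.univ ∧
    IsConnected (frontier (A : Set X))}

/-- `S(X)`: the members of the hyperspace that separate `X`,
i.e. whose complement is disconnected. -/
def SepSet (X : Type*) [MetricSpace X] : Set (Hyper X) :=
  {A | ¬ IsPreconnected ((A : Set X)ᶜ)}

/-- A set is `F_σ` if it is a countable union of closed sets. -/
def IsFsigma {α : Type*} [TopologicalSpace α] (s : Set α) : Prop :=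
  ∃ F : ℕ → Set α, (∀ n, IsClosed (F n)) ∧ s = ⋃ n, F n

/-- A set is `F_σδ` if it is a countable intersection of `F_σ` sets. -/
def IsFsigmaDelta {α : Type*} [TopologicalSpace α] (s : Set α) : Prop :=
  ∃ F : ℕ → Set α, (∀ n, IsFsigma (F n)) ∧ s = ⋂ n, F n

/-- A set is in the class `D_2(F_σ)` if it is a difference of two `F_σ` sets. -/
def IsD2Fsigma {α : Type*} [TopologicalSpace α] (s : Set α) : Prop :=
  ∃ u v : Set α, IsFsigma u ∧ IsFsigma v ∧ s = u \ v

/-- `X` is unicoherent: the intersection of any two closed connected sets covering `X`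
is connected. -/
def Unicoherent (X : Type*) [TopologicalSpace X] : Prop :=
  ∀ A B : Set X, IsClosed A → IsClosed B → IsConnected A → IsConnected B →
    A ∪ B = Set.univ → IsConnected (A ∩ B)

/-- An arc: a subspace homeomorphic to `[0,1]`. -/
def IsArc {X : Type*} [TopologicalSpace X] (A : Set X) : Prop :=
  Nonempty (unitInterval ≃ₜ A)

/-- A free arc: an arc which becomes open after removing its two endpoints. -/
def IsFreeArc {X : Type*} [TopologicalSpace X] (A : Set X) : Prop :=
  ∃ h : unitInterval ≃ₜ A, IsOpen (A \ {((h 0 : A) : X), ((h 1 : A) : X)})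

/-- `Y` is π-`n`-Euclidean: it has a π-base consisting of open sets homeomorphic to `ℝⁿ`. -/
def PiEuclidean (Y : Type*) [TopologicalSpace Y] (n : ℕ) : Prop :=
  ∃ 𝓤 : Set (Set Y),
    (∀ U ∈ 𝓤, IsOpen U ∧ U.Nonempty ∧ Nonempty (U ≃ₜ (Fin n → ℝ))) ∧
    ∀ V : Set Y, IsOpen V → V.Nonempty → ∃ U ∈ 𝓤, U ⊆ V

/-- The Hilbert cube `I^∞ = [0,1]^ℕ`. -/
abbrev Iinf : Type := ℕ → unitInterval

/-- The pseudo-interior `(0,1)^∞` of the Hilbert cube. -/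
def pseudoInterior : Set Iinf := {t | ∀ k, 0 < (t k : ℝ) ∧ (t k : ℝ) < 1}

/-- The pseudo-boundary `∂(I^∞) = I^∞ \ (0,1)^∞` of the Hilbert cube. -/
def pseudoBoundary : Set Iinf := pseudoInteriorᶜ

/-- A `Z`-set in a (Hilbert cube) metric space `Q`: a closed set `A` such that for every
`ε > 0` the identity can be `ε`-approximated by a map avoiding `A`. -/
def IsZSet {Q : Type*} [MetricSpace Q] (A : Set Q) : Prop :=
  IsClosed A ∧ ∀ ε : ℝ, 0 < ε →
    ∃ f : Q → Q, Continuous f ∧ (∀ x, dist (f x) x < ε) ∧ ∀ x, f x ∉ A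

/-- A `σZ`-set: a countable union of `Z`-sets. -/
def IsSigmaZSet {Q : Type*} [MetricSpace Q] (A : Set Q) : Prop :=
  ∃ Z : ℕ → Set Q, (∀ n, IsZSet (Z n)) ∧ A = ⋃ n, Z n

/-- `A ⊆ Q` is strongly `𝓜`-universal (for a class `𝓜` of subsets of the Hilbert cube
`I^∞`): every embedding `f : I^∞ → Q` sending a compact set `K` onto a `Z`-set can be
approximated by an embedding `g` onto a `Z`-set which agrees with `f` on `K` and with
`g⁻¹(A) \ K = M \ K`. -/
def StronglyUniversal {Q : Type*} [MetricSpace Q] (𝓜 : Set (Set Iinf)) (A : Set Q) : Prop :=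
  ∀ M ∈ 𝓜, ∀ K : Set Iinf, IsCompact K →
    ∀ f : Iinf → Q, IsEmbedding f → IsZSet (f '' K) →
      ∀ ε : ℝ, 0 < ε →
        ∃ g : Iinf → Q, IsEmbedding g ∧ IsZSet (Set.range g) ∧
          (∀ x, dist (g x) (f x) < ε) ∧ (∀ x ∈ K, g x = f x) ∧
          g ⁻¹' A \ K = M \ K

/-- Lebesgue covering dimension `≤ n`: every open cover has an open refinement which
covers and such that each point lies in at most `n + 1` members. -/
def CoveringDimLE (α : Type*) [TopologicalSpace α] (n : ℕ) : Prop :=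
  ∀ 𝓤 : Set (Set α), (∀ U ∈ 𝓤, IsOpen U) → ⋃₀ 𝓤 = Set.univ →
    ∃ 𝓥 : Set (Set α), (∀ V ∈ 𝓥, IsOpen V) ∧ ⋃₀ 𝓥 = Set.univ ∧
      (∀ V ∈ 𝓥, ∃ U ∈ 𝓤, V ⊆ U) ∧
      ∀ (x : α) (s : Finset (Set α)), ↑s ⊆ 𝓥 → (∀ V ∈ s, x ∈ V) → s.card ≤ n + 1

/-- An indecomposable continuum: not the union of two proper subcontinua. -/
def IndecomposableCont (X : Type*) [TopologicalSpace X] : Prop :=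
  ¬ ∃ A B : Set X, IsClosed A ∧ IsClosed B ∧ IsConnected A ∧ IsConnected B ∧
    A ≠ Set.univ ∧ B ≠ Set.univ ∧ A ∪ B = Set.univ


section Basics

variable {X : Type*} [MetricSpace X]

lemma hyper_dist_le {A B : Hyper X} {r : ℝ} (hr : 0 ≤ r)
    (h1 : ∀ a ∈ (A : Set X), ∃ b ∈ (B : Set X), dist a b ≤ r)
    (h2 : ∀ b ∈ (B : Set X), ∃ a ∈ (A : Set X), dist b a ≤ r) : dist A B ≤ r := by
  rw [NonemptyCompacts.dist_eq]
  exact hausdorffDist_le_of_mem_dist hr h1 h2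

lemma hyper_exists_lt {A B : Hyper X} {r : ℝ} (h : dist A B < r) {a : X} (ha : a ∈ (A : Set X)) :
    ∃ b ∈ (B : Set X), dist a b < r := by
  rw [NonemptyCompacts.dist_eq] at h
  exact exists_dist_lt_of_hausdorffDist_lt ha h
    (hausdorffEDist_ne_top_of_nonempty_of_bounded A.nonempty B.nonempty
      A.isCompact.isBounded B.isCompact.isBounded)

lemma hyper_exists_le {A B : Hyper X} {a : X} (ha : a ∈ (A : Set X)) :
    ∃ b ∈ (B : Set X), dist a b ≤ dist A B := by
  obtain ⟨b, hb, h⟩ := B.isCompact.exists_infDist_eq_dist B.nonempty a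
  refine ⟨b, hb, ?_⟩
  rw [← h]
  refine le_of_forall_gt fun r hr => ?_
  obtain ⟨c, hc, h'⟩ := hyper_exists_lt hr ha
  exact (infDist_le_dist_of_mem hc).trans_lt h'

lemma hyper_infDist_le (A B : Hyper X) (y : X) :
    infDist y (A : Set X) ≤ infDist y (B : Set X) + dist A B := by
  obtain ⟨b, hb, h⟩ := B.isCompact.exists_infDist_eq_dist B.nonempty y
  obtain ⟨a, ha, h'⟩ := hyper_exists_le (A := B) (B := A) hb
  rw [h]
  calc infDist y (A : Set X) ≤ dist y a := infDist_le_dist_of_mem ha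
    _ ≤ dist y b + dist b a := dist_triangle _ _ _
    _ ≤ _ := by rw [dist_comm A B]; gcongr

lemma hyper_continuousAt {T : Type*} [TopologicalSpace T] {F : T → Hyper X} {x : T}
    (h1 : ∀ U : Set X, IsOpen U → (F x : Set X) ⊆ U → ∀ᶠ y in 𝓝 x, (F y : Set X) ⊆ U)
    (h2 : ∀ p ∈ (F x : Set X), ∀ ε > 0, ∀ᶠ y in 𝓝 x, ∃ q ∈ (F y : Set X), dist p q < ε) :
    ContinuousAt F x := by
  rw [Metric.continuousAt_iff']
  intro ε hε
  have a1 := h1 (thickening (ε / 2) (F x : Set X)) isOpen_thickening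
    (self_subset_thickening (by positivity) _)
  obtain ⟨t, ht, htf, hc⟩ := (F x).isCompact.finite_cover_balls (e := ε / 4) (by positivity)
  have a2 : ∀ᶠ y in 𝓝 x, ∀ p ∈ t, ∃ q ∈ (F y : Set X), dist p q < ε / 4 := by
    rw [Filter.eventually_all_finite htf]
    exact fun p hp => h2 p (ht hp) _ (by positivity)
  filter_upwards [a1, a2] with y hy1 hy2
  refine (hyper_dist_le (r := ε / 2) (by positivity) ?_ ?_).trans_lt (by linarith)
  · intro a ha
    obtain ⟨z, hz, h⟩ := mem_thickening_iff.1 (hy1 ha)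
    exact ⟨z, hz, h.le⟩
  · intro b hb
    have := hc hb
    simp only [mem_iUnion, mem_ball] at this
    obtain ⟨p, hp, hbp⟩ := this
    obtain ⟨q, hq, hpq⟩ := hy2 p hp
    exact ⟨q, hq, by linarith [dist_triangle b p q]⟩

lemma isClosed_CSet : IsClosed (CSet X) := by
  rw [← isOpen_compl_iff, isOpen_iff_mem_nhds]
  intro A hA
  have hA' : ¬ IsPreconnected (A : Set X) := fun h => hA ⟨A.nonempty, h⟩
  rw [isPreconnected_iff_subset_of_fully_disjoint_closed A.isCompact.isClosed] at hA'
  push Not at hA'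
  obtain ⟨u, v, hu, hv, huv, hd, h1, h2⟩ := hA'
  obtain ⟨U, V, hU, hV, huU, hvV, hUV⟩ := SeparatedNhds.of_isCompact_isCompact
    (A.isCompact.inter_right hu) (A.isCompact.inter_right hv)
    (hd.mono inter_subset_right inter_subset_right)
  have e1 := TopologicalSpace.NonemptyCompacts.isOpen_subsets_of_isOpen (hU.union hV)
  have e2 := TopologicalSpace.NonemptyCompacts.isOpen_inter_nonempty_of_isOpen hU
  have e3 := TopologicalSpace.NonemptyCompacts.isOpen_inter_nonempty_of_isOpen hV
  obtain ⟨p, hp, hpu⟩ := not_subset.1 h1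
  obtain ⟨q, hq, hqv⟩ := not_subset.1 h2
  have hpv : p ∈ v := (huv hp).resolve_left hpu
  have hqu : q ∈ u := (huv hq).resolve_right hqv
  filter_upwards [e1.mem_nhds (x := A) (fun a ha => (huv ha).imp (fun h => huU ⟨ha, h⟩)
      (fun h => hvV ⟨ha, h⟩)), e2.mem_nhds (x := A) ⟨q, hq, huU ⟨hq, hqu⟩⟩,
      e3.mem_nhds (x := A) ⟨p, hp, hvV ⟨hp, hpv⟩⟩] with B hB1 hB2 hB3 hB
  obtain ⟨z, hz, hz1, hz2⟩ := hB.2 U V hU hV hB1 hB2 hB3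
  exact hUV.le_bot ⟨hz1, hz2⟩

instance [CompactSpace X] : CompactSpace ↥(CSet X) := isCompact_iff_compactSpace.1
  isClosed_CSet.isCompact

lemma isClosed_mem_hyper (p : X) : IsClosed {A : ↥(CSet X) | p ∈ ((A : Hyper X) : Set X)} := by
  have := (TopologicalSpace.NonemptyCompacts.isClosed_inter_nonempty_of_isClosed
    (isClosed_singleton (x := p))).preimage (continuous_subtype_val (p := (· ∈ CSet X)))
  convert this using 1
  ext A; simp

end Basics

lemma exists_minorant {S : Type*} [MetricSpace S] {Z : Set S} (hZ : IsClosed Z)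
    (P : S → ℝ → Prop)
    (h : ∀ x ∉ Z, ∃ ε > 0, ∀ y, dist y x < ε → ∀ t, 0 < t → t < ε → P y t) :
    ∃ r : S → ℝ, Continuous r ∧ (∀ x, 0 ≤ r x) ∧ (∀ x ∈ Z, r x = 0) ∧
      ∀ x ∉ Z, 0 < r x ∧ P x (r x) := by
  let good : S → ℝ → Prop := fun a ε => 0 < ε ∧ ε ≤ 1 ∧ (∀ y ∈ Z, ε ≤ dist y a) ∧
    ∀ y, dist y a < ε → ∀ t, 0 < t → t < ε → P y t
  let W : S → Set ℝ := fun x => insert 0 {u | ∃ a ε, good a ε ∧ u = ε / 2 - dist x a}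
  have hbd : ∀ x, BddAbove (W x) := by
    intro x
    refine ⟨1, ?_⟩
    rintro u (rfl | ⟨a, ε, hg, rfl⟩)
    · norm_num
    · have := hg.2.1
      have := dist_nonneg (x := x) (y := a)
      linarith
  have hne : ∀ x, (W x).Nonempty := fun x => ⟨0, mem_insert _ _⟩
  have h0 : ∀ x, 0 ≤ sSup (W x) := fun x => le_csSup (hbd x) (mem_insert _ _)
  have hlip : ∀ x y, sSup (W x) ≤ sSup (W y) + dist x y := by
    intro x y
    refine csSup_le (hne x) ?_
    rintro u (rfl | ⟨a, ε, hg, rfl⟩)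
    · exact add_nonneg (h0 y) dist_nonneg
    · have : ε / 2 - dist y a ≤ sSup (W y) := le_csSup (hbd y) (Or.inr ⟨a, ε, hg, rfl⟩)
      have := dist_triangle y x a
      rw [dist_comm y x] at this
      linarith
  have hpos : ∀ x ∉ Z, 0 < sSup (W x) := by
    intro x hx
    obtain ⟨ε, hε, hP⟩ := h x hx
    obtain ⟨δ, hδ, hb⟩ := Metric.isOpen_iff.1 hZ.isOpen_compl x hx
    have hg : good x (min (min ε δ) 1) := by
      refine ⟨by positivity, min_le_right _ _, ?_, ?_⟩
      · intro y hy
        by_contra! hlt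
        exact hb (mem_ball.2 (hlt.trans_le ((min_le_left _ _).trans (min_le_right _ _)))) hy
      · intro y hy t ht ht'
        have := (min_le_left (min ε δ) 1).trans (min_le_left _ _)
        exact hP y (by linarith) t ht (by linarith)
    have : min (min ε δ) 1 / 2 - dist x x ≤ sSup (W x) :=
      le_csSup (hbd x) (Or.inr ⟨x, _, hg, rfl⟩)
    rw [dist_self] at this
    have := hg.1
    linarith
  refine ⟨fun x => sSup (W x), ?_, h0, ?_, ?_⟩
  · refine (LipschitzWith.of_le_add (f := fun x => sSup (W x)) hlip).continuous
  · intro x hx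
    refine le_antisymm (csSup_le (hne x) ?_) (h0 x)
    rintro u (rfl | ⟨a, ε, hg, rfl⟩)
    · rfl
    · have := hg.2.2.1 x hx
      have := hg.1
      linarith
  · intro x hx
    refine ⟨hpos x hx, ?_⟩
    have hp := hpos x hx
    obtain ⟨u, hu, hlt⟩ := exists_lt_of_lt_csSup (hne x) (show sSup (W x) / 2 < sSup (W x) by linarith)
    rcases hu with rfl | ⟨a, ε, hg, rfl⟩
    · linarith
    · have := dist_nonneg (x := x) (y := a)
      have := hg.1
      exact hg.2.2.2 x (by linarith) _ hp (by linarith)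

section P2
variable {X : Type*} [MetricSpace X]

lemma frontier_eq_inter {A : Set X} (hA : IsClosed A) : frontier A = A ∩ closure Aᶜ := by
  rw [frontier_eq_closure_inter_closure, hA.closure_eq]

lemma closure_compl_preconnected [ConnectedSpace X] [LocallyConnectedSpace X] {A : Set X}
    (hA : IsClosed A) (hne : A.Nonempty) (h : IsConnected (frontier A)) :
    IsPreconnected (closure Aᶜ) := by
  have hsub : frontier A ⊆ closure Aᶜ := by rw [frontier_eq_inter hA]; exact inter_subset_right
  obtain ⟨p, hp⟩ := h.nonempty
  have key : ∀ x ∈ Aᶜ, ∃ S ⊆ closure Aᶜ, IsPreconnected S ∧ x ∈ S ∧ p ∈ S := by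
    intro x hx
    set U := connectedComponentIn Aᶜ x with hU
    have hUo : IsOpen U := hA.isOpen_compl.connectedComponentIn
    have hxU : x ∈ U := mem_connectedComponentIn hx
    have hUc : IsPreconnected U := isPreconnected_connectedComponentIn
    have hUs : U ⊆ Aᶜ := connectedComponentIn_subset _ _
    -- closure U meets A
    have hm : ∃ y ∈ closure U, y ∈ A := by
      by_contra! hcon
      have : closure U ⊆ U := by
        refine IsPreconnected.subset_connectedComponentIn hUc.closure (subset_closure hxU) ?_
        exact hcon
      have hcl : IsClosed U := closure_subset_iff_isClosed.1 this
      have := IsClopen.eq_univ ⟨hcl, hUo⟩ ⟨x, hxU⟩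
      obtain ⟨a, ha⟩ := hne
      exact hUs (this ▸ mem_univ a) ha
    obtain ⟨y, hyU, hyA⟩ := hm
    have hyc : y ∈ closure Aᶜ := closure_mono hUs hyU
    have hyf : y ∈ frontier A := by rw [frontier_eq_inter hA]; exact ⟨hyA, hyc⟩
    refine ⟨closure U ∪ frontier A, union_subset (closure_mono hUs) hsub, ?_,
      Or.inl (subset_closure hxU), Or.inr hp⟩
    exact IsPreconnected.union y hyU hyf hUc.closure h.isPreconnected
  apply isPreconnected_of_forall p
  intro x hx
  by_cases hxA : x ∈ A
  · exact ⟨frontier A, hsub, hp, by rw [frontier_eq_inter hA]; exact ⟨hxA, hx⟩, h.isPreconnected⟩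
  · obtain ⟨S, h1, h2, h3, h4⟩ := key x hxA
    exact ⟨S, h1, h4, h3, h2⟩

/-- membership in `CB` in terms of the closure of the complement -/
lemma mem_CBSet_iff [ConnectedSpace X] [LocallyConnectedSpace X] (huc : Unicoherent X)
    {A : Hyper X} (hA : A ∈ CSet X) (hne : (A : Set X) ≠ univ) :
    A ∈ CBSet X ↔ IsPreconnected (closure (A : Set X)ᶜ) := by
  have hcl : IsClosed (A : Set X) := A.isCompact.isClosed
  constructor
  · rintro ⟨_, _, h⟩
    exact closure_compl_preconnected hcl A.nonempty h
  · intro h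
    refine ⟨hA, hne, ?_⟩
    rw [frontier_eq_inter hcl]
    have hne' : ((A : Set X)ᶜ).Nonempty := nonempty_compl.2 hne
    refine huc _ _ hcl isClosed_closure hA ⟨hne'.closure, h⟩ ?_
    rw [eq_univ_iff_forall]
    intro x
    by_cases hx : x ∈ (A : Set X)
    · exact Or.inl hx
    · exact Or.inr (subset_closure hx)

lemma nonCB_iff [CompactSpace X] [ConnectedSpace X] [LocallyConnectedSpace X] (huc : Unicoherent X)
    {B : Set (Set X)} (hB : TopologicalSpace.IsTopologicalBasis B)
    {A : Hyper X} (hA : A ∈ CSet X) :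
    A ∉ CBSet X ↔ ((A : Set X) = univ) ∨ ∃ F₁ F₂ : Set (Set X), F₁.Finite ∧ F₂.Finite ∧ F₁ ⊆ B ∧
      F₂ ⊆ B ∧ Disjoint (closure (⋃₀ F₁)) (closure (⋃₀ F₂)) ∧ (⋃₀ F₁ ∪ ⋃₀ F₂)ᶜ ⊆ (A : Set X) ∧
      (⋃₀ F₁ ∩ (A : Set X)ᶜ).Nonempty ∧ (⋃₀ F₂ ∩ (A : Set X)ᶜ).Nonempty := by
  by_cases hne : (A : Set X) = univ
  · simp only [hne, true_or, iff_true]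
    exact fun h => h.2.1 hne
  rw [mem_CBSet_iff huc hA hne]
  simp only [hne, false_or]
  constructor
  · intro h
    rw [isPreconnected_iff_subset_of_fully_disjoint_closed isClosed_closure] at h
    push Not at h
    obtain ⟨u, v, hu, hv, huv, hd, hnu, hnv⟩ := h
    have hcover : ∀ (u w : Set X), IsClosed u → IsOpen w → u ⊆ w → ∃ F : Set (Set X), F.Finite ∧
        F ⊆ B ∧ u ⊆ ⋃₀ F ∧ ⋃₀ F ⊆ w := by
      intro u w hu hw huw
      have := hu.isCompact.elim_finite_subcover_image (b := {b ∈ B | b ⊆ w}) (c := id)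
        (fun b hb => hB.isOpen hb.1) (by
          intro x hx
          obtain ⟨b, hb, hxb, hbw⟩ := hB.exists_subset_of_mem_open (huw hx) hw
          exact mem_biUnion (x := b) ⟨hb, hbw⟩ hxb)
      obtain ⟨F, hF, hfin, hs⟩ := this
      refine ⟨F, hfin, fun b hb => (hF hb).1, by simpa [sUnion_eq_biUnion] using hs, ?_⟩
      exact sUnion_subset fun b hb => (hF hb).2
    obtain ⟨w₁, hw₁, hc₁, w₂, hw₂, hc₂, hdw⟩ : ∃ w₁, IsOpen w₁ ∧ u ⊆ w₁ ∧ ∃ w₂, IsOpen w₂ ∧ v ⊆ w₂ ∧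
        Disjoint (closure w₁) (closure w₂) := by
      obtain ⟨w₁, hw₁, h1, h2⟩ := normal_exists_closure_subset hu hv.isOpen_compl
        (fun x hx hx' => hd.le_bot ⟨hx, hx'⟩)
      obtain ⟨w₂, hw₂, h3, h4⟩ := normal_exists_closure_subset hv
        (isClosed_closure (s := w₁)).isOpen_compl (fun x hx hx' => h2 hx' hx)
      exact ⟨w₁, hw₁, h1, w₂, hw₂, h3, Set.disjoint_left.2 fun x hx hx' => h4 hx' hx⟩
    obtain ⟨F₁, f1, f2, f3, f4⟩ := hcover u w₁ hu hw₁ hc₁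
    obtain ⟨F₂, g1, g2, g3, g4⟩ := hcover v w₂ hv hw₂ hc₂
    have hmeet : ∀ u v F : Set X, closure (A : Set X)ᶜ ⊆ u ∪ v → IsClosed v →
        ¬ (closure (A : Set X)ᶜ ⊆ v) → u ⊆ F → (F ∩ (A : Set X)ᶜ).Nonempty := by
      intro u v F huv hv hn huF
      by_contra hemp
      apply hn
      apply closure_minimal _ hv
      intro x hx
      rcases huv (subset_closure hx) with h | h
      · exact absurd ⟨x, huF h, hx⟩ hemp
      · exact h
    refine ⟨F₁, F₂, f1, g1, f2, g2, hdw.mono (closure_mono f4) (closure_mono g4), ?_,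
      hmeet u v _ huv hv hnv f3, hmeet v u _ (by rwa [union_comm]) hu hnu g3⟩
    intro x hx
    by_contra hxA
    apply hx
    exact (huv (subset_closure hxA)).imp (fun h => f3 h) (fun h => g3 h)
  · rintro ⟨F₁, F₂, -, -, -, -, hd, hs, ⟨x, hx1, hx2⟩, y, hy1, hy2⟩ h
    rw [isPreconnected_iff_subset_of_fully_disjoint_closed isClosed_closure] at h
    have := h (closure (⋃₀ F₁)) (closure (⋃₀ F₂)) isClosed_closure isClosed_closure (by
      rw [← closure_union]; apply closure_mono; intro z hz; by_contra hzz; exact hz (hs hzz)) hd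
    rcases this with h | h
    · exact hd.le_bot ⟨h (subset_closure hy2), subset_closure hy1⟩
    · exact hd.le_bot ⟨subset_closure hx1, h (subset_closure hx2)⟩

lemma isFsigma_iUnion_countable {α ι : Type*} [TopologicalSpace α] [Countable ι] {F : ι → Set α}
    (h : ∀ i, IsFsigma (F i)) : IsFsigma (⋃ i, F i) := by
  choose G hG hF using h
  rcases isEmpty_or_nonempty ι with hi | hi
  · exact ⟨fun _ => ∅, fun _ => isClosed_empty, by simp⟩
  obtain ⟨φ, hφ⟩ := exists_surjective_nat (ι × ℕ)
  refine ⟨fun k => G (φ k).1 (φ k).2, fun k => hG _ _, ?_⟩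
  rw [hφ.iUnion_comp (fun p : ι × ℕ => G p.1 p.2), iUnion_prod']
  exact iUnion_congr fun i => hF i

lemma isFsigma_of_isClosed {α : Type*} [TopologicalSpace α] {s : Set α} (h : IsClosed s) :
    IsFsigma s := ⟨fun _ => s, fun _ => h, (iUnion_const s).symm⟩

lemma isFsigma_of_isOpen {α : Type*} [MetricSpace α] {s : Set α} (h : IsOpen s) :
    IsFsigma s := by
  obtain ⟨F, h1, -, h3, -⟩ := h.exists_iUnion_isClosed
  exact ⟨F, h1, h3.symm⟩

lemma IsFsigma.inter {α : Type*} [TopologicalSpace α] {s t : Set α} (hs : IsFsigma s)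
    (ht : IsFsigma t) : IsFsigma (s ∩ t) := by
  obtain ⟨F, hF, rfl⟩ := hs
  obtain ⟨G, hG, rfl⟩ := ht
  rw [iUnion_inter_iUnion]
  exact isFsigma_iUnion_countable fun i => isFsigma_iUnion_countable fun j =>
    isFsigma_of_isClosed ((hF i).inter (hG j))

lemma IsFsigma.union {α : Type*} [TopologicalSpace α] {s t : Set α} (hs : IsFsigma s)
    (ht : IsFsigma t) : IsFsigma (s ∪ t) := by
  rw [union_eq_iUnion]
  exact isFsigma_iUnion_countable fun b => by cases b <;> assumption

lemma isFsigma_nonCB [CompactSpace X] [ConnectedSpace X] [LocallyConnectedSpace X]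
    (huc : Unicoherent X) : IsFsigma {A : ↥(CSet X) | (A : Hyper X) ∉ CBSet X} := by
  obtain ⟨B, hBc, -, hB⟩ := TopologicalSpace.exists_countable_basis X
  set I := {p : Set (Set X) × Set (Set X) | p.1 ∈ {F | F.Finite ∧ F ⊆ B} ∧
    p.2 ∈ {F | F.Finite ∧ F ⊆ B}} with hI
  have hIc : I.Countable := (countable_ofPred_finite_subset hBc).prod (countable_ofPred_finite_subset hBc)
  have : Countable I := hIc.to_subtype
  have heq : {A : ↥(CSet X) | (A : Hyper X) ∉ CBSet X} =
      {A : ↥(CSet X) | (univ : Set X) ⊆ ((A : Hyper X) : Set X)} ∪ ⋃ p : I,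
        ({A : ↥(CSet X) | Disjoint (closure (⋃₀ p.1.1)) (closure (⋃₀ p.1.2))} ∩
         {A : ↥(CSet X) | (⋃₀ p.1.1 ∪ ⋃₀ p.1.2)ᶜ ⊆ ((A : Hyper X) : Set X)}) ∩
        ({A : ↥(CSet X) | (⋃₀ p.1.1 ⊆ ((A : Hyper X) : Set X))}ᶜ ∩
         {A : ↥(CSet X) | (⋃₀ p.1.2 ⊆ ((A : Hyper X) : Set X))}ᶜ) := by
    ext A
    rw [mem_ofPred_eq, nonCB_iff huc hB A.2]
    simp only [mem_union, mem_ofPred_eq, mem_iUnion, mem_inter_iff, mem_compl_iff, univ_subset_iff]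
    apply or_congr Iff.rfl
    simp only [inter_compl_nonempty_iff]
    constructor
    · rintro ⟨F₁, F₂, a, b, c, d, e, f, g, h⟩
      exact ⟨⟨(F₁, F₂), ⟨a, c⟩, ⟨b, d⟩⟩, ⟨e, f⟩, g, h⟩
    · rintro ⟨⟨⟨F₁, F₂⟩, ⟨a, c⟩, ⟨b, d⟩⟩, ⟨e, f⟩, g, h⟩
      exact ⟨F₁, F₂, a, b, c, d, e, f, g, h⟩
  have hcl : ∀ S : Set X, IsClosed {A : ↥(CSet X) | S ⊆ ((A : Hyper X) : Set X)} := by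
    intro S
    have : {A : ↥(CSet X) | S ⊆ ((A : Hyper X) : Set X)} = ⋂ p ∈ S, {A : ↥(CSet X) | p ∈ ((A : Hyper X) : Set X)} := by
      ext A; simp [Set.subset_def]
    rw [this]
    exact isClosed_biInter fun p _ => isClosed_mem_hyper p
  rw [heq]
  refine (isFsigma_of_isClosed (hcl _)).union (isFsigma_iUnion_countable fun p => ?_)
  refine ((isFsigma_of_isClosed isClosed_const).inter (isFsigma_of_isClosed (hcl _))).inter
    ((isFsigma_of_isOpen (hcl _).isOpen_compl).inter (isFsigma_of_isOpen (hcl _).isOpen_compl))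

/-- a non-CB set contains an open set -/
lemma nonCB_interior [CompactSpace X] [ConnectedSpace X] [LocallyConnectedSpace X]
    (huc : Unicoherent X) {A : Hyper X} (hA : A ∈ CSet X) (h : A ∉ CBSet X) :
    (interior (A : Set X)).Nonempty := by
  obtain ⟨B, hBc, -, hB⟩ := TopologicalSpace.exists_countable_basis X
  rw [nonCB_iff huc hB hA] at h
  rcases h with h | ⟨F₁, F₂, -, -, h1, h2, hd, hs, ⟨x, hx, -⟩, y, hy, -⟩
  · rw [h, interior_univ]; exact univ_nonempty
  have hs' : (closure (⋃₀ F₁) ∪ closure (⋃₀ F₂))ᶜ ⊆ (A : Set X) := by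
    refine Subset.trans ?_ hs
    exact compl_subset_compl.2 (union_subset_union subset_closure subset_closure)
  have hne : ((closure (⋃₀ F₁) ∪ closure (⋃₀ F₂))ᶜ).Nonempty := by
    by_contra hemp
    rw [not_nonempty_iff_eq_empty, compl_empty_iff] at hemp
    have := (isPreconnected_iff_subset_of_fully_disjoint_closed isClosed_univ).1
      (isPreconnected_univ (α := X)) _ _ isClosed_closure isClosed_closure hemp.ge hd
    rcases this with h | h
    · exact hd.le_bot ⟨h (mem_univ y), subset_closure hy⟩
    · exact hd.le_bot ⟨subset_closure hx, h (mem_univ x)⟩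
  exact hne.mono (interior_maximal hs' (isClosed_closure.union isClosed_closure).isOpen_compl)
end P2

section P3
variable {X : Type*} [MetricSpace X]

abbrev car (A : ↥(CSet X)) : Set X := ((A : Hyper X) : Set X)

def mkC (S : Set X) (hS : IsCompact S) (hc : IsConnected S) : ↥(CSet X) :=
  ⟨⟨⟨S, hS⟩, hc.nonempty⟩, hc⟩

@[simp] lemma car_mkC (S : Set X) (hS : IsCompact S) (hc : IsConnected S) : car (mkC S hS hc) = S :=
  rfl

lemma car_ext {A B : ↥(CSet X)} (h : car A = car B) : A = B :=
  Subtype.ext (SetLike.coe_injective h)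

lemma car_conn (A : ↥(CSet X)) : IsConnected (car A) := A.2
lemma car_compact (A : ↥(CSet X)) : IsCompact (car A) := A.1.isCompact
lemma car_closed (A : ↥(CSet X)) : IsClosed (car A) := A.1.isCompact.isClosed
lemma car_nonempty (A : ↥(CSet X)) : (car A).Nonempty := A.1.nonempty

lemma c_dist_le {A B : ↥(CSet X)} {r : ℝ} (hr : 0 ≤ r)
    (h1 : ∀ a ∈ car A, ∃ b ∈ car B, dist a b ≤ r)
    (h2 : ∀ b ∈ car B, ∃ a ∈ car A, dist b a ≤ r) : dist A B ≤ r := hyper_dist_le hr h1 h2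

lemma c_exists_lt {A B : ↥(CSet X)} {r : ℝ} (h : dist A B < r) {a : X} (ha : a ∈ car A) :
    ∃ b ∈ car B, dist a b < r := hyper_exists_lt h ha

lemma c_exists_le {A B : ↥(CSet X)} {a : X} (ha : a ∈ car A) :
    ∃ b ∈ car B, dist a b ≤ dist A B := hyper_exists_le ha

lemma c_infDist_le (A B : ↥(CSet X)) (y : X) :
    infDist y (car A) ≤ infDist y (car B) + dist A B := hyper_infDist_le A.1 B.1 y

lemma c_infDist_cont (y : X) : Continuous fun A : ↥(CSet X) => infDist y (car A) := by
  apply LipschitzWith.continuous (K := 1)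
  apply LipschitzWith.of_le_add
  intro A B
  exact c_infDist_le A B y

/-- bumping -/
lemma exists_bump {B C : Set X} (hB : IsCompact B) (hBc : IsPreconnected B) (hC : IsClosed C)
    (hCc : IsConnected C) (hCB : C ⊆ B) (hne : C ≠ B) {ε : ℝ} (hε : 0 < ε) :
    ∃ D : Set X, IsCompact D ∧ IsConnected D ∧ C ⊆ D ∧ D ⊆ B ∧ D ≠ C ∧
      ∀ x ∈ D, infDist x C ≤ ε := by
  obtain ⟨c, hc⟩ := hCc.nonempty
  set V : Set X := {x ∈ B | infDist x C ≤ ε} with hV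
  have hcont : Continuous fun x => infDist x C := continuous_infDist_pt C
  have hVc : IsCompact V := hB.inter_right (isClosed_le hcont continuous_const)
  have : CompactSpace V := isCompact_iff_compactSpace.1 hVc
  have hCV : C ⊆ V := fun x hx => ⟨hCB hx, by rw [infDist_zero_of_mem hx]; exact hε.le⟩
  set c' : V := ⟨c, hCV hc⟩
  set D : Set X := (↑) '' connectedComponent c' with hD
  have hDc : IsConnected D := isConnected_connectedComponent.image _ continuous_subtype_val.continuousOn
  have hDk : IsCompact D := isClosed_connectedComponent.isCompact.image continuous_subtype_val
  have hDmax : ∀ S : Set X, S ⊆ V → IsPreconnected S → c ∈ S → S ⊆ D := by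
    intro S hS hSc hcS x hx
    have h1 : IsPreconnected ((↑) ⁻¹' S : Set V) := by
      rw [← IsInducing.subtypeVal.isPreconnected_image, Subtype.image_preimage_coe]
      rwa [inter_eq_right.2 hS]
    exact ⟨⟨x, hS hx⟩, h1.subset_connectedComponent (x := c') hcS hx, rfl⟩
  have hCD : C ⊆ D := hDmax C hCV hCc.isPreconnected hc
  refine ⟨D, hDk, hDc, hCD, ?_, ?_, ?_⟩
  · rintro _ ⟨x, -, rfl⟩; exact x.2.1
  · intro hDC
    set E : Set V := {v | ε ≤ infDist (v : X) C} with hE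
    have hEc : IsCompact E := (isClosed_le continuous_const (hcont.comp continuous_subtype_val)).isCompact
    obtain ⟨T, hT⟩ := hEc.elim_finite_subcover
      (fun s : {s : Set V // IsClopen s ∧ c' ∈ s} => (s : Set V)ᶜ) (fun s => s.2.1.compl.isOpen) (by
        intro v hv
        by_contra hcon
        simp only [mem_iUnion, mem_compl_iff, not_exists, not_not] at hcon
        have : v ∈ connectedComponent c' := by
          rw [connectedComponent_eq_iInter_isClopen, mem_iInter]; exact hcon
        have h2 : (v : X) ∈ C := by rw [← hDC]; exact ⟨v, this, rfl⟩
        have h3 : ε ≤ infDist (v : X) C := hv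
        rw [infDist_zero_of_mem h2] at h3
        linarith)
    set Q : Set V := ⋂ s ∈ T, (s : Set V) with hQ
    have hQc : IsClopen Q := isClopen_biInter_finset fun s _ => s.2.1
    have hcQ : c' ∈ Q := mem_iInter₂.2 fun s _ => s.2.2
    have hQE : ∀ v ∈ Q, infDist (v : X) C < ε := by
      intro v hv
      by_contra! hcon
      obtain ⟨s, hs, hvs⟩ := mem_iUnion₂.1 (hT hcon)
      exact hvs (mem_iInter₂.1 hv s hs)
    -- Q is open and closed in B
    obtain ⟨O, hO, hOQ⟩ := hQc.isOpen
    have hQcl : IsClosed ((↑) '' Q : Set X) :=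
      (hQc.isClosed.isCompact.image continuous_subtype_val).isClosed
    have hsub : B ⊆ (↑) '' Q := by
      have hO2 : IsOpen (O ∩ {x | infDist x C < ε}) := hO.inter (isOpen_lt hcont continuous_const)
      have := isPreconnected_iff_subset_of_disjoint.1 hBc _ _ hO2 hQcl.isOpen_compl (by
          intro x hx
          by_cases hxQ : x ∈ ((↑) '' Q : Set X)
          · left
            obtain ⟨v, hv, rfl⟩ := hxQ
            refine ⟨?_, hQE v hv⟩
            rw [← hOQ] at hv; exact hv
          · exact Or.inr hxQ) (by
          rw [eq_empty_iff_forall_notMem]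
          rintro x ⟨hxB, ⟨hx1, hx2⟩, hx3⟩
          apply hx3
          refine ⟨⟨x, ⟨hxB, le_of_lt hx2⟩⟩, ?_, rfl⟩
          rw [← hOQ]; exact hx1)
      rcases this with this | this
      · intro x hx
        have hx2 := this hx
        have hxV : x ∈ V := ⟨hx, hx2.2.le⟩
        refine ⟨⟨x, hxV⟩, ?_, rfl⟩
        rw [← hOQ]; exact hx2.1
      · exact absurd ⟨c', hcQ, rfl⟩ (this (hCB hc))
    apply hne
    apply hCB.antisymm
    rw [← hDC]
    apply hDmax B _ hBc (hCB hc)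
    intro x hx
    obtain ⟨v, -, rfl⟩ := hsub hx
    exact v.2
  · rintro _ ⟨x, -, rfl⟩; exact x.2.2

variable [CompactSpace X]

/-- a Whitney-type function -/
def wh [Nonempty X] (A : Hyper X) : ℝ :=
  ∑' j : ℕ, (1 / 2 : ℝ) ^ j * infDist (TopologicalSpace.denseSeq X j) (A : Set X)

lemma infDist_le_diam (y : X) (A : Hyper X) : infDist y (A : Set X) ≤ diam (univ : Set X) := by
  obtain ⟨a, ha⟩ := A.nonempty
  exact (infDist_le_dist_of_mem ha).trans
    (dist_le_diam_of_mem isCompact_univ.isBounded (mem_univ _) (mem_univ _))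

lemma wh_summable [Nonempty X] (A : Hyper X) :
    Summable fun j : ℕ => (1 / 2 : ℝ) ^ j * infDist (TopologicalSpace.denseSeq X j) (A : Set X) := by
  refine Summable.of_nonneg_of_le (fun j => mul_nonneg (by positivity) infDist_nonneg) (fun j =>
    mul_le_mul_of_nonneg_left (infDist_le_diam _ A) (by positivity))
    (Summable.mul_right _ summable_geometric_two)

lemma wh_anti [Nonempty X] {A B : Hyper X} (h : (A : Set X) ⊆ B) : wh B ≤ wh A := by
  apply Summable.tsum_le_tsum _ (wh_summable B) (wh_summable A)
  intro j
  exact mul_le_mul_of_nonneg_left (infDist_le_infDist_of_subset h A.nonempty) (by positivity)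

lemma wh_lip [Nonempty X] (A B : Hyper X) : wh A ≤ wh B + 2 * dist A B := by
  have h : Summable fun j : ℕ => (1 / 2 : ℝ) ^ j * dist A B := summable_geometric_two.mul_right _
  have : 2 * dist A B = ∑' j : ℕ, (1 / 2 : ℝ) ^ j * dist A B := by
    rw [tsum_mul_right, tsum_geometric_two]
  rw [this, wh, wh, ← (wh_summable B).tsum_add h]
  apply Summable.tsum_le_tsum _ (wh_summable A) ((wh_summable B).add h)
  intro j
  rw [← mul_add]
  exact mul_le_mul_of_nonneg_left (hyper_infDist_le A B _) (by positivity)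

lemma wh_cont [Nonempty X] : Continuous (wh : Hyper X → ℝ) := by
  apply LipschitzWith.continuous (K := 2)
  apply LipschitzWith.of_le_add_mul
  intro A B
  exact wh_lip A B

lemma wh_unif [Nonempty X] {ε : ℝ} (hε : 0 < ε) : ∃ η > 0, ∀ C B : Hyper X, (C : Set X) ⊆ B →
    wh C - wh B ≤ η → dist C B ≤ ε := by
  obtain ⟨T, hT⟩ := isCompact_univ.elim_finite_subcover
    (fun j : ℕ => ball (TopologicalSpace.denseSeq X j) (ε / 4)) (fun _ => isOpen_ball) (by
      intro x _
      obtain ⟨j, hj⟩ := (TopologicalSpace.denseRange_denseSeq X).exists_dist_lt x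
        (show 0 < ε / 4 by linarith)
      exact mem_iUnion.2 ⟨j, hj⟩)
  set N := T.sup id
  refine ⟨(1 / 2) ^ N * (ε / 4), by positivity, fun C B hCB hw => ?_⟩
  apply hyper_dist_le hε.le (fun a ha => ⟨a, hCB ha, by simp [hε.le]⟩)
  intro b hb
  obtain ⟨c, hc, hbc⟩ := C.isCompact.exists_infDist_eq_dist C.nonempty b
  refine ⟨c, hc, ?_⟩
  rw [← hbc]
  by_contra! hcon
  obtain ⟨j, hj, hbj⟩ := mem_iUnion₂.1 (hT (mem_univ b))
  have hjN : j ≤ N := Finset.le_sup (f := id) hj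
  rw [mem_ball] at hbj
  have h1 : infDist (TopologicalSpace.denseSeq X j) (B : Set X) ≤ ε / 4 :=
    (infDist_le_dist_of_mem hb).trans (by rw [dist_comm]; exact hbj.le)
  have h2 : infDist b (C : Set X) ≤ infDist (TopologicalSpace.denseSeq X j) (C : Set X) + ε / 4 :=
    infDist_le_infDist_add_dist.trans (add_le_add le_rfl hbj.le)
  have h3 : (1 / 2 : ℝ) ^ N ≤ (1 / 2) ^ j := pow_le_pow_of_le_one (by norm_num) (by norm_num) hjN
  have hsum : Summable fun j : ℕ => (1 / 2 : ℝ) ^ j *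
      (infDist (TopologicalSpace.denseSeq X j) (C : Set X) -
        infDist (TopologicalSpace.denseSeq X j) (B : Set X)) := by
    simpa only [mul_sub] using (wh_summable C).sub (wh_summable B)
  have h4 : (1 / 2 : ℝ) ^ j * (infDist (TopologicalSpace.denseSeq X j) (C : Set X) -
      infDist (TopologicalSpace.denseSeq X j) (B : Set X)) ≤ wh C - wh B := by
    rw [wh, wh, ← (wh_summable C).tsum_sub (wh_summable B)]
    simp only [← mul_sub]
    apply hsum.le_tsum j
    intro i _
    exact mul_nonneg (by positivity)
      (sub_nonneg.2 (infDist_le_infDist_of_subset hCB C.nonempty))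
  have h5 : (1 / 2 : ℝ) ^ j * (ε / 2) ≤ (1 / 2 : ℝ) ^ j *
      (infDist (TopologicalSpace.denseSeq X j) (C : Set X) -
      infDist (TopologicalSpace.denseSeq X j) (B : Set X)) :=
    mul_le_mul_of_nonneg_left (by linarith) (by positivity)
  have h6 : (1 / 2 : ℝ) ^ N * (ε / 2) ≤ (1 / 2 : ℝ) ^ j * (ε / 2) :=
    mul_le_mul_of_nonneg_right h3 (by linarith)
  have h7 : 0 < (1 / 2 : ℝ) ^ N * ε := by positivity
  nlinarith

lemma wh_strict [Nonempty X] {C B : Hyper X} (h : (C : Set X) ⊆ B) (hw : wh C ≤ wh B) : C = B := by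
  rw [← dist_le_zero]
  by_contra! hcon
  obtain ⟨η, hη, H⟩ := wh_unif (X := X) (half_pos hcon)
  have := H C B h (by linarith)
  linarith

lemma exists_shrink [Nonempty X] {A B : ↥(CSet X)} (hAB : car A ⊆ car B) {t : ℝ} (ht : 0 ≤ t)
    (htw : t ≤ wh A.1 - wh B.1) :
    ∃ C : ↥(CSet X), car A ⊆ car C ∧ car C ⊆ car B ∧ wh A.1 - wh C.1 = t := by
  set S : Set ↥(CSet X) := {C | car A ⊆ car C ∧ car C ⊆ car B ∧ wh A.1 - wh C.1 ≤ t} with hS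
  have hwc : Continuous fun C : ↥(CSet X) => wh C.1 := wh_cont.comp continuous_subtype_val
  have hScl : IsClosed S := by
    refine IsClosed.inter ?_ (IsClosed.inter ?_ (isClosed_le (continuous_const.sub hwc) continuous_const))
    · have : {C : ↥(CSet X) | car A ⊆ car C} = ⋂ p ∈ car A, {C : ↥(CSet X) | p ∈ ((C : Hyper X) : Set X)} := by
        ext C; simp [Set.subset_def]
      change IsClosed {C : ↥(CSet X) | car A ⊆ car C}
      rw [this]
      exact isClosed_biInter fun p _ => isClosed_mem_hyper p
    · exact (TopologicalSpace.NonemptyCompacts.isClosed_subsets_of_isClosed (car_closed B)).preimage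
        continuous_subtype_val
  obtain ⟨C, hC, hmin⟩ := hScl.isCompact.exists_isMinOn ⟨A, Subset.rfl, hAB, by simpa using ht⟩
    hwc.continuousOn
  refine ⟨C, hC.1, hC.2.1, le_antisymm hC.2.2 ?_⟩
  by_contra! hlt
  have hne : car C ≠ car B := by
    intro h
    rw [car_ext h] at hlt
    linarith
  set δ := t - (wh A.1 - wh C.1) with hδ
  have hδp : 0 < δ := by linarith
  obtain ⟨D, hDk, hDc, hCD, hDB, hDne, hDd⟩ := exists_bump (car_compact B)
    (car_conn B).isPreconnected (car_closed C) (car_conn C) hC.2.1 hne (show 0 < δ / 4 by linarith)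
  set D' := mkC D hDk hDc
  have hd : dist C D' ≤ δ / 4 := by
    apply c_dist_le (by linarith) (fun a ha => ⟨a, hCD ha, by simp; linarith⟩)
    intro b hb
    obtain ⟨c, hc, hbc⟩ := (car_compact C).exists_infDist_eq_dist (car_nonempty C) b
    exact ⟨c, hc, by rw [← hbc]; exact hDd b hb⟩
  have h1 : wh C.1 ≤ wh D'.1 + 2 * dist C D' := wh_lip C.1 D'.1
  have hDS : D' ∈ S := ⟨hC.1.trans hCD, hDB, by linarith⟩
  have h2 : wh C.1 ≤ wh D'.1 := hmin hDS
  have := wh_strict (C := C.1) (B := D'.1) hCD h2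
  apply hDne
  have h3 : C = D' := Subtype.ext this
  rw [h3]
  rfl

lemma ulc [LocallyConnectedSpace X] {σ : ℝ} (hσ : 0 < σ) : ∃ η > 0, ∀ x y : X, dist x y < η →
    ∃ S : Set X, IsPreconnected S ∧ x ∈ S ∧ y ∈ S ∧ S ⊆ ball x σ := by
  obtain ⟨η, hη, H⟩ := lebesgue_number_lemma_of_metric (s := (univ : Set X)) isCompact_univ
    (c := fun z : X => connectedComponentIn (ball z (σ / 2)) z)
    (fun z => isOpen_ball.connectedComponentIn)
    (fun z _ => mem_iUnion.2 ⟨z, mem_connectedComponentIn (mem_ball_self (half_pos hσ))⟩)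
  refine ⟨η, hη, fun x y hxy => ?_⟩
  obtain ⟨z, hz⟩ := H x (mem_univ x)
  have hx := hz (mem_ball_self hη)
  refine ⟨_, isPreconnected_connectedComponentIn, hx, hz (by rwa [mem_ball, dist_comm]), ?_⟩
  intro u hu
  have h1 := connectedComponentIn_subset _ _ hu
  have h2 := connectedComponentIn_subset _ _ hx
  rw [mem_ball] at *
  have := dist_triangle_right u x z
  linarith

/-- the growth set -/
def growSet [Nonempty X] (A : ↥(CSet X)) (t : ℝ) : Set X :=
  ⋃ B ∈ {B : Hyper X | B ∈ CSet X ∧ car A ⊆ B ∧ wh A.1 - wh B ≤ max t 0}, (B : Set X)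

lemma mem_growSet [Nonempty X] {A : ↥(CSet X)} {t : ℝ} (ht : 0 ≤ t) {y : X} :
    y ∈ growSet A t ↔ ∃ B : ↥(CSet X), car A ⊆ car B ∧ wh A.1 - wh B.1 ≤ t ∧ y ∈ car B := by
  rw [growSet, max_eq_left ht]
  simp only [mem_iUnion]
  constructor
  · rintro ⟨B, ⟨h1, h2, h3⟩, h4⟩; exact ⟨⟨B, h1⟩, h2, h3, h4⟩
  · rintro ⟨B, h2, h3, h4⟩; exact ⟨B.1, ⟨B.2, h2, h3⟩, h4⟩

lemma growSet_compact [Nonempty X] (A : ↥(CSet X)) (t : ℝ) : IsCompact (growSet A t) := by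
  apply TopologicalSpace.NonemptyCompacts.isCompact_biUnion_coe_of_isCompact
  apply IsClosed.isCompact
  refine isClosed_CSet.inter (IsClosed.inter ?_
    (isClosed_le (continuous_const.sub wh_cont) continuous_const))
  have : {C : Hyper X | car A ⊆ C} = ⋂ p ∈ car A, {C : Hyper X | ((C : Set X) ∩ {p}).Nonempty} := by
    ext C; simp [Set.subset_def]
  change IsClosed {C : Hyper X | car A ⊆ C}
  rw [this]
  exact isClosed_biInter fun p _ =>
    TopologicalSpace.NonemptyCompacts.isClosed_inter_nonempty_of_isClosed isClosed_singleton

lemma subset_growSet [Nonempty X] (A : ↥(CSet X)) (t : ℝ) : car A ⊆ growSet A t := by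
  intro a ha
  exact mem_biUnion (x := A.1) ⟨A.2, Subset.rfl, by simp⟩ ha

lemma growSet_conn [Nonempty X] (A : ↥(CSet X)) (t : ℝ) : IsConnected (growSet A t) := by
  obtain ⟨a, ha⟩ := car_nonempty A
  refine ⟨⟨a, subset_growSet A t ha⟩, ?_⟩
  apply isPreconnected_of_forall a
  intro y hy
  obtain ⟨B, hB, hyB⟩ := mem_iUnion₂.1 hy
  exact ⟨B, subset_biUnion_of_mem (u := fun B : Hyper X => (B : Set X)) hB, hB.2.1 ha, hyB,
    hB.1.isPreconnected⟩

def grow [Nonempty X] (A : ↥(CSet X)) (t : ℝ) : ↥(CSet X) :=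
  mkC (growSet A t) (growSet_compact A t) (growSet_conn A t)

lemma grow_zero [Nonempty X] (A : ↥(CSet X)) : grow A 0 = A := by
  apply car_ext
  apply Subset.antisymm _ (subset_growSet A 0)
  intro y hy
  obtain ⟨B, h1, h2, h3⟩ := (mem_growSet le_rfl).1 hy
  have := wh_strict (C := A.1) (B := B.1) h1 (by linarith)
  rw [Subtype.ext this]; exact h3

lemma exists_enlarge [LocallyConnectedSpace X] {σ : ℝ} (hσ : 0 < σ) : ∃ η > 0,
    ∀ A A' B : ↥(CSet X), car A ⊆ car B → dist A' A < η →
      ∃ B' : ↥(CSet X), car B ⊆ car B' ∧ car A' ⊆ car B' ∧ dist B B' ≤ σ := by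
  obtain ⟨η, hη, H⟩ := ulc (X := X) hσ
  refine ⟨η, hη, fun A A' B hAB hd => ?_⟩
  have h1 : ∀ a' : car A', ∃ S : Set X, IsPreconnected S ∧ (a' : X) ∈ S ∧ ∃ a ∈ car A, a ∈ S ∧ S ⊆ ball a σ := by
    intro a'
    obtain ⟨a, ha, hda⟩ := c_exists_lt hd a'.2
    obtain ⟨S, s1, s2, s3, s4⟩ := H a a' (by rwa [dist_comm])
    exact ⟨S, s1, s3, a, ha, s2, s4⟩
  choose S s1 s2 a s3 s4 s5 using h1
  obtain ⟨b, hb⟩ := car_nonempty B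
  set E : Set X := car B ∪ ⋃ a', S a' with hE
  have hEc : IsPreconnected E := by
    apply isPreconnected_of_forall b
    rintro y (hy | hy)
    · exact ⟨car B, subset_union_left, hb, hy, (car_conn B).isPreconnected⟩
    · obtain ⟨a', ha'⟩ := mem_iUnion.1 hy
      exact ⟨car B ∪ S a', union_subset_union_right _ (subset_iUnion _ _), Or.inl hb, Or.inr ha',
        (car_conn B).isPreconnected.union (a a') (hAB (s3 a')) (s4 a') (s1 a')⟩
  refine ⟨mkC (closure E) isClosed_closure.isCompact ⟨⟨b, subset_closure (Or.inl hb)⟩, hEc.closure⟩,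
    ?_, ?_, ?_⟩
  · exact subset_union_left.trans subset_closure
  · intro y hy
    exact subset_closure (Or.inr (mem_iUnion.2 ⟨⟨y, hy⟩, s2 ⟨y, hy⟩⟩))
  · apply c_dist_le hσ.le
    · intro y hy
      exact ⟨y, subset_closure (Or.inl hy), by simp [hσ.le]⟩
    · intro y hy
      obtain ⟨c, hc, hyc⟩ := (car_compact B).exists_infDist_eq_dist (car_nonempty B) y
      refine ⟨c, hc, ?_⟩
      rw [← hyc]
      have : closure E ⊆ {y | infDist y (car B) ≤ σ} := by
        apply closure_minimal _ (isClosed_le (continuous_infDist_pt _) continuous_const)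
        rintro y (hy | hy)
        · simp only [mem_ofPred_eq]; rw [infDist_zero_of_mem hy]; exact hσ.le
        · obtain ⟨a', ha'⟩ := mem_iUnion.1 hy
          have := s5 a' ha'
          exact (infDist_le_dist_of_mem (hAB (s3 a'))).trans (le_of_lt this)
      exact this hy

lemma grow_unif [Nonempty X] [LocallyConnectedSpace X] {ε : ℝ} (hε : 0 < ε) : ∃ δ > 0,
    ∀ (A A' : ↥(CSet X)) (t t' : ℝ), 0 ≤ t → 0 ≤ t' → dist A' A < δ → t ≤ t' + δ →
      ∀ y ∈ car (grow A t), ∃ y' ∈ car (grow A' t'), dist y y' ≤ ε := by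
  obtain ⟨η, hη, H⟩ := wh_unif (X := X) hε
  obtain ⟨δ, hδ, D⟩ := exists_enlarge (X := X) (σ := η / 8) (by linarith)
  refine ⟨min δ (η / 8), lt_min hδ (by linarith), fun A A' t t' ht ht' hd htt y hy => ?_⟩
  obtain ⟨B, h1, h2, h3⟩ := (mem_growSet ht).1 hy
  obtain ⟨B', b1, b2, b3⟩ := D A A' B h1 (hd.trans_le (min_le_left _ _))
  have e1 : min δ (η / 8) ≤ η / 8 := min_le_right _ _
  by_cases hcase : wh A'.1 - wh B'.1 ≤ t'
  · exact ⟨y, (mem_growSet ht').2 ⟨B', b2, hcase, b1 h3⟩, by simp [hε.le]⟩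
  · obtain ⟨C, c1, c2, c3⟩ := exists_shrink b2 ht' (not_le.1 hcase).le
    have w1 : wh A'.1 ≤ wh A.1 + 2 * dist A' A := wh_lip A'.1 A.1
    have w2 : wh B.1 ≤ wh B'.1 + 2 * dist B B' := wh_lip B.1 B'.1
    have := H C.1 B'.1 c2 (by linarith)
    obtain ⟨y', hy', hdy⟩ := c_exists_le (A := B') (B := C) (b1 h3)
    refine ⟨y', (mem_growSet ht').2 ⟨C, c1, c3.le, hy'⟩, hdy.trans ?_⟩
    rw [dist_comm]; exact this

lemma grow_continuous [Nonempty X] [LocallyConnectedSpace X] {S : Type*} [TopologicalSpace S]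
    {f : S → ↥(CSet X)} {t : S → ℝ} (hf : Continuous f) (ht : Continuous t) (h0 : ∀ x, 0 ≤ t x) :
    Continuous fun x => grow (f x) (t x) := by
  rw [continuous_iff_continuousAt]
  intro x
  rw [Metric.continuousAt_iff']
  intro ε hε
  obtain ⟨δ, hδ, H⟩ := grow_unif (X := X) (half_pos hε)
  have e1 := Metric.continuousAt_iff'.1 (hf.continuousAt (x := x)) δ hδ
  have e2 := Metric.continuousAt_iff'.1 (ht.continuousAt (x := x)) δ hδ
  filter_upwards [e1, e2] with y h1 h2
  rw [Real.dist_eq, abs_lt] at h2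
  refine lt_of_le_of_lt (c_dist_le (r := ε / 2) (by linarith) ?_ ?_) (by linarith)
  · exact H _ _ _ _ (h0 _) (h0 _) (by rwa [dist_comm]) (by linarith)
  · exact H _ _ _ _ (h0 _) (h0 _) h1 (by linarith)

/-- positive growth engulfs a neighbourhood, uniformly -/
lemma grow_engulf [Nonempty X] [LocallyConnectedSpace X] {t : ℝ} (ht : 0 < t) : ∃ κ > 0,
    ∀ (A : ↥(CSet X)) (y : X), infDist y (car A) < κ → y ∈ car (grow A t) := by
  obtain ⟨κ, hκ, H⟩ := ulc (X := X) (σ := t / 4) (by linarith)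
  refine ⟨κ, hκ, fun A y hy => ?_⟩
  obtain ⟨a, ha, hya⟩ := (infDist_lt_iff (car_nonempty A)).1 hy
  obtain ⟨S, s1, s2, s3, s4⟩ := H a y (by rwa [dist_comm])
  set B : Set X := car A ∪ closure S
  have hBc : IsConnected B := ⟨⟨a, Or.inl ha⟩,
    (car_conn A).isPreconnected.union a ha (subset_closure s2) s1.closure⟩
  have hBk : IsCompact B := (car_compact A).union isClosed_closure.isCompact
  have hd : dist A (mkC B hBk hBc) ≤ t / 4 := by
    apply c_dist_le (by linarith)
    · intro u hu; exact ⟨u, Or.inl hu, by simp; linarith⟩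
    · rintro u (hu | hu)
      · exact ⟨u, hu, by simp; linarith⟩
      · refine ⟨a, ha, ?_⟩
        have : u ∈ closedBall a (t / 4) := closure_minimal (s4.trans ball_subset_closedBall) isClosed_closedBall hu
        exact this
  refine (mem_growSet ht.le).2 ⟨mkC B hBk hBc, subset_union_left, ?_, Or.inr (subset_closure s3)⟩
  have : wh A.1 ≤ wh (mkC B hBk hBc).1 + 2 * dist A (mkC B hBk hBc) := wh_lip _ _
  linarith
end P3

section P4
set_option linter.unusedSectionVars false

section Model
variable {W : Type*} [NormedAddCommGroup W]

/-- radial room -/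
def pb (ρ : ℝ) (v : ℂ × W) : ℝ := max 0 (ρ - ‖v‖)
def pl (ρ : ℝ) (v : ℂ × W) : ℝ := if ‖v.1‖ ≤ pb ρ v then 1 else pb ρ v / ‖v.1‖
def pang (ρ : ℝ) (v : ℂ × W) (θ : ℝ) : ℝ := v.1.arg + Real.pi * (pl ρ v * θ)
def pmap (ρ : ℝ) (v : ℂ × W) (θ : ℝ) : ℂ × W :=
  (((‖v.1‖ + pb ρ v : ℝ) : ℂ) * Complex.exp ((pang ρ v θ : ℝ) * Complex.I), v.2)

lemma pb_nonneg (ρ : ℝ) (v : ℂ × W) : 0 ≤ pb ρ v := le_max_left _ _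

lemma pb_cont : Continuous fun p : ℝ × (ℂ × W) => pb p.1 p.2 := by
  unfold pb; fun_prop

lemma pmap_cont (ρ : ℝ) (v : ℂ × W) : Continuous (pmap ρ v) := by
  unfold pmap pang; fun_prop

/-- the push relation in the model -/
def pset (p : ℝ × (ℂ × W)) : Hyper (ℂ × W) :=
  ⟨⟨pmap p.1 p.2 '' Icc (-1) 1, isCompact_Icc.image (pmap_cont _ _)⟩,
    (nonempty_Icc.2 (by norm_num)).image _⟩

lemma mem_pset {p : ℝ × (ℂ × W)} {w : ℂ × W} :
    w ∈ (pset p : Set (ℂ × W)) ↔ ∃ θ ∈ Icc (-1 : ℝ) 1, pmap p.1 p.2 θ = w := Iff.rfl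

lemma pset_conn (p : ℝ × (ℂ × W)) : pset p ∈ CSet (ℂ × W) :=
  ⟨(pset p).nonempty, isPreconnected_Icc.image _ (pmap_cont _ _).continuousOn⟩

lemma norm_pmap (ρ : ℝ) (v : ℂ × W) (θ : ℝ) : ‖(pmap ρ v θ).1‖ = ‖v.1‖ + pb ρ v := by
  simp only [pmap, norm_mul, Complex.norm_exp_ofReal_mul_I, mul_one, Complex.norm_real,
    Real.norm_eq_abs]
  exact abs_of_nonneg (add_nonneg (norm_nonneg _) (pb_nonneg _ _))

lemma pset_ne_zero {ρ : ℝ} (hρ : 0 < ρ) (v : ℂ × W) : (0 : ℂ × W) ∉ (pset (ρ, v) : Set (ℂ × W)) := by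
  rintro ⟨θ, -, h⟩
  have h1 := norm_pmap ρ v θ
  have h2 : (pmap ρ v θ).2 = v.2 := rfl
  have h : pmap ρ v θ = 0 := h
  rw [h] at h1 h2
  simp only [Prod.fst_zero, norm_zero, Prod.snd_zero] at h1 h2
  have h3 := norm_nonneg v.1
  have h4 := pb_nonneg ρ v
  have h5 : v.1 = 0 := by rw [← norm_eq_zero]; linarith
  have h6 : v = 0 := Prod.ext h5 h2.symm
  have h7 : pb ρ v = 0 := by linarith
  rw [h6, pb, norm_zero, sub_zero, max_eq_right hρ.le] at h7
  linarith

lemma pset_of_le {ρ : ℝ} {v : ℂ × W} (h : ρ ≤ ‖v‖) : (pset (ρ, v) : Set (ℂ × W)) = {v} := by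
  have hb : pb ρ v = 0 := max_eq_left (by linarith)
  have key : ∀ θ, pmap ρ v θ = v := by
    intro θ
    refine Prod.ext ?_ rfl
    simp only [pmap, pang, pl, hb, add_zero]
    by_cases hz : v.1 = 0
    · simp [hz]
    · have : ¬ ‖v.1‖ ≤ 0 := by simpa using hz
      rw [if_neg this]
      simp
  ext w
  rw [mem_pset]
  simp only [key]
  constructor
  · rintro ⟨_, _, h⟩; exact h.symm
  · rintro h; exact ⟨0, by norm_num, h.symm⟩

lemma exists_theta (a φ : ℝ) : ∃ θ ∈ Icc (-1 : ℝ) 1,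
    Complex.exp (((a + Real.pi * θ : ℝ) : ℂ) * Complex.I) = Complex.exp ((φ : ℂ) * Complex.I) := by
  set z := Complex.exp (((φ - a : ℝ) : ℂ) * Complex.I)
  have hz : ‖z‖ = 1 := Complex.norm_exp_ofReal_mul_I _
  have hpi := Real.pi_pos
  refine ⟨z.arg / Real.pi, ⟨?_, ?_⟩, ?_⟩
  · rw [le_div_iff₀ hpi]; linarith [Complex.neg_pi_lt_arg z]
  · rw [div_le_iff₀ hpi]; linarith [Complex.arg_le_pi z]
  · rw [mul_div_cancel₀ _ hpi.ne']
    have h1 : Complex.exp (((z.arg : ℝ) : ℂ) * Complex.I) = z := by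
      have := Complex.norm_mul_exp_arg_mul_I z
      rwa [hz, Complex.ofReal_one, one_mul] at this
    push_cast
    rw [add_mul, Complex.exp_add, h1, ← Complex.exp_add]
    congr 1; push_cast; ring

lemma circ_dist (r s φ : ℝ) (u u' : W) :
    dist (((r : ℂ) * Complex.exp ((φ : ℂ) * Complex.I), u) : ℂ × W)
      ((s : ℂ) * Complex.exp ((φ : ℂ) * Complex.I), u') = max |r - s| (dist u u') := by
  rw [Prod.dist_eq]
  congr 1
  simp only
  rw [dist_eq_norm, ← sub_mul, norm_mul, Complex.norm_exp_ofReal_mul_I, mul_one,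
    ← Complex.ofReal_sub, Complex.norm_real, Real.norm_eq_abs]

set_option maxHeartbeats 1000000 in
lemma pset_cont : Continuous (pset : ℝ × (ℂ × W) → Hyper (ℂ × W)) := by
  rw [continuous_iff_continuousAt]
  rintro ⟨ρ₀, v₀⟩
  rw [Metric.continuousAt_iff']
  intro ε hε
  suffices h : ∀ᶠ p in 𝓝 (ρ₀, v₀), (∀ a ∈ (pset p : Set (ℂ × W)), ∃ b ∈ (pset (ρ₀, v₀) : Set (ℂ × W)), dist a b ≤ ε / 2) ∧
      ∀ b ∈ (pset (ρ₀, v₀) : Set (ℂ × W)), ∃ a ∈ (pset p : Set (ℂ × W)), dist b a ≤ ε / 2 by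
    filter_upwards [h] with p hp
    exact lt_of_le_of_lt (hyper_dist_le (by linarith) hp.1 hp.2) (by linarith)
  by_cases hz : v₀.1 = 0
  · -- center case
    have hc : Continuous fun p : ℝ × (ℂ × W) => ‖p.2.1‖ + pb p.1 p.2 :=
      (by fun_prop : Continuous fun p : ℝ × (ℂ × W) => ‖p.2.1‖).add pb_cont
    have hc2 : Continuous fun p : ℝ × (ℂ × W) => p.2.2 := by fun_prop
    have e1 := Metric.continuousAt_iff'.1 (hc.continuousAt (x := (ρ₀, v₀))) (ε / 2) (half_pos hε)
    have e2 := Metric.continuousAt_iff'.1 (hc2.continuousAt (x := (ρ₀, v₀))) (ε / 2) (half_pos hε)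
    have hr0 : ‖v₀.1‖ + pb ρ₀ v₀ = pb ρ₀ v₀ := by rw [hz]; simp
    have hl0 : pl ρ₀ v₀ = 1 := by rw [pl, if_pos]; rw [hz, norm_zero]; exact pb_nonneg _ _
    have up : ∀ p : ℝ × (ℂ × W), dist (‖p.2.1‖ + pb p.1 p.2) (‖v₀.1‖ + pb ρ₀ v₀) < ε / 2 →
        dist p.2.2 v₀.2 < ε / 2 →
        ∀ a ∈ (pset p : Set (ℂ × W)), ∃ b ∈ (pset (ρ₀, v₀) : Set (ℂ × W)), dist a b ≤ ε / 2 := by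
      rintro p h1 h2 _ ⟨θ, hθ, rfl⟩
      obtain ⟨θ', hθ', he⟩ := exists_theta v₀.1.arg (pang p.1 p.2 θ)
      refine ⟨_, ⟨θ', hθ', rfl⟩, ?_⟩
      simp only [pmap]
      have : pang ρ₀ v₀ θ' = v₀.1.arg + Real.pi * θ' := by rw [pang, hl0, one_mul]
      rw [this, he, circ_dist]
      exact max_le h1.le h2.le
    by_cases hb : pb ρ₀ v₀ = 0
    · filter_upwards [e1, e2] with p h1 h2
      refine ⟨up p h1 h2, ?_⟩
      rintro _ ⟨θ, hθ, rfl⟩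
      refine ⟨_, ⟨0, by norm_num, rfl⟩, ?_⟩
      simp only [pmap]
      have : (((‖v₀.1‖ + pb ρ₀ v₀ : ℝ) : ℂ) * Complex.exp ((pang ρ₀ v₀ θ : ℝ) * Complex.I), v₀.2) =
        ((((‖v₀.1‖ + pb ρ₀ v₀ : ℝ) : ℂ) * Complex.exp ((pang p.1 p.2 0 : ℝ) * Complex.I), v₀.2) : ℂ × W) := by
        rw [hr0, hb]; simp
      rw [this, circ_dist]
      exact max_le (by rw [abs_sub_comm]; exact h1.le) (by rw [dist_comm]; exact h2.le)
    · have hbp : 0 < pb ρ₀ v₀ := lt_of_le_of_ne (pb_nonneg _ _) (Ne.symm hb)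
      have hc3 : Continuous fun p : ℝ × (ℂ × W) => ‖p.2.1‖ := by fun_prop
      have e3 : ∀ᶠ p : ℝ × (ℂ × W) in 𝓝 (ρ₀, v₀), ‖p.2.1‖ < pb p.1 p.2 :=
        hc3.continuousAt.eventually_lt pb_cont.continuousAt (by simpa [hz] using hbp)
      filter_upwards [e1, e2, e3] with p h1 h2 h3
      refine ⟨up p h1 h2, ?_⟩
      rintro _ ⟨θ, hθ, rfl⟩
      obtain ⟨θ', hθ', he⟩ := exists_theta p.2.1.arg (pang ρ₀ v₀ θ)
      refine ⟨_, ⟨θ', hθ', rfl⟩, ?_⟩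
      simp only [pmap]
      have : pang p.1 p.2 θ' = p.2.1.arg + Real.pi * θ' := by
        rw [pang, pl, if_pos h3.le, one_mul]
      rw [this, he, circ_dist]
      exact max_le (by rw [abs_sub_comm]; exact h1.le) (by rw [dist_comm]; exact h2.le)
  · -- off center
    set Φ : (ℝ × (ℂ × W)) → ℝ → ℂ × W := fun p θ =>
      (((‖p.2.1‖ + pb p.1 p.2 : ℝ) : ℂ) * ((p.2.1 / (‖p.2.1‖ : ℂ)) *
        Complex.exp (((Real.pi * (min 1 (pb p.1 p.2 / ‖p.2.1‖) * θ) : ℝ) : ℂ) * Complex.I)), p.2.2) with hΦ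
    have hev : ∀ p : ℝ × (ℂ × W), p.2.1 ≠ 0 → ∀ θ, pmap p.1 p.2 θ = Φ p θ := by
      intro p hp θ
      have hpos : 0 < ‖p.2.1‖ := norm_pos_iff.2 hp
      refine Prod.ext ?_ rfl
      simp only [pmap, hΦ, pang]
      congr 1
      have hl : pl p.1 p.2 = min 1 (pb p.1 p.2 / ‖p.2.1‖) := by
        rw [pl]
        split_ifs with h
        · rw [min_eq_left]; rwa [le_div_iff₀ hpos, one_mul]
        · rw [min_eq_right]; rw [div_le_iff₀ hpos, one_mul]; exact (not_le.1 h).le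
      rw [hl]
      push_cast
      rw [add_mul, Complex.exp_add]
      congr 1
      have := Complex.norm_mul_exp_arg_mul_I p.2.1
      have h0 : (‖p.2.1‖ : ℂ) ≠ 0 := by exact_mod_cast hpos.ne'
      rw [eq_div_iff h0, mul_comm]
      exact this
    have hcont : ∀ θ₀, ContinuousAt (fun q : (ℝ × (ℂ × W)) × ℝ => Φ q.1 q.2) ((ρ₀, v₀), θ₀) := by
      intro θ₀
      have hn : ‖v₀.1‖ ≠ 0 := norm_ne_zero_iff.2 hz
      have hpbc : Continuous fun q : (ℝ × (ℂ × W)) × ℝ => pb q.1.1 q.1.2 := pb_cont.comp continuous_fst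
      have hnc : Continuous fun q : (ℝ × (ℂ × W)) × ℝ => ‖q.1.2.1‖ := by fun_prop
      have hzc : Continuous fun q : (ℝ × (ℂ × W)) × ℝ => q.1.2.1 := by fun_prop
      have hwc : Continuous fun q : (ℝ × (ℂ × W)) × ℝ => q.1.2.2 := by fun_prop
      have k1 : ContinuousAt (fun q : (ℝ × (ℂ × W)) × ℝ => pb q.1.1 q.1.2 / ‖q.1.2.1‖) ((ρ₀, v₀), θ₀) :=
        hpbc.continuousAt.div hnc.continuousAt hn
      have k2 : ContinuousAt (fun q : (ℝ × (ℂ × W)) × ℝ => q.1.2.1 / (‖q.1.2.1‖ : ℂ)) ((ρ₀, v₀), θ₀) :=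
        hzc.continuousAt.div (Complex.continuous_ofReal.comp hnc).continuousAt (by exact_mod_cast hn)
      refine ContinuousAt.prodMk ?_ hwc.continuousAt
      refine ContinuousAt.mul (Complex.continuous_ofReal.comp (hnc.add hpbc)).continuousAt ?_
      refine k2.mul ?_
      refine Complex.continuous_exp.continuousAt.comp ?_
      refine ContinuousAt.mul ?_ continuousAt_const
      refine Complex.continuous_ofReal.continuousAt.comp ?_
      exact continuousAt_const.mul ((continuousAt_const.min k1).mul continuous_snd.continuousAt)
    clear_value Φ
    have hu : ∀ᶠ p in 𝓝 (ρ₀, v₀), ∀ θ ∈ Icc (-1 : ℝ) 1, dist (Φ p θ) (Φ (ρ₀, v₀) θ) < ε / 2 := by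
      apply isCompact_Icc.eventually_forall_of_forall_eventually
      intro θ₀ _
      have hc0 : Continuous fun q : (ℝ × (ℂ × W)) × ℝ => (((ρ₀, v₀), q.2) : (ℝ × (ℂ × W)) × ℝ) := by fun_prop
      have hcc : ContinuousAt (fun q : (ℝ × (ℂ × W)) × ℝ => Φ (ρ₀, v₀) q.2) ((ρ₀, v₀), θ₀) :=
        ContinuousAt.comp_of_eq (f := fun q : (ℝ × (ℂ × W)) × ℝ => (((ρ₀, v₀), q.2) : (ℝ × (ℂ × W)) × ℝ))
          (hcont θ₀) hc0.continuousAt rfl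
      have := (hcont θ₀).dist hcc
      exact this.eventually_lt continuousAt_const (by simpa using half_pos hε)
    have hne : ∀ᶠ p : ℝ × (ℂ × W) in 𝓝 (ρ₀, v₀), p.2.1 ≠ 0 :=
      (by fun_prop : Continuous fun p : ℝ × (ℂ × W) => p.2.1).continuousAt.eventually_ne hz
    filter_upwards [hu, hne] with p hp hp0
    constructor
    · rintro _ ⟨θ, hθ, rfl⟩
      refine ⟨_, ⟨θ, hθ, rfl⟩, ?_⟩
      have := hp θ hθ
      rw [← hev p hp0, ← hev _ hz] at this
      exact this.le
    · rintro _ ⟨θ, hθ, rfl⟩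
      refine ⟨_, ⟨θ, hθ, rfl⟩, ?_⟩
      have := hp θ hθ
      rw [← hev p hp0, ← hev _ hz, dist_comm] at this
      exact this.le
end Model

section Rel
variable {X : Type*} [MetricSpace X]

lemma rel_compact {ψ : X → Hyper X} (hψ : Continuous ψ) (A : ↥(CSet X)) :
    IsCompact (⋃ x ∈ car A, (ψ x : Set X)) := by
  have := TopologicalSpace.NonemptyCompacts.isCompact_biUnion_coe_of_isCompact
    ((car_compact A).image hψ)
  rwa [biUnion_image] at this

lemma rel_conn {ψ : X → Hyper X} (hψ : Continuous ψ) (hc : ∀ x, ψ x ∈ CSet X) (A : ↥(CSet X)) :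
    IsConnected (⋃ x ∈ car A, (ψ x : Set X)) := by
  obtain ⟨a, ha⟩ := car_nonempty A
  refine ⟨?_, ?_⟩
  · obtain ⟨y, hy⟩ := (ψ a).nonempty
    exact ⟨y, mem_biUnion ha hy⟩
  · letI : TopologicalSpace (Set X) := TopologicalSpace.vietoris X
    exact TopologicalSpace.vietoris.isPreconnected_biUnion (car_conn A).isPreconnected
      (TopologicalSpace.NonemptyCompacts.continuous_coe.comp hψ).continuousOn
      ⟨a, ha, (hc a).isPreconnected⟩

def relIm (ψ : X → Hyper X) (hψ : Continuous ψ) (hc : ∀ x, ψ x ∈ CSet X) (A : ↥(CSet X)) :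
    ↥(CSet X) :=
  mkC (⋃ x ∈ car A, (ψ x : Set X)) (rel_compact hψ A) (rel_conn hψ hc A)

lemma mem_relIm {ψ : X → Hyper X} {hψ : Continuous ψ} {hc : ∀ x, ψ x ∈ CSet X} {A : ↥(CSet X)}
    {y : X} : y ∈ car (relIm ψ hψ hc A) ↔ ∃ x ∈ car A, y ∈ (ψ x : Set X) := by
  rw [relIm, car_mkC]; simp

lemma relIm_cont [CompactSpace X] {T : Type*} [TopologicalSpace T] {ψ : T × X → Hyper X}
    (hψ : Continuous ψ) (hc : ∀ p, ψ p ∈ CSet X) :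
    Continuous fun p : T × ↥(CSet X) => relIm (fun x => ψ (p.1, x)) (by fun_prop)
      (fun x => hc _) p.2 := by
  rw [continuous_iff_continuousAt]
  rintro ⟨t₀, A₀⟩
  rw [Metric.continuousAt_iff']
  intro ε hε
  have huc : UniformContinuous fun x => ψ (t₀, x) :=
    CompactSpace.uniformContinuous_of_continuous (by fun_prop)
  obtain ⟨δ, hδ, hu⟩ := Metric.uniformContinuous_iff.1 huc (ε / 4) (by linarith)
  have e1 : ∀ᶠ t in 𝓝 t₀, ∀ x ∈ (univ : Set X), dist (ψ (t, x)) (ψ (t₀, x)) < ε / 4 := by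
    apply isCompact_univ.eventually_forall_of_forall_eventually
    intro x _
    have : Continuous fun q : T × X => dist (ψ (q.1, q.2)) (ψ (t₀, q.2)) := by fun_prop
    exact this.continuousAt.eventually_lt continuousAt_const (by simp; linarith)
  have e1' := (continuous_fst.continuousAt (x := (t₀, A₀))).eventually e1
  have e2 : ∀ᶠ p : T × ↥(CSet X) in 𝓝 (t₀, A₀), dist p.2 A₀ < δ :=
    Metric.continuousAt_iff'.1 continuous_snd.continuousAt δ hδ
  filter_upwards [e1', e2] with p h1 h2
  have key : ∀ x x' : X, dist x x' < δ → dist (ψ (p.1, x)) (ψ (t₀, x')) < ε / 2 := by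
    intro x x' hx
    have := dist_triangle (ψ (p.1, x)) (ψ (t₀, x)) (ψ (t₀, x'))
    have a1 := h1 x (mem_univ x)
    have a2 : dist (ψ (t₀, x)) (ψ (t₀, x')) < ε / 4 := hu hx
    linarith
  refine lt_of_le_of_lt (c_dist_le (r := ε / 2) (by linarith) ?_ ?_) (by linarith)
  · intro y hy
    obtain ⟨x, hx, hyx⟩ := mem_relIm.1 hy
    obtain ⟨x', hx', hd⟩ := c_exists_lt h2 hx
    obtain ⟨y', hy', hyd⟩ := hyper_exists_lt (key x x' hd) hyx
    exact ⟨y', mem_relIm.2 ⟨x', hx', hy'⟩, hyd.le⟩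
  · intro y hy
    obtain ⟨x, hx, hyx⟩ := mem_relIm.1 hy
    obtain ⟨x', hx', hd⟩ := c_exists_lt (by rwa [dist_comm] at h2) hx
    have := key x' x (by rwa [dist_comm])
    rw [dist_comm] at this
    obtain ⟨y', hy', hyd⟩ := hyper_exists_lt this hyx
    exact ⟨y', mem_relIm.2 ⟨x', hx', hy'⟩, hyd.le⟩

variable {W : Type*} [NormedAddCommGroup W] [NormedSpace ℝ W] [ProperSpace W]

open Classical in
def psiX (e : ℂ × W → X) (he : IsOpenEmbedding e) (p : ℝ × X) : Hyper X :=
  if h : p.2 ∈ range e then (pset (max 0 (min p.1 1), h.choose)).map e he.continuous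
  else {p.2}

lemma psiX_e {e : ℂ × W → X} (he : IsOpenEmbedding e) (ρ : ℝ) (v : ℂ × W) :
    psiX e he (ρ, e v) = (pset (max 0 (min ρ 1), v)).map e he.continuous := by
  have h : e v ∈ range e := ⟨v, rfl⟩
  rw [psiX, dif_pos h]
  have : h.choose = v := he.injective h.choose_spec
  simp only [this]

lemma psiX_off {e : ℂ × W → X} (he : IsOpenEmbedding e) (ρ : ℝ) {x : X} (hx : x ∉ range e) :
    psiX e he (ρ, x) = {x} := by
  rw [psiX, dif_neg hx]

lemma psiX_e_of_le {e : ℂ × W → X} (he : IsOpenEmbedding e) {ρ : ℝ} {v : ℂ × W}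
    (h : max 0 (min ρ 1) ≤ ‖v‖) : psiX e he (ρ, e v) = {e v} := by
  rw [psiX_e]
  apply SetLike.coe_injective
  change e '' (pset (max 0 (min ρ 1), v) : Set (ℂ × W)) = _
  rw [pset_of_le h]
  simp

lemma psiX_conn {e : ℂ × W → X} (he : IsOpenEmbedding e) (p : ℝ × X) : psiX e he p ∈ CSet X := by
  obtain ⟨ρ, x⟩ := p
  by_cases hx : x ∈ range e
  · obtain ⟨v, rfl⟩ := hx
    rw [psiX_e]
    exact IsConnected.image (pset_conn (max 0 (min ρ 1), v)) e he.continuous.continuousOn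
  · rw [psiX_off he ρ hx]
    exact isConnected_singleton

lemma psiX_cont {e : ℂ × W → X} (he : IsOpenEmbedding e) : Continuous (psiX e he) := by
  rw [continuous_iff_continuousAt]
  rintro ⟨ρ, x⟩
  by_cases hx : x ∈ range e
  · obtain ⟨v, rfl⟩ := hx
    have h1 : IsOpenEmbedding (Prod.map id e : ℝ × (ℂ × W) → ℝ × X) :=
      IsOpenEmbedding.id.prodMap he
    have h2 := h1.continuousAt_iff (g := psiX e he) (x := (ρ, v))
    refine h2.1 ?_
    have : psiX e he ∘ Prod.map id e = fun p : ℝ × (ℂ × W) =>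
        (pset (max 0 (min p.1 1), p.2)).map e he.continuous := by
      funext p
      exact psiX_e he p.1 p.2
    rw [this]
    apply Continuous.continuousAt
    refine he.continuous.nonemptyCompacts_map.comp (pset_cont.comp ?_)
    fun_prop
  · have hK : IsClosed (e '' closedBall 0 1) := ((isCompact_closedBall 0 1).image he.continuous).isClosed
    have hx' : x ∈ (e '' closedBall 0 1)ᶜ := fun h => hx (image_subset_range _ _ h)
    have : psiX e he =ᶠ[𝓝 (ρ, x)] fun p => {p.2} := by
      have := (continuous_snd.continuousAt (x := (ρ, x))).eventually (hK.isOpen_compl.mem_nhds hx')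
      filter_upwards [this] with p hp
      by_cases hpr : p.2 ∈ range e
      · obtain ⟨v, hv⟩ := hpr
        have hv1 : 1 < ‖v‖ := by
          by_contra! hcon
          exact hp ⟨v, by simpa using hcon, hv⟩
        have := psiX_e_of_le he (ρ := p.1) (v := v)
          ((max_le (by linarith) (min_le_right _ _)).trans hv1.le)
        rw [hv] at this
        exact this
      · exact psiX_off he p.1 hpr
    refine ContinuousAt.congr ?_ this.symm
    exact (TopologicalSpace.NonemptyCompacts.continuous_singleton.comp continuous_snd).continuousAt

/-- push-off -/
def push (e : ℂ × W → X) (he : IsOpenEmbedding e) (ρ : ℝ) (A : ↥(CSet X)) : ↥(CSet X) :=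
  relIm (fun x => psiX e he (ρ, x)) ((psiX_cont he).comp (by fun_prop)) (fun _ => psiX_conn he _) A

lemma mem_push {e : ℂ × W → X} {he : IsOpenEmbedding e} {ρ : ℝ} {A : ↥(CSet X)} {y : X} :
    y ∈ car (push e he ρ A) ↔ ∃ x ∈ car A, y ∈ (psiX e he (ρ, x) : Set X) := mem_relIm

lemma push_cont [CompactSpace X] {e : ℂ × W → X} (he : IsOpenEmbedding e) :
    Continuous fun p : ℝ × ↥(CSet X) => push e he p.1 p.2 :=
  relIm_cont (psiX_cont he) (psiX_conn he)

lemma push_zero {e : ℂ × W → X} (he : IsOpenEmbedding e) (A : ↥(CSet X)) : push e he 0 A = A := by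
  have : ∀ x, psiX e he (0, x) = {x} := by
    intro x
    by_cases hx : x ∈ range e
    · obtain ⟨v, rfl⟩ := hx
      exact psiX_e_of_le he (by simp)
    · exact psiX_off he 0 hx
  apply car_ext
  ext y
  rw [mem_push]
  simp [this]

lemma push_avoid {e : ℂ × W → X} (he : IsOpenEmbedding e) {ρ : ℝ} (hρ : 0 < ρ) (A : ↥(CSet X)) :
    e 0 ∉ car (push e he ρ A) := by
  rw [mem_push]
  rintro ⟨x, -, hx⟩
  by_cases hxr : x ∈ range e
  · obtain ⟨v, rfl⟩ := hxr
    rw [psiX_e] at hx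
    obtain ⟨w, hw, h⟩ := hx
    have : w = 0 := he.injective h
    subst this
    exact pset_ne_zero (lt_max_of_lt_right (lt_min hρ one_pos)) v hw
  · rw [psiX_off he ρ hxr] at hx
    exact hxr ⟨0, hx⟩

lemma push_keep {e : ℂ × W → X} (he : IsOpenEmbedding e) {p : X} (hp : p ≠ e 0) :
    ∃ r > 0, ∀ ρ < r, ∀ A : ↥(CSet X), p ∈ car A → p ∈ car (push e he ρ A) := by
  by_cases hpr : p ∈ range e
  · obtain ⟨v, rfl⟩ := hpr
    have hv : 0 < ‖v‖ := norm_pos_iff.2 fun h => hp (by rw [h])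
    refine ⟨‖v‖, hv, fun ρ hρ A hA => mem_push.2 ⟨_, hA, ?_⟩⟩
    rw [psiX_e_of_le he (max_le hv.le ((min_le_left _ _).trans hρ.le))]
    rfl
  · refine ⟨1, one_pos, fun ρ _ A hA => mem_push.2 ⟨_, hA, ?_⟩⟩
    rw [psiX_off he ρ hpr]
    rfl
end Rel

/-- charts -/
lemma exists_chart {X : Type*} [TopologicalSpace X] {n : ℕ} (hE : PiEuclidean X n) (hn : 2 ≤ n)
    (E : Type*) [NormedAddCommGroup E] [NormedSpace ℝ E] [FiniteDimensional ℝ E]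
    (hdim : Module.finrank ℝ E = n) {V : Set X} (hV : IsOpen V) (hVne : V.Nonempty)
    {P : Set X} (hP : P.Countable) :
    ∃ e : E → X, IsOpenEmbedding e ∧ e 0 ∈ V ∧ e 0 ∉ P := by
  obtain ⟨𝓤, h1, h2⟩ := hE
  obtain ⟨U, hU, hUV⟩ := h2 V hV hVne
  obtain ⟨hUo, hUne, ⟨φ⟩⟩ := h1 U hU
  have L : E ≃L[ℝ] (Fin n → ℝ) := ContinuousLinearEquiv.ofFinrankEq (by simpa using hdim)
  set e₀ : E → X := fun v => (φ.symm (L v) : X) with he₀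
  have he₀o : IsOpenEmbedding e₀ := hUo.isOpenEmbedding_subtypeVal.comp
    (φ.symm.isOpenEmbedding.comp L.toHomeomorph.isOpenEmbedding)
  have : Nontrivial E := by
    apply Module.nontrivial_of_finrank_pos (R := ℝ)
    omega
  have hc : (e₀ ⁻¹' P).Countable := hP.preimage he₀o.injective
  have hd := hc.dense_compl ℝ
  obtain ⟨v, hv⟩ := hd.nonempty
  refine ⟨fun u => e₀ (u + v), he₀o.comp (Homeomorph.addRight v).isOpenEmbedding, ?_, ?_⟩
  · exact hUV (Subtype.coe_prop _)
  · simpa using hv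
end P4

section P5

lemma IsZSet.mono {Q : Type*} [MetricSpace Q] {A B : Set Q} (hA : IsZSet A) (hB : IsClosed B)
    (h : B ⊆ A) : IsZSet B :=
  ⟨hB, fun ε hε => by
    obtain ⟨f, h1, h2, h3⟩ := hA.2 ε hε
    exact ⟨f, h1, h2, fun x hx => h3 x (h hx)⟩⟩

lemma isZSet_of_subset_iUnion {Q : Type*} [MetricSpace Q] [CompactSpace Q] {A : Set Q}
    (hA : IsClosed A) {Z : ℕ → Set Q} (hZ : ∀ i, IsZSet (Z i)) (h : A ⊆ ⋃ i, Z i) : IsZSet A := by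
  refine ⟨hA, fun ε hε => ?_⟩
  have hd : Dense (⋂ i, {f : C(Q, Q) | MapsTo f univ (Z i)ᶜ}) := by
    apply dense_iInter_of_isOpen_nat
    · intro i
      exact ContinuousMap.isOpen_setOfPred_mapsTo isCompact_univ (hZ i).1.isOpen_compl
    · intro i
      rw [Metric.dense_iff]
      intro f r hr
      obtain ⟨g, g1, g2, g3⟩ := (hZ i).2 r hr
      refine ⟨⟨fun x => g (f x), g1.comp f.continuous⟩, ?_, ?_⟩
      · rw [mem_ball, ContinuousMap.dist_lt_iff hr]
        intro x
        exact g2 (f x)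
      · intro x _
        exact g3 (f x)
  obtain ⟨f, hf, hfd⟩ := hd.exists_dist_lt (ContinuousMap.id Q) hε
  refine ⟨f, f.continuous, fun x => ?_, fun x hx => ?_⟩
  · have := (ContinuousMap.dist_lt_iff hε).1 hfd x
    rw [dist_comm]
    exact this
  · obtain ⟨i, hi⟩ := mem_iUnion.1 (h hx)
    exact mem_iInter.1 hf i (mem_univ x) hi

variable {X : Type*} [MetricSpace X] [CompactSpace X]
variable {W : Type*} [NormedAddCommGroup W] [NormedSpace ℝ W] [ProperSpace W]

lemma push_small {e : ℂ × W → X} (he : IsOpenEmbedding e) {ε : ℝ} (hε : 0 < ε) :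
    ∃ r > 0, ∀ ρ, 0 < ρ → ρ < r → ∀ A, dist (push e he ρ A) A < ε := by
  have : ∀ᶠ ρ in 𝓝 (0 : ℝ), ∀ A ∈ (univ : Set ↥(CSet X)), dist (push e he ρ A) A < ε := by
    apply isCompact_univ.eventually_forall_of_forall_eventually
    intro A _
    have hc : Continuous fun q : ℝ × ↥(CSet X) => dist (push e he q.1 q.2) q.2 :=
      (push_cont he).dist continuous_snd
    exact hc.continuousAt.eventually_lt continuousAt_const (by simpa [push_zero] using hε)
  obtain ⟨r, hr, h⟩ := Metric.eventually_nhds_iff.1 this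
  refine ⟨r, hr, fun ρ h0 h1 A => h ?_ A (mem_univ A)⟩
  rw [Real.dist_eq, sub_zero, abs_of_pos h0]; exact h1

lemma isZSet_mem {e : ℂ × W → X} (he : IsOpenEmbedding e) :
    IsZSet {A : ↥(CSet X) | e 0 ∈ car A} := by
  refine ⟨isClosed_mem_hyper _, fun ε hε => ?_⟩
  obtain ⟨r, hr, h⟩ := push_small he hε
  have hc : Continuous (push e he (r / 2)) :=
    (push_cont he).comp (f := fun A : ↥(CSet X) => ((r / 2 : ℝ), A))
      (Continuous.prodMk continuous_const continuous_id)
  have hr2 : 0 < r / 2 := half_pos hr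
  exact ⟨push e he (r / 2), hc, h (r / 2) hr2 (half_lt_self hr), fun A => push_avoid he hr2 A⟩

lemma isZSet_mem' {n : ℕ} (hn : 2 ≤ n) {E : Type*} [NormedAddCommGroup E] [NormedSpace ℝ E]
    [FiniteDimensional ℝ E] (hdim : Module.finrank ℝ E = n) {e : E → X} (he : IsOpenEmbedding e) :
    IsZSet {A : ↥(CSet X) | e 0 ∈ car A} := by
  have L : (ℂ × (Fin (n - 2) → ℝ)) ≃L[ℝ] E := ContinuousLinearEquiv.ofFinrankEq (by
    rw [Module.finrank_prod, hdim]; simp; omega)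
  have := isZSet_mem (he.comp L.toHomeomorph.isOpenEmbedding)
  simpa using this

/-- countable dense set of Euclidean points avoiding a countable set, with charts,
pairwise distinct -/
lemma exists_charts {n : ℕ} [Nonempty X] (hE : PiEuclidean X n) (hn : 2 ≤ n)
    (E : Type*) [NormedAddCommGroup E] [NormedSpace ℝ E] [FiniteDimensional ℝ E]
    (hdim : Module.finrank ℝ E = n) {P : Set X} (hP : P.Countable) :
    ∃ e : ℕ → E → X, (∀ i, IsOpenEmbedding (e i)) ∧ (∀ V : Set X, IsOpen V → V.Nonempty →
      ∃ i, e i 0 ∈ V) ∧ (∀ i, e i 0 ∉ P) ∧ Function.Injective fun i => e i 0 := by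
  obtain ⟨B, hBc, hBne, hB⟩ := TopologicalSpace.exists_countable_basis X
  have hBn : B.Nonempty := by
    obtain ⟨x⟩ := ‹Nonempty X›
    obtain ⟨b, hb, -⟩ := hB.exists_subset_of_mem_open (mem_univ x) isOpen_univ
    exact ⟨b, hb⟩
  obtain ⟨b, hb⟩ := hBc.exists_eq_range hBn
  have hbB : ∀ i, b i ∈ B := fun i => by rw [hb]; exact mem_range_self i
  have step : ∀ (i : ℕ) (F : Finset X), ∃ e : E → X, IsOpenEmbedding e ∧ e 0 ∈ b i ∧ e 0 ∉ P ∪ F := by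
    intro i F
    refine exists_chart hE hn E hdim (hB.isOpen (hbB i)) ?_ (hP.union F.countable_toSet)
    rw [nonempty_iff_ne_empty]
    intro h
    exact hBne (h ▸ hbB i)
  choose c c1 c2 c3 using step
  classical
  let S : ℕ → Finset X := fun k => Nat.rec ∅ (fun k F => insert (c k F 0) F) k
  have hS : ∀ k, S (k + 1) = insert (c k (S k) 0) (S k) := fun k => rfl
  have hSm : Monotone S := monotone_nat_of_le_succ fun k => by
    rw [hS]; exact Finset.subset_insert _ _
  refine ⟨fun k => c k (S k), fun k => c1 _ _, ?_, fun k h => c3 k (S k) (Or.inl h), ?_⟩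
  · intro V hV hVne
    obtain ⟨x, hx⟩ := hVne
    obtain ⟨u, hu, -, huV⟩ := hB.exists_subset_of_mem_open hx hV
    rw [hb] at hu
    obtain ⟨i, rfl⟩ := hu
    exact ⟨i, huV (c2 _ _)⟩
  · have : ∀ i j, i < j → c i (S i) 0 ≠ c j (S j) 0 := by
      intro i j hij h
      apply c3 j (S j)
      right
      rw [← h]
      have h1 : c i (S i) 0 ∈ S (i + 1) := by rw [hS]; exact Finset.mem_insert_self _ _
      exact hSm hij h1
    intro i j hij
    rcases lt_trichotomy i j with h | h | h
    · exact absurd hij (this i j h)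
    · exact h
    · exact absurd hij.symm (this j i h)

lemma sigmaZ_cover {n : ℕ} [ConnectedSpace X] [LocallyConnectedSpace X] (huc : Unicoherent X)
    (hE : PiEuclidean X n) (hn : 2 ≤ n) :
    ∃ Z : Set ↥(CSet X), IsSigmaZSet Z ∧ {A : ↥(CSet X) | (A : Hyper X) ∉ CBSet X} ⊆ Z := by
  obtain ⟨e, h1, h2, -, -⟩ := exists_charts hE hn (Fin n → ℝ) (by simp) countable_empty
  refine ⟨_, ⟨fun i => {A : ↥(CSet X) | e i 0 ∈ car A}, fun i => isZSet_mem' hn (by simp) (h1 i), rfl⟩, ?_⟩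
  intro A hA
  obtain ⟨i, hi⟩ := h2 _ isOpen_interior (nonCB_interior huc A.2 hA)
  exact mem_iUnion.2 ⟨i, show e i 0 ∈ car A from interior_subset hi⟩
end P5

section P6
set_option linter.unusedSectionVars false
variable {W : Type} [NormedAddCommGroup W] [NormedSpace ℝ W]

def ca (i : ℕ) : ℝ := (1 / 2) ^ (i + 1)
def ch (i : ℕ) : ℝ := (1 / 2) ^ (i + 5)

lemma ch_pos (i : ℕ) : 0 < ch i := by unfold ch; positivity
lemma ca_eq (i : ℕ) : ca i = 16 * ch i := by unfold ca ch; rw [pow_succ, pow_add]; norm_num; ring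
lemma ca_le (i : ℕ) : ca i ≤ 1 / 2 := by
  unfold ca; rw [pow_succ]
  have : ((1 : ℝ) / 2) ^ i ≤ 1 := pow_le_one₀ (by norm_num) (by norm_num)
  linarith
lemma ch_lt {i j : ℕ} (h : i < j) : ch j ≤ ch i / 2 := by
  have : ch (i + 1) = ch i / 2 := by
    unfold ch; rw [show i + 1 + 5 = i + 5 + 1 by ring, pow_succ]; ring
  rw [← this]; unfold ch
  exact pow_le_pow_of_le_one (by norm_num) (by norm_num) (by omega)
lemma strips {i j : ℕ} (h : i ≠ j) {x : ℝ} (hi : |x - ca i| < 2 * ch i) : ch j ≤ |x - ca j| := by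
  by_contra hj
  push Not at hj
  rw [abs_lt] at hi hj
  have h1 := ca_eq i; have h2 := ca_eq j
  have := ch_pos i; have := ch_pos j
  rcases lt_or_gt_of_ne h with h | h
  · have := ch_lt h; linarith
  · have := ch_lt h; linarith

def cP (w : ℝ × W) : ℝ := 1 - 2 * ‖w‖
def cT (w : ℝ × W) : ℝ := 1 - 2 * max (-w.1) ‖w.2‖
lemma cP_le (w : ℝ × W) : cP w ≤ 1 := by unfold cP; linarith [norm_nonneg w]
lemma cT_le (w : ℝ × W) : cT w ≤ 1 := by
  unfold cT; linarith [le_max_right (-w.1) ‖w.2‖, norm_nonneg w.2]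
lemma cP_le_cT (w : ℝ × W) : cP w ≤ cT w := by
  unfold cP cT
  have : max (-w.1) ‖w.2‖ ≤ ‖w‖ :=
    max_le ((neg_le_abs w.1).trans (norm_fst_le w)) (norm_snd_le w)
  linarith
@[fun_prop] lemma cP_cont : Continuous (cP : ℝ × W → ℝ) := by unfold cP; fun_prop
@[fun_prop] lemma cT_cont : Continuous (cT : ℝ × W → ℝ) := by unfold cT; fun_prop

/-- width of the hole number `i` at height `w` -/
def cm (y z : Iinf) (i : ℕ) (w : ℝ × W) : ℝ :=
  max ((1 + (y i : ℝ)) / 2 * cP w) ((z i : ℝ) / 4 * cT w)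
@[fun_prop] lemma cm_cont (y z : Iinf) (i : ℕ) : Continuous (cm y z i : ℝ × W → ℝ) := by
  unfold cm; fun_prop
lemma cm_le_max (y z : Iinf) (i : ℕ) (w : ℝ × W) : cm y z i w ≤ (1 + (y i : ℝ)) / 2 := by
  have h1 := (y i).2.1; have h2 := (z i).2.1; have h3 := (z i).2.2
  unfold cm
  apply max_le
  · nlinarith [cP_le w]
  · nlinarith [cT_le w]
lemma cm_le (y z : Iinf) (i : ℕ) (w : ℝ × W) : cm y z i w ≤ 1 :=
  (cm_le_max y z i w).trans (by linarith [(y i).2.2])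

def Code (W : Type) [NormedAddCommGroup W] (y z : Iinf) : Set (ℝ × (ℝ × W)) :=
  {v | ‖v‖ ≤ 1 ∧ ∀ i, ch i * cm y z i v.2 ≤ |v.1 - ca i|}

lemma code_closed (y z : Iinf) : IsClosed (Code W y z) := by
  have : Code W y z = {v | ‖v‖ ≤ 1} ∩ ⋂ i, {v | ch i * cm y z i v.2 ≤ |v.1 - ca i|} := by
    ext v; simp [Code]
  rw [this]
  refine (isClosed_le (by fun_prop) (by fun_prop)).inter (isClosed_iInter fun i => isClosed_le ?_ ?_)
  · exact continuous_const.mul ((cm_cont y z i).comp continuous_snd)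
  · fun_prop
lemma code_sub (y z : Iinf) : Code W y z ⊆ closedBall 0 1 := fun v hv => by
  simpa using hv.1
lemma code_compact [ProperSpace W] (y z : Iinf) : IsCompact (Code W y z) :=
  (isCompact_closedBall 0 1).of_isClosed_subset (code_closed y z) (code_sub y z)

/-- free `x`-coordinates -/
lemma code_free (y z : Iinf) {v : ℝ × (ℝ × W)} (h1 : ‖v‖ ≤ 1) (h : ∀ i, ch i ≤ |v.1 - ca i|) :
    v ∈ Code W y z :=
  ⟨h1, fun i => le_trans (by nlinarith [cm_le y z i v.2, ch_pos i]) (h i)⟩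
lemma neg_free {x : ℝ} (hx : x ≤ 0) (i : ℕ) : ch i ≤ |x - ca i| := by
  rw [abs_sub_comm, abs_of_nonneg] <;> linarith [ca_eq i, ch_pos i]
lemma code_zero (y z : Iinf) : (0 : ℝ × (ℝ × W)) ∈ Code W y z :=
  code_free y z (by simp) fun i => neg_free (by simp) i
lemma code_bottom (y z : Iinf) {x : ℝ} (hx : |x| ≤ 1) : (x, ((-1 : ℝ), (0 : W))) ∈ Code W y z := by
  refine ⟨by simp [Prod.norm_def, hx], fun i => le_trans ?_ (abs_nonneg _)⟩
  have hP : cP ((-1 : ℝ), (0 : W)) = -1 := by simp [cP, Prod.norm_def]; norm_num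
  have hT : cT ((-1 : ℝ), (0 : W)) = -1 := by simp [cT]; norm_num
  have : cm y z i ((-1 : ℝ), (0 : W)) ≤ 0 := by
    unfold cm; rw [hP, hT]
    have h1 := (y i).2.1; have h2 := (z i).2.1
    apply max_le <;> linarith
  nlinarith [ch_pos i]

/-- moving `x` outward inside a strip -/
lemma code_strip (y z : Iinf) {i : ℕ} {x : ℝ} {w : ℝ × W} (hv : ‖(x, w)‖ ≤ 1)
    (hx : |x - ca i| < 2 * ch i) (h : ch i * cm y z i w ≤ |x - ca i|) : (x, w) ∈ Code W y z := by
  refine ⟨hv, fun j => ?_⟩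
  by_cases hj : i = j
  · subst hj; exact h
  · exact le_trans (by nlinarith [cm_le y z j w, ch_pos j]) (strips hj hx)
lemma strip_norm {i : ℕ} {x : ℝ} (hx : |x - ca i| ≤ ch i) : |x| ≤ 1 := by
  have h1 := ca_le i; have h2 := ca_eq i; have := ch_pos i
  rw [abs_le] at *; constructor <;> linarith

lemma code_conn (y z : Iinf) : IsConnected (Code W y z) := by
  refine ⟨⟨0, code_zero y z⟩, IsPathConnected.isConnected ?_ |>.2⟩
  refine ⟨(0, ((-1 : ℝ), 0)), code_bottom y z (by simp), ?_⟩
  -- from a free coordinate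
  have free : ∀ x : ℝ, ∀ w : ℝ × W, (∀ i, ch i ≤ |x - ca i|) → ‖(x, w)‖ ≤ 1 →
      JoinedIn (Code W y z) (x, w) (0, ((-1 : ℝ), 0)) := by
    intro x w hx hv
    have hx1 : |x| ≤ 1 := (norm_fst_le (x, w)).trans hv
    have hw1 : ‖w‖ ≤ 1 := (norm_snd_le (x, w)).trans hv
    have j1 : JoinedIn (Code W y z) (x, w) (x, ((-1 : ℝ), 0)) := by
      have hc : Convex ℝ ({x} ×ˢ closedBall (0 : ℝ × W) 1) :=
        (convex_singleton x).prod (convex_closedBall 0 1)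
      refine (JoinedIn.of_segment_subset (hc.segment_subset (by simpa using hw1)
        (by simp [Prod.norm_def]))).mono ?_
      rintro ⟨a, b⟩ ⟨ha, hb⟩
      simp only [mem_singleton_iff] at ha
      subst ha
      exact code_free y z (by simpa [Prod.norm_def] using ⟨hx1, by simpa [Prod.norm_def] using hb⟩) hx
    have j2 : JoinedIn (Code W y z) (x, ((-1 : ℝ), 0)) (0, ((-1 : ℝ), 0)) := by
      have hc : Convex ℝ (closedBall (0 : ℝ) 1 ×ˢ {((-1 : ℝ), (0 : W))}) :=
        (convex_closedBall 0 1).prod (convex_singleton _)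
      refine (JoinedIn.of_segment_subset (hc.segment_subset (by simpa using hx1)
        (by simp))).mono ?_
      rintro ⟨a, b⟩ ⟨ha, hb⟩
      simp only [mem_singleton_iff] at hb
      subst hb
      exact code_bottom y z (by simpa using ha)
    exact j1.trans j2
  rintro ⟨x, w⟩ hv
  apply JoinedIn.symm
  by_cases hx : ∀ i, ch i ≤ |x - ca i|
  · exact free x w hx hv.1
  push Not at hx
  obtain ⟨i, hi⟩ := hx
  have hw1 : ‖w‖ ≤ 1 := (norm_snd_le (x, w)).trans hv.1
  have key : ∃ x', |x' - ca i| = ch i ∧ ∀ t ∈ segment ℝ x x', ch i * cm y z i w ≤ |t - ca i| ∧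
      |t - ca i| ≤ ch i := by
    have hm := hv.2 i
    simp only at hm
    rw [abs_lt] at hi
    rcases le_total (ca i) x with h | h
    · refine ⟨ca i + ch i, by simp [abs_of_pos (ch_pos i)], fun t ht => ?_⟩
      rw [segment_eq_Icc (by linarith)] at ht
      rw [abs_of_nonneg (by linarith)] at hm
      rw [abs_of_nonneg (by linarith [ht.1])]
      constructor <;> linarith [ht.1, ht.2]
    · refine ⟨ca i - ch i, by simp [abs_of_pos (ch_pos i)], fun t ht => ?_⟩
      rw [segment_symm, segment_eq_Icc (by linarith)] at ht
      rw [abs_of_nonpos (by linarith)] at hm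
      rw [abs_of_nonpos (by linarith [ht.2])]
      constructor <;> linarith [ht.1, ht.2]
  obtain ⟨x', hx', hseg⟩ := key
  have hc : Convex ℝ (segment ℝ x x' ×ˢ {w}) := (convex_segment x x').prod (convex_singleton w)
  have hn : ∀ t ∈ segment ℝ x x', ‖(t, w)‖ ≤ 1 := fun t ht => by
    simpa [Prod.norm_def] using ⟨strip_norm (hseg t ht).2, by simpa [Prod.norm_def] using hw1⟩
  have j : JoinedIn (Code W y z) (x, w) (x', w) := by
    refine (JoinedIn.of_segment_subset (hc.segment_subset (mk_mem_prod (left_mem_segment ℝ x x') (mem_singleton w))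
        (mk_mem_prod (right_mem_segment ℝ x x') (mem_singleton w)))).mono ?_
    rintro ⟨a, b⟩ ⟨ha, hb⟩
    simp only [mem_singleton_iff] at hb
    subst hb
    exact code_strip y z (hn a ha) (by have := (hseg a ha).2; simp only at *; linarith [ch_pos i])
      (hseg a ha).1
  refine j.trans (free x' w (fun k => ?_) (hn x' (right_mem_segment ℝ x x')))
  by_cases hk : i = k
  · subst hk; exact hx'.ge
  · exact strips hk (by rw [hx']; linarith [ch_pos i])

lemma code_move_one {y z y' z' : Iinf} {δ : ℝ} (hδ : 0 ≤ δ)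
    (h : ∀ i, ch i * (|(y i : ℝ) - y' i| + |(z i : ℝ) - z' i|) ≤ δ) {v : ℝ × (ℝ × W)}
    (hv : v ∈ Code W y z) : ∃ v' ∈ Code W y' z', dist v v' ≤ δ := by
  obtain ⟨x, w⟩ := v
  by_cases hc : (x, w) ∈ Code W y' z'
  · exact ⟨_, hc, by simpa using hδ⟩
  have hw1 : ‖w‖ ≤ 1 := (norm_snd_le (x, w)).trans hv.1
  have : ∃ i, |x - ca i| < ch i * cm y' z' i w := by
    by_contra hn; push Not at hn
    exact hc ⟨hv.1, hn⟩
  obtain ⟨i, hi⟩ := this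
  have hm := hv.2 i
  have hle := cm_le y' z' i w
  have hmp : 0 < cm y' z' i w := by
    by_contra hn
    push Not at hn
    nlinarith [abs_nonneg (x - ca i), ch_pos i]
  simp only at hm
  -- difference
  have hd : ch i * cm y' z' i w - |x - ca i| ≤ δ := by
    refine le_trans ?_ (h i)
    have hm' : cm y z i w * ch i ≤ |x - ca i| := by rw [mul_comm]; exact hm
    have : cm y' z' i w - cm y z i w ≤ |(y i : ℝ) - y' i| + |(z i : ℝ) - z' i| := by
      have hP := cP_le w; have hT := cT_le w
      have ha := neg_abs_le ((y i : ℝ) - y' i)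
      have hb := neg_abs_le ((z i : ℝ) - z' i)
      have ha0 := abs_nonneg ((y i : ℝ) - y' i)
      have hb0 := abs_nonneg ((z i : ℝ) - z' i)
      have hy' := (y' i).2.1; have hz' := (z' i).2.1
      rcases le_total ((1 + (y' i : ℝ)) / 2 * cP w) ((z' i : ℝ) / 4 * cT w) with hh | hh
      · have e1 : cm y' z' i w = (z' i : ℝ) / 4 * cT w := max_eq_right hh
        have e2 : (z i : ℝ) / 4 * cT w ≤ cm y z i w := le_max_right _ _
        rw [e1] at hmp ⊢
        have hT0 : 0 < cT w := by
          by_contra hn; push Not at hn; nlinarith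
        nlinarith
      · have e1 : cm y' z' i w = (1 + (y' i : ℝ)) / 2 * cP w := max_eq_left hh
        have e2 : (1 + (y i : ℝ)) / 2 * cP w ≤ cm y z i w := le_max_left _ _
        rw [e1] at hmp ⊢
        have hT0 : 0 < cP w := by
          by_contra hn; push Not at hn; nlinarith
        nlinarith
    nlinarith [ch_pos i]
  have hp := ch_pos i
  have hs : ∃ x', |x' - ca i| = ch i * cm y' z' i w ∧ |x - x'| ≤ δ := by
    rcases le_total (ca i) x with h | h
    · refine ⟨ca i + ch i * cm y' z' i w, by simp [abs_of_pos, hp, hmp], ?_⟩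
      rw [abs_of_nonneg (by linarith)] at hi hd
      rw [abs_of_nonpos (by linarith)]; linarith
    · refine ⟨ca i - ch i * cm y' z' i w, by simp [abs_of_pos, hp, hmp], ?_⟩
      rw [abs_of_nonpos (by linarith)] at hi hd
      rw [abs_of_nonneg (by linarith)]; linarith
  obtain ⟨x', h1, h2⟩ := hs
  have h3 : |x' - ca i| ≤ ch i := by rw [h1]; nlinarith
  refine ⟨(x', w), code_strip y' z' ?_ (by linarith) h1.ge, ?_⟩
  · simpa [Prod.norm_def] using ⟨strip_norm h3, by simpa [Prod.norm_def] using hw1⟩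
  · simpa [Prod.dist_eq, Real.dist_eq] using h2

lemma ch_tendsto : Filter.Tendsto ch Filter.atTop (𝓝 0) := by
  have := (tendsto_pow_atTop_nhds_zero_of_lt_one (r := (1 / 2 : ℝ)) (by norm_num) (by norm_num))
  exact this.comp (Filter.tendsto_add_atTop_nat 5)

lemma code_param (p : Iinf × Iinf) {δ : ℝ} (hδ : 0 < δ) :
    ∀ᶠ q in 𝓝 p, ∀ i, ch i * (|(p.1 i : ℝ) - q.1 i| + |(p.2 i : ℝ) - q.2 i|) ≤ δ := by
  obtain ⟨N, hN⟩ := (Metric.tendsto_atTop.1 ch_tendsto) (δ / 2) (by linarith)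
  have : ∀ᶠ q in 𝓝 p, ∀ i ∈ Finset.range N,
      ch i * (|(p.1 i : ℝ) - q.1 i| + |(p.2 i : ℝ) - q.2 i|) < δ := by
    rw [Filter.eventually_all_finset]
    intro i _
    have hc : Continuous fun q : Iinf × Iinf =>
        ch i * (|(p.1 i : ℝ) - q.1 i| + |(p.2 i : ℝ) - q.2 i|) := by fun_prop
    exact hc.continuousAt.eventually_lt continuousAt_const (by simpa using hδ)
  filter_upwards [this] with q hq i
  by_cases hi : i < N
  · exact (hq i (Finset.mem_range.2 hi)).le
  · have h1 := hN i (by omega)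
    rw [Real.dist_eq, sub_zero, abs_of_pos (ch_pos i)] at h1
    have h2 : |(p.1 i : ℝ) - q.1 i| ≤ 1 := by
      have := (p.1 i).2; have := (q.1 i).2
      rw [abs_le]; constructor <;> linarith [(p.1 i).2.1, (p.1 i).2.2, (q.1 i).2.1, (q.1 i).2.2]
    have h3 : |(p.2 i : ℝ) - q.2 i| ≤ 1 := by
      rw [abs_le]; constructor <;> linarith [(p.2 i).2.1, (p.2 i).2.2, (q.2 i).2.1, (q.2 i).2.2]
    nlinarith [ch_pos i]

/-- Hausdorff continuity of the code -/
lemma code_move (p : Iinf × Iinf) {δ : ℝ} (hδ : 0 < δ) :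
    ∀ᶠ q in 𝓝 p, (∀ v ∈ Code W p.1 p.2, ∃ v' ∈ Code W q.1 q.2, dist v v' ≤ δ) ∧
      ∀ v ∈ Code W q.1 q.2, ∃ v' ∈ Code W p.1 p.2, dist v v' ≤ δ := by
  filter_upwards [code_param p hδ] with q hq
  refine ⟨fun v hv => code_move_one hδ.le hq hv, fun v hv => code_move_one hδ.le (fun i => ?_) hv⟩
  rw [abs_sub_comm, abs_sub_comm (q.2 i : ℝ)]
  exact hq i

lemma rank_gt : 1 < Module.rank ℝ (ℝ × (ℝ × W)) := by
  have : Module.rank ℝ (ℝ × ℝ) ≤ Module.rank ℝ (ℝ × (ℝ × W)) := by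
    refine LinearMap.rank_le_of_injective
      ((LinearMap.fst ℝ ℝ ℝ).prod ((LinearMap.inl ℝ ℝ W).comp (LinearMap.snd ℝ ℝ ℝ))) ?_
    rintro ⟨a, b⟩ ⟨c, d⟩ h
    simpa using h
  refine lt_of_lt_of_le ?_ this
  rw [rank_prod', Module.rank_self, one_add_one_eq_two]
  exact_mod_cast (by norm_num : 1 < 2)

lemma annulus_conn : IsPreconnected {v : ℝ × (ℝ × W) | 1 < ‖v‖ ∧ ‖v‖ < 2} := by
  have h1 : IsPreconnected (sphere (0 : ℝ × (ℝ × W)) 1) :=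
    (isPreconnected_sphere rank_gt 0 1)
  have h2 := ((isPreconnected_Ioo (a := (1 : ℝ)) (b := 2)).prod h1).image
    (fun p : ℝ × (ℝ × (ℝ × W)) => p.1 • p.2) (by fun_prop)
  convert h2 using 1
  ext v
  constructor
  · rintro ⟨h, h'⟩
    refine ⟨(‖v‖, ‖v‖⁻¹ • v), ⟨⟨h, h'⟩, ?_⟩, ?_⟩
    · have : ‖v‖ ≠ 0 := by linarith
      simp [norm_smul, this]
    · have : ‖v‖ ≠ 0 := by linarith
      simp [smul_smul, this]
  · rintro ⟨⟨r, w⟩, ⟨⟨h, h'⟩, hw⟩, rfl⟩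
    have hw : ‖w‖ = 1 := by simpa using hw
    simp only at h h'
    simp only [mem_ofPred_eq, norm_smul, hw, mul_one, Real.norm_eq_abs, abs_of_pos (by linarith : 0 < r)]
    exact ⟨h, h'⟩

/-- with open tunnels the complement is connected -/
lemma code_compl {y z : Iinf} (hz : ∀ i, 0 < (z i : ℝ)) :
    IsPreconnected (ball 0 2 \ Code W y z) := by
  have hA : {v : ℝ × (ℝ × W) | 1 < ‖v‖ ∧ ‖v‖ < 2} ⊆ ball 0 2 \ Code W y z :=
    fun v hv => ⟨by simpa using hv.2, fun h => absurd h.1 (by have := hv.1; linarith)⟩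
  have base : ((0 : ℝ), ((3 / 2 : ℝ), (0 : W))) ∈ {v : ℝ × (ℝ × W) | 1 < ‖v‖ ∧ ‖v‖ < 2} := by
    simp [Prod.norm_def]; norm_num
  apply isPreconnected_of_forall ((0 : ℝ), ((3 / 2 : ℝ), (0 : W)))
  rintro ⟨x, a, u⟩ hv
  by_cases hn : 1 < ‖(x, a, u)‖
  · exact ⟨_, hA, base, ⟨hn, by simpa using hv.1⟩, annulus_conn⟩
  have hn1 : ‖(x, a, u)‖ ≤ 1 := not_lt.1 hn
  have hx1 : |x| ≤ 1 := (norm_fst_le (x, a, u)).trans hn1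
  have hw1 : ‖(a, u)‖ ≤ 1 := (norm_snd_le (x, a, u)).trans hn1
  have ha1 : |a| ≤ 1 := (norm_fst_le (a, u)).trans hw1
  have hu1 : ‖u‖ ≤ 1 := (norm_snd_le (a, u)).trans hw1
  have : ∃ i, |x - ca i| < ch i * cm y z i (a, u) := by
    by_contra h; push Not at h
    exact hv.2 ⟨hn1, h⟩
  obtain ⟨i, hi⟩ := this
  have hp := ch_pos i
  have hmp : 0 < cm y z i (a, u) := by
    by_contra hn
    push Not at hn
    nlinarith [abs_nonneg (x - ca i)]
  have hT : 0 < cT (a, u) := by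
    by_contra h
    push Not at h
    have h2 := (cP_le_cT (a, u)).trans h
    have : cm y z i (a, u) ≤ 0 := by
      unfold cm
      have h1 := (y i).2.1; have h2 := (z i).2.1
      apply max_le <;> nlinarith
    linarith
  have hca := ca_le i
  have hca0 := ca_eq i
  -- the two segments
  set S1 : Set (ℝ × (ℝ × W)) := ball (ca i) (ch i * cm y z i (a, u)) ×ˢ {(a, u)} with hS1
  set S2 : Set (ℝ × (ℝ × W)) := {ca i} ×ˢ (Icc a (3 / 2) ×ˢ {u}) with hS2
  have c1 : IsPreconnected S1 := ((convex_ball _ _).prod (convex_singleton _)).isPreconnected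
  have c2 : IsPreconnected S2 :=
    ((convex_singleton _).prod ((convex_Icc _ _).prod (convex_singleton _))).isPreconnected
  have ha2 : a ≤ 3 / 2 := by linarith [le_abs_self a]
  have m12 : (ca i, a, u) ∈ S1 ∩ S2 := by
    constructor
    · rw [hS1]; simp [hp, hmp]
    · simp [hS2, ha2]
  have m2A : (ca i, (3 / 2 : ℝ), u) ∈ S2 ∩ {v : ℝ × (ℝ × W) | 1 < ‖v‖ ∧ ‖v‖ < 2} := by
    constructor
    · simp [hS2, ha2]
    · have e : |ca i| = ca i := abs_of_pos (by linarith)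
      have : |(3 / 2 : ℝ)| = 3 / 2 := abs_of_pos (by norm_num)
      simp only [mem_ofPred_eq, Prod.norm_def, Real.norm_eq_abs, e, this, lt_max_iff, max_lt_iff]
      exact ⟨Or.inr (Or.inl (by norm_num)), by linarith, by norm_num, by linarith⟩
  have s1 : S1 ⊆ ball 0 2 \ Code W y z := by
    rintro ⟨t, w⟩ ⟨ht, hw⟩
    simp only [mem_singleton_iff] at hw
    subst hw
    have ht : |t - ca i| < ch i * cm y z i (a, u) := by simpa [Real.dist_eq] using ht
    refine ⟨?_, fun h => absurd (h.2 i) (not_le.2 ht)⟩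
    have h3 : |t| ≤ 1 := strip_norm (i := i) (by nlinarith [cm_le y z i (a, u)])
    rw [mem_ball_zero_iff]
    simp only [Prod.norm_def, Real.norm_eq_abs, max_lt_iff]
    exact ⟨by linarith, by linarith, by linarith⟩
  have s2 : S2 ⊆ ball 0 2 \ Code W y z := by
    rintro ⟨t, b, w⟩ ⟨ht, hb, hw⟩
    simp only [mem_singleton_iff] at hw ht
    subst hw ht
    simp only [mem_Icc] at hb
    constructor
    · rw [mem_ball_zero_iff]
      simp only [Prod.norm_def, Real.norm_eq_abs, max_lt_iff]
      rw [abs_le] at ha1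
      exact ⟨by rw [abs_of_pos] <;> linarith, by rw [abs_lt]; constructor <;> linarith, by linarith⟩
    · intro h
      have := h.2 i
      simp only [sub_self, abs_zero] at this
      have h3 : cT (a, w) ≤ cT (b, w) := by
        unfold cT
        have : max (-b) ‖w‖ ≤ max (-a) ‖w‖ := max_le_max (by linarith) le_rfl
        simp only; linarith
      have h4 : (z i : ℝ) / 4 * cT (b, w) ≤ cm y z i (b, w) := le_max_right _ _
      have h5 : 0 < (z i : ℝ) / 4 * cT (b, w) := by
        have := hz i
        have : 0 < cT (b, w) := by linarith
        positivity
      nlinarith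
  refine ⟨S1 ∪ (S2 ∪ {v : ℝ × (ℝ × W) | 1 < ‖v‖ ∧ ‖v‖ < 2}), union_subset s1 (union_subset s2 hA),
    Or.inr (Or.inr base), Or.inl ?_, ?_⟩
  · rw [hS1]; simpa [Real.dist_eq] using hi
  · exact c1.union' ⟨_, m12.1, Or.inl m12.2⟩ (c2.union' ⟨_, m2A⟩ annulus_conn)

/-- a closed tunnel gives a separated cavity -/
lemma code_cav [ProperSpace W] {y z : Iinf} {i : ℕ} (hz : (z i : ℝ) = 0) :
    ∃ U O : Set (ℝ × (ℝ × W)), IsCompact U ∧ IsOpen O ∧ U ⊆ O ∧ O ⊆ ball 0 1 ∧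
      (Code W y z)ᶜ ⊆ U ∪ Oᶜ ∧ (U \ Code W y z).Nonempty := by
  have hp := ch_pos i
  have hca := ca_le i
  have hca0 := ca_eq i
  have hy0 := (y i).2.1
  have hy1 := (y i).2.2
  let U : Set (ℝ × (ℝ × W)) := {v | |v.1 - ca i| ≤ ch i * ((1 + (y i : ℝ)) / 2 * cP v.2)}
  let O : Set (ℝ × (ℝ × W)) := {v | |v.1 - ca i| < 2 * ch i} ∩ {v | ‖v.2‖ < 3 / 4}
  have hOb : O ⊆ ball 0 1 := by
    rintro ⟨x, w⟩ ⟨h1, h2⟩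
    simp only [mem_ofPred_eq] at h1 h2
    rw [mem_ball_zero_iff, Prod.norm_def, max_lt_iff]
    refine ⟨?_, by simp only; linarith⟩
    simp only [Real.norm_eq_abs]
    rw [abs_lt] at *
    constructor <;> linarith
  have hUO : U ⊆ O := by
    rintro ⟨x, w⟩ h
    have h : |x - ca i| ≤ ch i * ((1 + (y i : ℝ)) / 2 * cP w) := h
    have h0 := abs_nonneg (x - ca i)
    have h1 : 0 ≤ cP w := by
      by_contra hn
      push Not at hn
      have : (1 + (y i : ℝ)) / 2 * cP w < 0 := by nlinarith
      nlinarith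
    have h2 := cP_le w
    refine ⟨show |x - ca i| < 2 * ch i from ?_, show ‖w‖ < 3 / 4 from ?_⟩
    · have : (1 + (y i : ℝ)) / 2 * cP w ≤ 1 := by nlinarith
      nlinarith
    · unfold cP at h1; linarith
  have hUc : IsClosed U := by
    refine isClosed_le (by fun_prop) ?_
    exact continuous_const.mul (continuous_const.mul (cP_cont.comp continuous_snd))
  refine ⟨U, O, ?_, ?_, hUO, hOb, ?_, (ca i, 0), ?_, ?_⟩
  · exact (isCompact_closedBall 0 1).of_isClosed_subset hUc
      (hUO.trans (hOb.trans ball_subset_closedBall))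
  · exact (isOpen_lt (by fun_prop) (by fun_prop)).inter (isOpen_lt (by fun_prop) (by fun_prop))
  · rintro ⟨x, w⟩ hv
    by_contra hn
    simp only [mem_union, mem_compl_iff, not_or, not_not] at hn
    obtain ⟨h1, h2⟩ := hn
    have h1 : ch i * ((1 + (y i : ℝ)) / 2 * cP w) < |x - ca i| := not_le.1 h1
    refine hv (code_strip y z ((mem_ball_zero_iff.1 (hOb h2)).le) h2.1 ?_)
    have : cm y z i w = max ((1 + (y i : ℝ)) / 2 * cP w) 0 := by unfold cm; rw [hz]; simp
    rw [this, mul_max_of_nonneg _ _ hp.le]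
    exact max_le h1.le (by simp)
  · change |ca i - ca i| ≤ _
    simp [cP]; positivity
  · intro h
    have h1 := h.2 i
    have : (1 + (y i : ℝ)) / 2 * cP (0 : ℝ × W) ≤ cm y z i (0 : ℝ × W) := le_max_left _ _
    simp [cP] at h1 this
    nlinarith

lemma code_neg {y z : Iinf} {r : ℝ} (h0 : 0 < r) (h1 : r < 1) :
    ((-r, 0) : ℝ × (ℝ × W)) ∈ interior (Code W y z) := by
  rw [mem_interior]
  refine ⟨{v | v.1 < 0} ∩ ball 0 1, fun v hv => ?_, ?_, ?_, ?_⟩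
  · exact code_free y z (by simpa using (mem_ball_zero_iff.1 hv.2).le) (fun i => neg_free (le_of_lt hv.1) i)
  · exact (isOpen_lt (by fun_prop) (by fun_prop)).inter isOpen_ball
  · simpa using h0
  · simp [Prod.norm_def, abs_of_pos h0, h1]

lemma code_in {y z : Iinf} {i : ℕ} {d : ℝ} (h0 : ch i * ((1 + (y i : ℝ)) / 2) < d) (h1 : d < ch i) :
    ((ca i + d, 0) : ℝ × (ℝ × W)) ∈ interior (Code W y z) := by
  have hp := ch_pos i
  have hca := ca_le i
  have hca0 := ca_eq i
  have hy0 := (y i).2.1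
  have hd : 0 < d := lt_of_le_of_lt (by positivity) h0
  rw [mem_interior]
  refine ⟨({v | |v.1 - ca i| < 2 * ch i} ∩ {v | ch i * ((1 + (y i : ℝ)) / 2) < |v.1 - ca i|}) ∩ ball 0 1,
    fun v hv => ?_, ?_, ⟨?_, ?_⟩, ?_⟩
  · obtain ⟨x, w⟩ := v
    refine code_strip y z (by simpa using (mem_ball_zero_iff.1 hv.2).le) hv.1.1 ?_
    have : ch i * ((1 + (y i : ℝ)) / 2) < |x - ca i| := hv.1.2
    nlinarith [cm_le_max y z i w]
  · exact ((isOpen_lt (by fun_prop) (by fun_prop)).inter (isOpen_lt (by fun_prop) (by fun_prop))).inter isOpen_ball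
  · simp only [mem_ofPred_eq, add_sub_cancel_left, abs_of_pos hd]; linarith
  · simpa only [mem_ofPred_eq, add_sub_cancel_left, abs_of_pos hd] using h0
  · rw [mem_ball_zero_iff, Prod.norm_def, max_lt_iff]
    simp only [Real.norm_eq_abs, norm_zero]
    rw [abs_of_pos (by linarith)]
    constructor <;> linarith

lemma code_notin {y z : Iinf} {i : ℕ} {d : ℝ} (hd : 0 < d) (h0 : d < ch i * ((1 + (y i : ℝ)) / 2)) :
    ((ca i + d, 0) : ℝ × (ℝ × W)) ∉ Code W y z := by
  intro h
  have h1 := h.2 i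
  have : (1 + (y i : ℝ)) / 2 * cP (0 : ℝ × W) ≤ cm y z i (0 : ℝ × W) := le_max_left _ _
  simp only [add_sub_cancel_left, abs_of_pos hd] at h1
  simp [cP] at this
  nlinarith [ch_pos i]

lemma code_decode_y {y z y' z' : Iinf} (h : interior (Code W y z) ⊆ Code W y' z') (i : ℕ) :
    (y' i : ℝ) ≤ y i := by
  by_contra hn
  push Not at hn
  have hp := ch_pos i
  have hy0 := (y i).2.1
  have hy1 := (y' i).2.2
  obtain ⟨d, h1, h2⟩ := exists_between
    (show ch i * ((1 + (y i : ℝ)) / 2) < ch i * ((1 + (y' i : ℝ)) / 2) by nlinarith)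
  refine code_notin (lt_of_le_of_lt (by positivity) h1) h2 (h (code_in (W := W) (z := z) h1 ?_))
  nlinarith

lemma code_decode_s {y z y' z' : Iinf} {s s' : ℝ} (hs : 0 < s) (hs' : 0 < s')
    (h : interior ((fun v => s • v) '' Code W y z) ⊆ (fun v => s' • v) '' Code W y' z') : s ≤ s' := by
  by_contra hn
  push Not at hn
  obtain ⟨r, h1, h2⟩ := exists_between hn
  have hm : ((-(r / s), 0) : ℝ × (ℝ × W)) ∈ interior (Code W y z) :=
    code_neg (div_pos (hs'.trans h1) hs) (by rw [div_lt_one hs]; exact h2)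
  have hm2 : s • ((-(r / s), 0) : ℝ × (ℝ × W)) ∈ interior ((fun v => s • v) '' Code W y z) :=
    (Homeomorph.smulOfNeZero s hs.ne').isOpenMap.image_interior_subset _ ⟨_, hm, rfl⟩
  obtain ⟨v, hv, hve⟩ := h hm2
  have : ‖s' • v‖ = r := by
    simp only at hve
    rw [hve]
    simp only [Prod.smul_mk, smul_eq_mul, mul_neg, smul_zero]
    rw [mul_div_cancel₀ _ hs.ne']
    simp [Prod.norm_def, abs_of_pos (hs'.trans h1), (hs'.trans h1).le]
  rw [norm_smul, Real.norm_eq_abs, abs_of_pos hs'] at this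
  nlinarith [hv.1]

lemma code_decode {y z y' z' : Iinf} {s s' : ℝ} (hs : 0 < s) (hs' : 0 < s')
    (h : interior ((fun v => s • v) '' Code W y z) = interior ((fun v => s' • v) '' Code W y' z')) :
    s = s' ∧ y = y' := by
  have e : s = s' := le_antisymm (code_decode_s (W := W) hs hs' (h.trans_subset interior_subset))
    (code_decode_s (W := W) hs' hs (h.symm.trans_subset interior_subset))
  refine ⟨e, ?_⟩
  subst e
  have h' : interior (Code W y z) = interior (Code W y' z') := by
    have h1 := (Homeomorph.smulOfNeZero s hs.ne' : (ℝ × (ℝ × W)) ≃ₜ _).image_interior (Code W y z)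
    have h2 := (Homeomorph.smulOfNeZero s hs.ne' : (ℝ × (ℝ × W)) ≃ₜ _).image_interior (Code W y' z')
    exact (Homeomorph.smulOfNeZero s hs.ne' : (ℝ × (ℝ × W)) ≃ₜ _).injective.image_injective
      (h1.trans (h.trans h2.symm))
  ext i
  exact le_antisymm (code_decode_y (W := W) (h'.symm.trans_subset interior_subset) i)
    (code_decode_y (W := W) (h'.trans_subset interior_subset) i)
end P6

section P7
set_option linter.unusedSectionVars false

lemma exists_tau {S : Type*} [MetricSpace S] {Z : Set S} (hZ : IsClosed Z) {ε : ℝ} (hε : 0 < ε) :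
    ∃ τ : S → ℝ, Continuous τ ∧ (∀ A B, τ A ≤ τ B + dist A B) ∧ (∀ A, 0 ≤ τ A) ∧ (∀ A, τ A ≤ ε) ∧
      (∀ A ∈ Z, τ A = 0) ∧ ∀ A ∉ Z, 0 < τ A := by
  rcases Z.eq_empty_or_nonempty with rfl | hne
  · exact ⟨fun _ => ε, continuous_const, fun A B => by linarith [dist_nonneg (x := A) (y := B)],
      fun _ => hε.le, fun _ => le_rfl, fun A hA => hA.elim, fun A _ => hε⟩
  · refine ⟨fun A => min ε (infDist A Z), by fun_prop, fun A B => ?_, fun A => le_min hε.le infDist_nonneg,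
      fun A => min_le_left _ _, fun A hA => ?_, fun A hA => ?_⟩
    · rw [← min_add_add_right]
      exact min_le_min (by linarith [dist_nonneg (x := A) (y := B)]) infDist_le_infDist_add_dist
    · simp only; rw [infDist_zero_of_mem hA]; exact min_eq_right hε.le
    · exact lt_min hε ((hZ.notMem_iff_infDist_pos hne).1 hA)

variable {X : Type*} [MetricSpace X] [CompactSpace X]

lemma grow_small [Nonempty X] [LocallyConnectedSpace X] {ε : ℝ} (hε : 0 < ε) : ∃ δ > 0,
    ∀ (A : ↥(CSet X)) (t : ℝ), 0 ≤ t → t ≤ δ → dist (grow A t) A ≤ ε := by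
  obtain ⟨δ, hδ, h⟩ := grow_unif (X := X) hε
  refine ⟨δ, hδ, fun A t h0 h1 => c_dist_le hε.le (fun a ha => ?_) (fun a ha => ?_)⟩
  · have := h A A t 0 h0 le_rfl (by simpa using hδ) (by linarith) a ha
    rwa [grow_zero] at this
  · exact ⟨a, subset_growSet A t ha, by simpa using hε.le⟩

lemma grow_mono [Nonempty X] {A : ↥(CSet X)} {s t : ℝ} (hs : 0 ≤ s) (h : s ≤ t) :
    car (grow A s) ⊆ car (grow A t) := by
  intro y hy
  obtain ⟨B, h1, h2, h3⟩ := (mem_growSet hs).1 hy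
  exact (mem_growSet (hs.trans h)).2 ⟨B, h1, h2.trans h, h3⟩

lemma exists_f0 [Nonempty X] [LocallyConnectedSpace X] {Z : Set ↥(CSet X)} (hZ : IsClosed Z)
    {τ : ↥(CSet X) → ℝ} (hτ : Continuous τ) (hτp : ∀ A ∉ Z, 0 < τ A) (hτ0 : ∀ A ∈ Z, τ A = 0) :
    ∃ (f : ↥(CSet X) → ↥(CSet X)) (κ : ↥(CSet X) → ℝ), Continuous f ∧ Continuous κ ∧
      (∀ A ∈ Z, f A = A) ∧ (∀ A, dist (f A) A ≤ τ A / 16) ∧ (∀ A, 0 ≤ κ A) ∧ (∀ A ∈ Z, κ A = 0) ∧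
      ∀ A ∉ Z, 0 < κ A ∧ ∀ y, infDist y (car A) < κ A → y ∈ car (f A) := by
  have hnear : ∀ (φ : ↥(CSet X) → ℝ), Continuous φ → ∀ A, 0 < φ A → ∃ ε > 0, ∀ B, dist B A < ε →
      φ A / 2 < φ B := fun φ hφ A hA => by
    have := hφ.continuousAt.eventually_const_lt (show φ A / 2 < φ A by linarith)
    exact Metric.eventually_nhds_iff.1 this
  obtain ⟨t, t1, t2, t3, t4⟩ := exists_minorant hZ (fun A t => dist (grow A t) A ≤ τ A / 16) (by
    intro A hA
    obtain ⟨ε1, h1, h1'⟩ := hnear τ hτ A (hτp A hA)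
    obtain ⟨δ, h2, h2'⟩ := grow_small (X := X) (show 0 < τ A / 32 by linarith [hτp A hA])
    refine ⟨min ε1 δ, lt_min h1 h2, fun B hB t ht0 ht1 => ?_⟩
    have := h1' B (hB.trans_le (min_le_left _ _))
    exact (h2' B t ht0.le (ht1.le.trans (min_le_right _ _))).trans (by linarith))
  obtain ⟨κ, k1, k2, k3, k4⟩ := exists_minorant hZ
    (fun A k => ∀ y, infDist y (car A) < k → y ∈ car (grow A (t A))) (by
    intro A hA
    obtain ⟨ε1, h1, h1'⟩ := hnear t t1 A (t4 A hA).1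
    obtain ⟨δ, h2, h2'⟩ := grow_engulf (X := X) (show 0 < t A / 2 by linarith [(t4 A hA).1])
    refine ⟨min ε1 δ, lt_min h1 h2, fun B hB k hk0 hk1 y hy => ?_⟩
    refine grow_mono ?_ (h1' B (hB.trans_le (min_le_left _ _))).le
      (h2' B y (hy.trans (hk1.trans_le (min_le_right _ _))))
    linarith [(t4 A hA).1])
  have hz : ∀ A ∈ Z, grow A (t A) = A := fun A hA => by rw [t3 A hA, grow_zero]
  refine ⟨fun A => grow A (t A), κ, grow_continuous continuous_id t1 t2, k1, hz, fun A => ?_, k2, k3, k4⟩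
  by_cases hA : A ∈ Z
  · simp only; rw [hz A hA, hτ0 A hA]; simp
  · exact (t4 A hA).2

/-- activity functions -/
lemma exists_active [Nonempty X] {Z : Set ↥(CSet X)} {κ : ↥(CSet X) → ℝ} (hκ : Continuous κ)
    (k0 : ∀ A ∈ Z, κ A = 0) (kp : ∀ A ∉ Z, 0 < κ A) {p : ℕ → X}
    (hp : ∀ V : Set X, IsOpen V → V.Nonempty → ∃ i, p i ∈ V) :
    ∃ s : ℕ → ↥(CSet X) → ℝ, (∀ i, Continuous (s i)) ∧ (∀ i A, 0 ≤ s i A) ∧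
      (∀ i, ∀ A ∈ Z, s i A = 0) ∧ (∀ A ∉ Z, ∃ i, 0 < s i A) ∧
      (∀ i A, 0 < s i A → infDist (p i) (car A) < κ A) ∧
      ∀ A ∉ Z, ∃ N : ℕ, ∀ᶠ B in 𝓝 A, ∀ i, 0 < s i B → i < N := by
  let s : ℕ → ↥(CSet X) → ℝ := fun i A => max 0 (κ A - infDist (p i) (car A)) *
    ∏ j ∈ Finset.range i, max 0 (infDist (p j) (car A) - κ A / 2)
  have hexists : ∀ A ∉ Z, ∃ i, infDist (p i) (car A) < κ A / 2 := by
    intro A hA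
    obtain ⟨i, hi⟩ := hp {x | infDist x (car A) < κ A / 2}
      (isOpen_lt (continuous_infDist_pt _) continuous_const) (by
        obtain ⟨a, ha⟩ := car_nonempty A
        exact ⟨a, by
          change infDist a (car A) < κ A / 2
          rw [infDist_zero_of_mem ha]; linarith [kp A hA]⟩)
    exact ⟨i, hi⟩
  refine ⟨s, fun i => ?_, fun i A => ?_, fun i A hA => ?_, fun A hA => ?_, fun i A h => ?_, fun A hA => ?_⟩
  · refine (continuous_const.max (hκ.sub (c_infDist_cont _))).mul (continuous_finsetProd _ fun j _ => ?_)
    exact continuous_const.max ((c_infDist_cont _).sub (hκ.div_const 2))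
  · exact mul_nonneg (le_max_left _ _) (Finset.prod_nonneg fun j _ => le_max_left _ _)
  · simp only [s]
    rw [k0 A hA, max_eq_left (by linarith [infDist_nonneg (x := p i) (s := car A)]), zero_mul]
  · classical
    have hx := hexists A hA
    refine ⟨Nat.find (show ∃ i, infDist (p i) (car A) ≤ κ A / 2 from hx.imp fun i h => h.le), ?_⟩
    set hx' := (show ∃ i, infDist (p i) (car A) ≤ κ A / 2 from hx.imp fun i h => h.le)
    have h1 := Nat.find_spec hx'
    refine mul_pos (lt_max_of_lt_right ?_) (Finset.prod_pos fun j hj => lt_max_of_lt_right ?_)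
    · linarith [kp A hA]
    · have := Nat.find_min hx' (Finset.mem_range.1 hj)
      push Not at this
      linarith
  · by_contra hn
    push Not at hn
    simp only [s] at h
    rw [max_eq_left (by linarith), zero_mul] at h
    exact lt_irrefl _ h
  · obtain ⟨i, hi⟩ := hexists A hA
    refine ⟨i + 1, ?_⟩
    filter_upwards [(c_infDist_cont (p i)).continuousAt.eventually_lt (hκ.div_const 2).continuousAt hi]
      with B hB j hj
    by_contra hn
    have : s j B = 0 := by
      apply mul_eq_zero_of_right
      apply Finset.prod_eq_zero (i := i) (Finset.mem_range.2 (by omega))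
      exact max_eq_left (by linarith)
    linarith

variable {W : Type*} [NormedAddCommGroup W] [NormedSpace ℝ W] [ProperSpace W]

lemma push_step {Z : Set ↥(CSet X)} (hZ : IsClosed Z) {p : ℕ → X} {act : ℕ → ↥(CSet X) → Prop}
    (hact : ∀ A ∉ Z, ∃ N : ℕ, ∀ᶠ B in 𝓝 A, ∀ i, act i B → i < N)
    {e : ℂ × W → X} (he : IsOpenEmbedding e) (hpq : ∀ i, p i ≠ e 0)
    {G : ↥(CSet X) → ↥(CSet X)} {b : ↥(CSet X) → ℝ} (hG : Continuous G) (hb : Continuous b)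
    (hGZ : ∀ A ∈ Z, G A = A) (hbZ : ∀ A ∈ Z, b A = 0) (hbp : ∀ A ∉ Z, 0 < b A)
    (hGa : ∀ i, ∀ A ∉ Z, act i A → p i ∈ car (G A)) :
    ∃ (G' : ↥(CSet X) → ↥(CSet X)) (b' : ↥(CSet X) → ℝ), (Continuous G' ∧ Continuous b' ∧
      (∀ A ∈ Z, G' A = A) ∧ (∀ A ∈ Z, b' A = 0) ∧ (∀ A ∉ Z, 0 < b' A) ∧
      (∀ i, ∀ A ∉ Z, act i A → p i ∈ car (G' A))) ∧ (∀ A, dist (G' A) (G A) ≤ b A / 2) ∧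
      (∀ A, b' A ≤ b A / 2) ∧ ∀ A ∉ Z, ∀ H, dist H (G' A) ≤ b' A → e 0 ∉ car H := by
  obtain ⟨r, r1, r2, r3, r4⟩ := exists_minorant hZ (fun A r => dist (push e he r (G A)) (G A) ≤ b A / 2 ∧
    ∀ i, act i A → p i ∈ car (push e he r (G A))) (by
    intro A hA
    obtain ⟨N, hN⟩ := hact A hA
    have hb2 := hb.continuousAt.eventually_const_lt (show b A / 2 < b A by linarith [hbp A hA])
    have hZc := hZ.isOpen_compl.eventually_mem hA
    obtain ⟨ε1, h1, h1'⟩ := Metric.eventually_nhds_iff.1 (hN.and (hb2.and hZc))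
    obtain ⟨δ, h2, h2'⟩ := push_small he (show 0 < b A / 4 by linarith [hbp A hA])
    choose k k1 k2 using fun i => push_keep he (hpq i)
    obtain ⟨δ3, h3, h3'⟩ : ∃ δ3 > 0, ∀ i < N, δ3 ≤ k i := by
      clear hN h1'
      induction N with
      | zero => exact ⟨1, one_pos, fun i hi => absurd hi (by omega)⟩
      | succ N ih =>
        obtain ⟨d, hd, hd'⟩ := ih
        refine ⟨min d (k N), lt_min hd (k1 N), fun i hi => ?_⟩
        rcases Nat.lt_succ_iff_lt_or_eq.1 hi with h | rfl
        · exact (min_le_left _ _).trans (hd' i h)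
        · exact min_le_right _ _
    refine ⟨min ε1 (min δ δ3), lt_min h1 (lt_min h2 h3), fun B hB ρ hρ0 hρ1 => ⟨?_, fun i hi => ?_⟩⟩
    · have := (h1' (hB.trans_le (min_le_left _ _))).2.1
      have h4 := h2' ρ hρ0 (hρ1.trans_le ((min_le_right _ _).trans (min_le_left _ _))) (G B)
      linarith
    · obtain ⟨h5, -, h6⟩ := h1' (hB.trans_le (min_le_left _ _))
      refine k2 i ρ ?_ _ (hGa i B h6 hi)
      exact (hρ1.trans_le ((min_le_right _ _).trans (min_le_right _ _))).trans_le (h3' i (h5 i hi)))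
  have hG' : Continuous fun A => push e he (r A) (G A) :=
    (push_cont he).comp (f := fun A : ↥(CSet X) => (r A, G A)) (Continuous.prodMk r1 hG)
  have hGZ' : ∀ A ∈ Z, push e he (r A) (G A) = A := fun A hA => by rw [r3 A hA, push_zero, hGZ A hA]
  refine ⟨fun A => push e he (r A) (G A), fun A => min (b A / 2) (infDist (e 0) (car (push e he (r A) (G A))) / 2),
    ⟨hG', ?_, hGZ', ?_, ?_, ?_⟩, ?_, fun A => min_le_left _ _, ?_⟩
  · exact (hb.div_const 2).min (((c_infDist_cont (e 0)).comp hG').div_const 2)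
  · intro A hA
    simp only [hbZ A hA, zero_div]
    exact min_eq_left (by have := infDist_nonneg (x := e 0) (s := car (push e he (r A) (G A))); linarith)
  · intro A hA
    have h1 := push_avoid he (r4 A hA).1 (G A)
    have h2 := ((car_closed _).notMem_iff_infDist_pos (car_nonempty _)).1 h1
    exact lt_min (by linarith [hbp A hA]) (by linarith)
  · intro i A hA hi
    exact (r4 A hA).2.2 i hi
  · intro A
    by_cases hA : A ∈ Z
    · simp only; rw [hGZ' A hA, hGZ A hA, hbZ A hA]; simp
    · exact (r4 A hA).2.1
  · intro A hA H hH hq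
    have h1 := push_avoid he (r4 A hA).1 (G A)
    have h2 := ((car_closed _).notMem_iff_infDist_pos (car_nonempty _)).1 h1
    have h3 := c_infDist_le (push e he (r A) (G A)) H (e 0)
    rw [infDist_zero_of_mem hq, dist_comm] at h3
    have h4 := hH.trans (min_le_right _ _)
    linarith

lemma exists_F {Z : Set ↥(CSet X)} (hZ : IsClosed Z) {p : ℕ → X} {act : ℕ → ↥(CSet X) → Prop}
    (hact : ∀ A ∉ Z, ∃ N : ℕ, ∀ᶠ B in 𝓝 A, ∀ i, act i B → i < N)
    {e : ℕ → ℂ × W → X} (he : ∀ k, IsOpenEmbedding (e k)) (hpq : ∀ i k, p i ≠ e k 0)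
    {G : ↥(CSet X) → ↥(CSet X)} {b : ↥(CSet X) → ℝ} (hG : Continuous G) (hb : Continuous b)
    (hGZ : ∀ A ∈ Z, G A = A) (hbZ : ∀ A ∈ Z, b A = 0) (hbp : ∀ A ∉ Z, 0 < b A)
    (hGa : ∀ i, ∀ A ∉ Z, act i A → p i ∈ car (G A)) :
    ∃ F : ↥(CSet X) → ↥(CSet X), Continuous F ∧ (∀ A ∈ Z, F A = A) ∧ (∀ A, dist (F A) (G A) ≤ b A) ∧
      (∀ k, ∀ A ∉ Z, e k 0 ∉ car (F A)) ∧ ∀ i, ∀ A ∉ Z, act i A → p i ∈ car (F A) := by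
  let Q : (↥(CSet X) → ↥(CSet X)) × (↥(CSet X) → ℝ) → Prop := fun q =>
    Continuous q.1 ∧ Continuous q.2 ∧
      (∀ A ∈ Z, q.1 A = A) ∧ (∀ A ∈ Z, q.2 A = 0) ∧ (∀ A ∉ Z, 0 < q.2 A) ∧
      (∀ i, ∀ A ∉ Z, act i A → p i ∈ car (q.1 A))
  have step : ∀ (k : ℕ) (q : {q // Q q}), ∃ q' : {q // Q q}, (∀ A, dist (q'.1.1 A) (q.1.1 A) ≤ q.1.2 A / 2) ∧
      (∀ A, q'.1.2 A ≤ q.1.2 A / 2) ∧ ∀ A ∉ Z, ∀ H, dist H (q'.1.1 A) ≤ q'.1.2 A → e k 0 ∉ car H := by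
    rintro k ⟨⟨G, b⟩, h1, h2, h3, h4, h5, h6⟩
    obtain ⟨G', b', h, h', h'', h'''⟩ := push_step hZ hact (he k) (fun i => hpq i k) h1 h2 h3 h4 h5 h6
    exact ⟨⟨⟨G', b'⟩, h⟩, h', h'', h'''⟩
  choose nx n1 n2 n3 using step
  let q : ℕ → {q // Q q} := fun k => Nat.rec ⟨(G, b), hG, hb, hGZ, hbZ, hbp, hGa⟩ nx k
  have hq : ∀ k, q (k + 1) = nx k (q k) := fun k => rfl
  let g : ℕ → ↥(CSet X) → ↥(CSet X) := fun k => (q k).1.1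
  let β : ℕ → ↥(CSet X) → ℝ := fun k => (q k).1.2
  have g1 : ∀ k A, dist (g (k + 1) A) (g k A) ≤ β k A / 2 := fun k A => n1 k (q k) A
  have g2 : ∀ k A, β (k + 1) A ≤ β k A / 2 := fun k A => n2 k (q k) A
  have g3 : ∀ k, ∀ A ∉ Z, ∀ H, dist H (g (k + 1) A) ≤ β (k + 1) A → e k 0 ∉ car H :=
    fun k => n3 k (q k)
  have β0 : ∀ k A, 0 ≤ β k A := fun k A => by
    by_cases hA : A ∈ Z
    · exact ((q k).2.2.2.2.1 A hA).ge
    · exact ((q k).2.2.2.2.2.1 A hA).le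
  have tel : ∀ k m A, dist (g (k + m) A) (g k A) ≤ β k A - β (k + m) A := by
    intro k m A
    induction m with
    | zero => simp
    | succ m ih =>
      have h1 := g1 (k + m) A
      have h2 := g2 (k + m) A
      have h3 := dist_triangle (g (k + m + 1) A) (g (k + m) A) (g k A)
      rw [← add_assoc]
      linarith
  obtain ⟨B, hB⟩ : ∃ B, ∀ A, b A ≤ B := by
    obtain ⟨B, hB⟩ := (isCompact_univ (X := ↥(CSet X))).bddAbove_image hb.continuousOn
    exact ⟨B, fun A => hB ⟨A, mem_univ A, rfl⟩⟩
  have βk : ∀ k A, β k A ≤ B * (1 / 2) ^ k := by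
    intro k A
    induction k with
    | zero => rw [pow_zero, mul_one]; exact hB A
    | succ k ih => have := g2 k A; rw [pow_succ]; linarith
  have hlim0 : Filter.Tendsto (fun k : ℕ => B * (1 / 2 : ℝ) ^ k) Filter.atTop (𝓝 0) := by
    simpa using (tendsto_pow_atTop_nhds_zero_of_lt_one (r := (1 / 2 : ℝ)) (by norm_num) (by norm_num)).const_mul B
  have tel' : ∀ k m A, k ≤ m → dist (g m A) (g k A) ≤ β k A := by
    intro k m A h
    obtain ⟨l, rfl⟩ := Nat.exists_eq_add_of_le h
    linarith [tel k l A, β0 (k + l) A]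
  have hc : ∀ A, CauchySeq fun k => g k A := fun A =>
    cauchySeq_of_le_tendsto_0' (fun k => B * (1 / 2 : ℝ) ^ k)
      (fun k m h => by rw [dist_comm]; exact (tel' k m A h).trans (βk k A)) hlim0
  choose F hF using fun A => cauchySeq_tendsto_of_complete (hc A)
  have hFd : ∀ k A, dist (F A) (g k A) ≤ β k A := fun k A =>
    le_of_tendsto ((hF A).dist tendsto_const_nhds) (Filter.eventually_atTop.2 ⟨k, fun m hm => tel' k m A hm⟩)
  refine ⟨F, ?_, fun A hA => ?_, hFd 0, fun k A hA => g3 k A hA _ (hFd (k + 1) A), fun i A hA hi => ?_⟩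
  · have : TendstoUniformly g F Filter.atTop := by
      rw [Metric.tendstoUniformly_iff]
      intro ε hε
      filter_upwards [hlim0.eventually_lt_const hε] with k hk A
      exact ((hFd k A).trans (βk k A)).trans_lt hk
    exact this.continuous (Filter.Frequently.of_forall fun k => (q k).2.1)
  · have := hFd 0 A
    have h0 : β 0 A = 0 := hbZ A hA
    rw [h0] at this
    have h1 : g 0 A = A := hGZ A hA
    rw [h1] at this
    exact dist_le_zero.1 this
  · exact (isClosed_mem_hyper (p i)).mem_of_tendsto (hF A)
      (Filter.Eventually.of_forall fun k => (q k).2.2.2.2.2.2 i A hA hi)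

lemma exists_c {E : Type*} [NormedAddCommGroup E] {Z : Set ↥(CSet X)} (hZ : IsClosed Z)
    {τ : ↥(CSet X) → ℝ} (hτ : Continuous τ) (hτl : ∀ A B, τ A ≤ τ B + dist A B)
    (hτp : ∀ A ∉ Z, 0 < τ A) (hτ0 : ∀ A ∈ Z, τ A = 0) {act : ℕ → ↥(CSet X) → Prop}
    (hact : ∀ A ∉ Z, ∃ N : ℕ, ∀ᶠ B in 𝓝 A, ∀ i, act i B → i < N)
    {e : ℕ → E → X} (he : ∀ k, IsOpenEmbedding (e k)) (hinj : Function.Injective fun i => e i 0) :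
    ∃ c : ↥(CSet X) → ℝ, Continuous c ∧ (∀ A, 0 ≤ c A) ∧ (∀ A ∈ Z, c A = 0) ∧ ∀ A ∉ Z, 0 < c A ∧
      (∀ A' A'' i j, dist A' A ≤ τ A / 2 → dist A'' A ≤ τ A / 2 → act i A' → act j A'' → i ≠ j →
        Disjoint (e i '' closedBall 0 (c A)) (e j '' closedBall 0 (c A))) ∧
      ∀ i, act i A → ∀ v, ‖v‖ ≤ c A → dist (e i v) (e i 0) ≤ τ A / 16 := by
  apply exists_minorant hZ (fun A t =>
    (∀ A' A'' i j, dist A' A ≤ τ A / 2 → dist A'' A ≤ τ A / 2 → act i A' → act j A'' → i ≠ j →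
        Disjoint (e i '' closedBall 0 t) (e j '' closedBall 0 t)) ∧
      ∀ i, act i A → ∀ v, ‖v‖ ≤ t → dist (e i v) (e i 0) ≤ τ A / 16)
  intro A hA
  have hτA := hτp A hA
  have hsub : ∀ B ∈ closedBall A (3 * τ A / 4), B ∉ Z := by
    intro B hB hBZ
    have h1 := hτl A B
    rw [hτ0 B hBZ, dist_comm] at h1
    rw [mem_closedBall] at hB
    linarith
  obtain ⟨N, hN⟩ : ∃ N : ℕ, ∀ B ∈ closedBall A (3 * τ A / 4), ∀ i, act i B → i < N := by
    refine (isCompact_closedBall A (3 * τ A / 4)).induction_on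
      (p := fun s => ∃ N : ℕ, ∀ B ∈ s, ∀ i, act i B → i < N) ⟨0, by simp⟩ ?_ ?_ ?_
    · rintro s t hst ⟨N, hN⟩
      exact ⟨N, fun B hB => hN B (hst hB)⟩
    · rintro s t ⟨N, hN⟩ ⟨M, hM⟩
      refine ⟨max N M, fun B hB i hi => ?_⟩
      rcases hB with hB | hB
      · exact lt_max_of_lt_left (hN B hB i hi)
      · exact lt_max_of_lt_right (hM B hB i hi)
    · intro B hB
      obtain ⟨N, hN⟩ := hact B (hsub B hB)
      exact ⟨_, mem_nhdsWithin_of_mem_nhds hN, N, fun B hB => hB⟩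
  obtain ⟨η, hη0, hη1, hη2⟩ : ∃ η > 0, η < τ A / 32 ∧ ∀ q ∈ Finset.range N ×ˢ Finset.range N,
      q.1 ≠ q.2 → 2 * η < dist (e q.1 0) (e q.2 0) := by
    have h1 : ∀ᶠ η in 𝓝 (0 : ℝ), ∀ q ∈ Finset.range N ×ˢ Finset.range N,
        q.1 ≠ q.2 → 2 * η < dist (e q.1 0) (e q.2 0) := by
      rw [Filter.eventually_all_finset]
      intro q _
      by_cases hq : q.1 = q.2
      · simp [hq]
      · have h2 : 0 < dist (e q.1 0) (e q.2 0) := dist_pos.2 fun h => hq (hinj h)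
        have h3 : ContinuousAt (fun η : ℝ => 2 * η) 0 := by fun_prop
        filter_upwards [h3.eventually_lt_const (show 2 * 0 < dist (e q.1 0) (e q.2 0) by simpa using h2)]
          with η h _
        exact h
    have h2 : ∀ᶠ η in 𝓝 (0 : ℝ), η < τ A / 32 := eventually_lt_nhds (by linarith)
    have h3 := ((h1.and h2).filter_mono nhdsWithin_le_nhds).and (self_mem_nhdsWithin (s := Ioi (0 : ℝ)))
    obtain ⟨η, ⟨h4, h5⟩, h6⟩ := h3.exists
    exact ⟨η, h6, h5, h4⟩
  obtain ⟨δ, hδ0, hδ⟩ : ∃ δ > 0, ∀ t, 0 < t → t < δ → ∀ i ∈ Finset.range N, ∀ v, ‖v‖ ≤ t →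
      dist (e i v) (e i 0) ≤ η := by
    have h1 : ∀ᶠ t in 𝓝 (0 : ℝ), ∀ i ∈ Finset.range N, ∀ v, ‖v‖ ≤ t → dist (e i v) (e i 0) ≤ η := by
      rw [Filter.eventually_all_finset]
      intro i _
      obtain ⟨d, hd, h⟩ := Metric.continuousAt_iff.1 ((he i).continuous.continuousAt (x := (0 : E))) η hη0
      filter_upwards [eventually_lt_nhds hd] with t ht v hv
      exact (h (by simpa using hv.trans_lt ht)).le
    obtain ⟨δ, hδ, h⟩ := Metric.eventually_nhds_iff.1 h1
    refine ⟨δ, hδ, fun t h0 h1 => h ?_⟩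
    rw [Real.dist_eq, sub_zero, abs_of_pos h0]; exact h1
  obtain ⟨ε, hε, hε'⟩ := Metric.eventually_nhds_iff.1
    (hτ.continuousAt.eventually_const_lt (show τ A / 2 < τ A by linarith))
  refine ⟨min δ (min ε (τ A / 16)), lt_min hδ0 (lt_min hε (by linarith)), fun B hB t ht0 ht1 => ?_⟩
  have hB1 : dist B A < ε := hB.trans_le ((min_le_right _ _).trans (min_le_left _ _))
  have hB2 : dist B A < τ A / 16 := hB.trans_le ((min_le_right _ _).trans (min_le_right _ _))
  have hτB := hε' hB1
  have hτB2 := hτl B A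
  have htδ := ht1.trans_le (min_le_left δ _)
  have hin : ∀ B', dist B' B ≤ τ B / 2 → B' ∈ closedBall A (3 * τ A / 4) := by
    intro B' h
    rw [mem_closedBall]
    have := dist_triangle B' B A
    linarith
  constructor
  · intro A' A'' i j h1 h2 hi hj hij
    have hi' := hN A' (hin A' h1) i hi
    have hj' := hN A'' (hin A'' h2) j hj
    rw [Set.disjoint_left]
    rintro _ ⟨v, hv, rfl⟩ ⟨w, hw, hvw⟩
    have a1 := hδ t ht0 htδ i (Finset.mem_range.2 hi') v (by simpa using hv)
    have a2 := hδ t ht0 htδ j (Finset.mem_range.2 hj') w (by simpa using hw)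
    have a3 := hη2 (i, j) (by simp [hi', hj']) hij
    simp only at a3
    have a4 := dist_triangle_left (e i 0) (e j 0) (e i v)
    rw [hvw] at a2
    linarith
  · intro i hi v hv
    have hi' := hN B (hin B (by rw [dist_self]; linarith)) i hi
    have a1 := hδ t ht0 htδ i (Finset.mem_range.2 hi') v hv
    linarith

/-- all the data needed for the construction -/
structure Data {E : Type*} [NormedAddCommGroup E] (Z : Set ↥(CSet X)) (ε : ℝ) (e : ℕ → E → X)
    (F : ↥(CSet X) → ↥(CSet X)) (τ c : ↥(CSet X) → ℝ) (σ : ℕ → ↥(CSet X) → ℝ) : Prop where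
  τl : ∀ A B, τ A ≤ τ B + dist A B
  τc : Continuous τ
  τn : ∀ A, 0 ≤ τ A
  τε : ∀ A, τ A ≤ ε
  τ0 : ∀ A ∈ Z, τ A = 0
  τp : ∀ A ∉ Z, 0 < τ A
  Fc : Continuous F
  FZ : ∀ A ∈ Z, F A = A
  Fd : ∀ A, dist (F A) A ≤ τ A / 8
  Fi : ∀ A ∉ Z, interior (car (F A)) = ∅
  σc : ∀ i, Continuous (σ i)
  σn : ∀ i A, 0 ≤ σ i A
  σ0 : ∀ i, ∀ A ∈ Z, σ i A = 0
  σa : ∀ A ∉ Z, ∃ i, 0 < σ i A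
  σl : ∀ A ∉ Z, ∃ N : ℕ, ∀ᶠ B in 𝓝 A, ∀ i, 0 < σ i B → i < N
  σF : ∀ i, ∀ A ∉ Z, 0 < σ i A → e i 0 ∈ car (F A)
  cp : ∀ A ∉ Z, 0 < c A
  σs : ∀ i, ∀ A, σ i A ≤ c A / 2
  cd : ∀ A ∉ Z, ∀ A' A'' i j, dist A' A ≤ τ A / 2 → dist A'' A ≤ τ A / 2 → 0 < σ i A' → 0 < σ j A'' →
    i ≠ j → Disjoint (e i '' closedBall 0 (c A)) (e j '' closedBall 0 (c A))
  ct : ∀ A ∉ Z, ∀ i, 0 < σ i A → ∀ v, ‖v‖ ≤ c A → dist (e i v) (e i 0) ≤ τ A / 16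

lemma exists_data [Nonempty X] [LocallyConnectedSpace X] {n : ℕ} (hE : PiEuclidean X n) (hn : 2 ≤ n)
    {E : Type*} [NormedAddCommGroup E]
    {Z : Set ↥(CSet X)} (hZ : IsClosed Z) {ε : ℝ} (hε : 0 < ε) {e : ℕ → E → X}
    (he : ∀ k, IsOpenEmbedding (e k)) (hd : ∀ V : Set X, IsOpen V → V.Nonempty → ∃ i, e i 0 ∈ V)
    (hinj : Function.Injective fun i => e i 0) :
    ∃ F τ c σ, Data Z ε e F τ c σ := by
  obtain ⟨τ, t1, t2, t3, t4, t5, t6⟩ := exists_tau hZ hε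
  obtain ⟨f, κ, f1, k1, f2, f3, k2, k3, k4⟩ := exists_f0 hZ t1 t6 t5
  obtain ⟨s, s1, s2, s3, s4, s5, s6⟩ := exists_active k1 k3 (fun A hA => (k4 A hA).1) hd
  obtain ⟨q, q1, q2, q3, -⟩ := exists_charts hE hn (ℂ × (Fin (n - 2) → ℝ))
    (by rw [Module.finrank_prod]; simp; omega) (countable_range fun i => e i 0)
  obtain ⟨F, F1, F2, F3, F4, F5⟩ := exists_F (b := fun A => τ A / 16) hZ s6 q1
    (fun i k h => q3 k ⟨i, h⟩) f1 (t1.div_const 16) f2 (fun A hA => by simp [t5 A hA])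
    (fun A hA => by have := t6 A hA; positivity) (fun i A hA hi => (k4 A hA).2 _ (s5 i A hi))
  obtain ⟨c, c1, c2, c3, c4⟩ := exists_c hZ t1 t2 t6 t5 s6 he hinj
  have hpos : ∀ i A, 0 < min (s i A) (c A) / 2 → 0 < s i A := fun i A h =>
    lt_of_lt_of_le (by linarith) (min_le_left (s i A) (c A))
  refine ⟨F, τ, c, fun i A => min (s i A) (c A) / 2, t2, t1, t3, t4, t5, t6, F1, F2, ?_, ?_, ?_, ?_, ?_, ?_, ?_,
    ?_, fun A hA => (c4 A hA).1, ?_, ?_, ?_⟩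
  · intro A
    have := dist_triangle (F A) (f A) A
    linarith [F3 A, f3 A]
  · intro A hA
    by_contra hne
    obtain ⟨k, hk⟩ := q2 _ isOpen_interior (nonempty_iff_ne_empty.2 hne)
    exact F4 k A hA (interior_subset hk)
  · exact fun i => ((s1 i).min c1).div_const 2
  · exact fun i A => div_nonneg (le_min (s2 i A) (c2 A)) (by norm_num)
  · intro i A hA
    simp [s3 i A hA, c3 A hA]
  · intro A hA
    obtain ⟨i, hi⟩ := s4 A hA
    exact ⟨i, half_pos (lt_min hi (c4 A hA).1)⟩
  · intro A hA
    obtain ⟨N, hN⟩ := s6 A hA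
    refine ⟨N, ?_⟩
    filter_upwards [hN] with B hB i hi
    exact hB i (hpos i B hi)
  · exact fun i A hA hi => F5 i A hA (hpos i A hi)
  · intro i A
    have := min_le_right (s i A) (c A)
    linarith
  · intro A hA A' A'' i j h1 h2 hi hj hij
    exact (c4 A hA).2.1 A' A'' i j h1 h2 (hpos i A' hi) (hpos j A'' hj) hij
  · exact fun A hA i hi => (c4 A hA).2.2 i (hpos i A hi)
end P7

section P8
set_option linter.unusedSectionVars false

lemma preconn_remove {X : Type*} [TopologicalSpace X] {S E C : Set X} (hS : IsPreconnected S)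
    (hE : IsOpen E) (hES : E ⊆ S) (hC : IsClosed C) (hCE : C ⊆ E) (h : IsPreconnected (E \ C)) :
    IsPreconnected (S \ C) := by
  have key : ∀ u v : Set X, IsOpen u → IsOpen v → S \ C ⊆ u ∪ v → ((S \ C) ∩ u).Nonempty →
      ((S \ C) ∩ v).Nonempty → ¬ ((S \ C) ∩ (u ∩ v)).Nonempty → E \ C ⊆ u → False := by
    intro u v hu hv huv hSu hSv hn hEu
    have h1 := hS (u ∪ E) (v \ C) (hu.union hE) (hv.sdiff hC) (by
      intro x hx
      by_cases hxC : x ∈ C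
      · exact Or.inl (Or.inr (hCE hxC))
      · rcases huv ⟨hx, hxC⟩ with h | h
        · exact Or.inl (Or.inl h)
        · exact Or.inr ⟨h, hxC⟩) (by
      obtain ⟨x, hx, hxu⟩ := hSu
      exact ⟨x, hx.1, Or.inl hxu⟩) (by
      obtain ⟨x, hx, hxu⟩ := hSv
      exact ⟨x, hx.1, hxu, hx.2⟩)
    obtain ⟨x, hxS, hx1, hx2, hx3⟩ := h1
    refine hn ⟨x, ⟨hxS, hx3⟩, ?_, hx2⟩
    rcases hx1 with h | h
    · exact h
    · exact hEu ⟨h, hx3⟩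
  intro u v hu hv huv hSu hSv
  by_contra hn
  have hsub : E \ C ⊆ S \ C := sdiff_subset_sdiff_left hES
  by_cases h1 : ((E \ C) ∩ v).Nonempty
  · by_cases h2 : ((E \ C) ∩ u).Nonempty
    · obtain ⟨x, hx, hx'⟩ := h u v hu hv (hsub.trans huv) h2 h1
      exact hn ⟨x, hsub hx, hx'⟩
    · refine key v u hv hu (by rwa [union_comm]) hSv hSu (by rwa [inter_comm v u]) fun x hx => ?_
      rcases huv (hsub hx) with h' | h'
      · exact (h2 ⟨x, hx, h'⟩).elim
      · exact h'
  · refine key u v hu hv huv hSu hSv hn fun x hx => ?_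
    rcases huv (hsub hx) with h' | h'
    · exact h'
    · exact (h1 ⟨x, hx, h'⟩).elim

variable {X : Type*} [MetricSpace X] [CompactSpace X]
variable {W : Type} [NormedAddCommGroup W] [NormedSpace ℝ W] [ProperSpace W]

/-- one code -/
def code1 (e : ℕ → ℝ × (ℝ × W) → X) (σ : ℕ → ↥(CSet X) → ℝ) (A : ↥(CSet X)) (y z : Iinf) (i : ℕ) : Set X :=
  e i '' ((fun v => σ i A • v) '' Code W y z)

/-- the union of the active codes -/
def codes (e : ℕ → ℝ × (ℝ × W) → X) (σ : ℕ → ↥(CSet X) → ℝ) (A : ↥(CSet X)) (y z : Iinf) : Set X :=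
  ⋃ i ∈ {i | 0 < σ i A}, code1 e σ A y z i

variable {Z : Set ↥(CSet X)} {ε : ℝ} {e : ℕ → ℝ × (ℝ × W) → X} {F : ↥(CSet X) → ↥(CSet X)}
  {τ c : ↥(CSet X) → ℝ} {σ : ℕ → ↥(CSet X) → ℝ}

lemma mem_codes {A : ↥(CSet X)} {y z : Iinf} {x : X} :
    x ∈ codes e σ A y z ↔ ∃ i, 0 < σ i A ∧ x ∈ code1 e σ A y z i := by
  simp [codes]

namespace Data

lemma fin (D : Data Z ε e F τ c σ) (A : ↥(CSet X)) : {i | 0 < σ i A}.Finite := by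
  by_cases hA : A ∈ Z
  · convert finite_empty (α := ℕ)
    ext i
    simp [D.σ0 i A hA]
  · obtain ⟨N, hN⟩ := D.σl A hA
    exact (finite_lt_nat N).subset fun i hi => hN.self_of_nhds i hi

lemma code1_sub (D : Data Z ε e F τ c σ) (A : ↥(CSet X)) (y z : Iinf) (i : ℕ) : code1 e σ A y z i ⊆ e i '' closedBall 0 (σ i A) := by
  refine image_mono ?_
  rintro _ ⟨v, hv, rfl⟩
  have := hv.1
  simp only [mem_closedBall, dist_zero_right, norm_smul, Real.norm_eq_abs, abs_of_nonneg (D.σn i A)]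
  nlinarith [D.σn i A]

lemma code1_compact (D : Data Z ε e F τ c σ) (he : ∀ i, IsOpenEmbedding (e i)) (A : ↥(CSet X)) (y z : Iinf) (i : ℕ) : IsCompact (code1 e σ A y z i) :=
  ((code_compact y z).image (by fun_prop)).image (he i).continuous

lemma codes_compact (D : Data Z ε e F τ c σ) (he : ∀ i, IsOpenEmbedding (e i)) (A : ↥(CSet X)) (y z : Iinf) : IsCompact (codes e σ A y z) :=
  (D.fin A).isCompact_biUnion fun i _ => D.code1_compact he A y z i

lemma code1_conn (D : Data Z ε e F τ c σ) (he : ∀ i, IsOpenEmbedding (e i)) (A : ↥(CSet X)) (y z : Iinf) (i : ℕ) : IsPreconnected (code1 e σ A y z i) :=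
  ((code_conn y z).2.image _ (by fun_prop)).image _ (he i).continuous.continuousOn

lemma code1_mem (D : Data Z ε e F τ c σ) (A : ↥(CSet X)) (y z : Iinf) (i : ℕ) : e i 0 ∈ code1 e σ A y z i :=
  ⟨0, ⟨0, code_zero y z, by simp⟩, rfl⟩

lemma notZ (D : Data Z ε e F τ c σ) {A : ↥(CSet X)} {i : ℕ} (h : 0 < σ i A) : A ∉ Z := fun hA => by
  rw [D.σ0 i A hA] at h; exact lt_irrefl _ h

lemma gset_conn (D : Data Z ε e F τ c σ) (he : ∀ i, IsOpenEmbedding (e i)) (A : ↥(CSet X)) (y z : Iinf) : IsConnected (car (F A) ∪ codes e σ A y z) := by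
  obtain ⟨a, ha⟩ := car_nonempty (F A)
  refine ⟨⟨a, Or.inl ha⟩, isPreconnected_of_forall a ?_⟩
  rintro x (hx | hx)
  · exact ⟨car (F A), subset_union_left, ha, hx, (car_conn _).2⟩
  · obtain ⟨i, hi, hx⟩ := mem_codes.1 hx
    refine ⟨car (F A) ∪ code1 e σ A y z i, union_subset_union_right _ ?_, Or.inl ha, Or.inr hx, ?_⟩
    · exact fun x hx => mem_codes.2 ⟨i, hi, hx⟩
    · exact (car_conn _).2.union (e i 0) (D.σF i A (D.notZ hi) hi) (D.code1_mem A y z i) (D.code1_conn he A y z i)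

/-- the modified continuum -/
def g (D : Data Z ε e F τ c σ) (he : ∀ i, IsOpenEmbedding (e i)) (A : ↥(CSet X)) (y z : Iinf) : ↥(CSet X) :=
  mkC (car (F A) ∪ codes e σ A y z) ((car_compact _).union (D.codes_compact he A y z)) (D.gset_conn he A y z)

lemma g_distF (D : Data Z ε e F τ c σ) (he : ∀ i, IsOpenEmbedding (e i)) (A : ↥(CSet X)) (y z : Iinf) : dist (D.g he A y z) (F A) ≤ τ A / 16 := by
  have h0 : 0 ≤ τ A / 16 := by linarith [D.τn A]
  refine c_dist_le h0 (fun x hx => ?_) (fun x hx => ⟨x, Or.inl hx, by simpa using h0⟩)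
  rcases hx with hx | hx
  · exact ⟨x, hx, by simpa using h0⟩
  · obtain ⟨i, hi, hx⟩ := mem_codes.1 hx
    have hA := D.notZ hi
    refine ⟨e i 0, D.σF i A hA hi, ?_⟩
    obtain ⟨v, hv, rfl⟩ := D.code1_sub A y z i hx
    refine D.ct A hA i hi v ?_
    have h1 : ‖v‖ ≤ σ i A := by simpa using hv
    linarith [D.σs i A, D.cp A hA]

lemma g_dist (D : Data Z ε e F τ c σ) (he : ∀ i, IsOpenEmbedding (e i)) (A : ↥(CSet X)) (y z : Iinf) : dist (D.g he A y z) A ≤ 3 / 16 * τ A := by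
  have := dist_triangle (D.g he A y z) (F A) A
  linarith [D.g_distF he A y z, D.Fd A]

lemma g_interior (D : Data Z ε e F τ c σ) (he : ∀ i, IsOpenEmbedding (e i)) {A : ↥(CSet X)} (hA : A ∉ Z) (y z : Iinf) :
    interior (car (D.g he A y z)) = interior (codes e σ A y z) := by
  change interior (car (F A) ∪ codes e σ A y z) = _
  rw [union_comm]
  exact interior_union_isClosed_of_interior_empty (D.codes_compact he A y z).isClosed (D.Fi A hA)

/-- description of the codes inside an active chart -/
lemma mem_chart (D : Data Z ε e F τ c σ) (he : ∀ i, IsOpenEmbedding (e i)) {A : ↥(CSet X)} (hA : A ∉ Z) {A' : ↥(CSet X)} (hd : dist A' A ≤ τ A / 2) (hc : c A' ≤ c A)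
    {i : ℕ} (hi : 0 < σ i A) (y z : Iinf) {x : X} (hx : x ∈ e i '' closedBall 0 (c A)) :
    x ∈ codes e σ A' y z ↔ 0 < σ i A' ∧ x ∈ code1 e σ A' y z i := by
  rw [mem_codes]
  constructor
  · rintro ⟨j, hj, hxj⟩
    by_cases hij : i = j
    · subst hij; exact ⟨hj, hxj⟩
    · exfalso
      refine disjoint_left.1 (D.cd A hA A A' i j (by simp; linarith [D.τn A]) hd hi hj hij) hx ?_
      refine image_mono (closedBall_subset_closedBall ?_) (D.code1_sub A' y z j hxj)
      linarith [D.σs j A', D.cp A hA]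
  · rintro ⟨h1, h2⟩
    exact ⟨i, h1, h2⟩

lemma scaled (D : Data Z ε e F τ c σ) (he : ∀ i, IsOpenEmbedding (e i)) {A : ↥(CSet X)} {i : ℕ} (hi : 0 < σ i A) : IsOpenEmbedding fun v => e i (σ i A • v) :=
  (he i).comp (Homeomorph.smulOfNeZero (σ i A) hi.ne').isOpenEmbedding

lemma mem_scaled (D : Data Z ε e F τ c σ) (he : ∀ i, IsOpenEmbedding (e i)) {A : ↥(CSet X)} {i : ℕ} (hi : 0 < σ i A) (y z : Iinf) {v : ℝ × (ℝ × W)} (hv : ‖v‖ ≤ 2) :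
    e i (σ i A • v) ∈ codes e σ A y z ↔ v ∈ Code W y z := by
  have hA := D.notZ hi
  rw [D.mem_chart he hA (A' := A) (by simp; linarith [D.τn A]) le_rfl hi]
  · constructor
    · rintro ⟨-, _, ⟨w, hw, rfl⟩, h⟩
      have := (D.scaled he hi).injective h
      rwa [← this]
    · intro h
      exact ⟨hi, _, ⟨v, h, rfl⟩, rfl⟩
  · refine ⟨_, ?_, rfl⟩
    simp only [mem_closedBall, dist_zero_right, norm_smul, Real.norm_eq_abs, abs_of_pos hi]
    nlinarith [D.σs i A]

lemma exists_out (D : Data Z ε e F τ c σ) (he : ∀ i, IsOpenEmbedding (e i)) {A : ↥(CSet X)} {i : ℕ} (hi : 0 < σ i A) (y z : Iinf) :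
    e i (σ i A • ((3 / 2 : ℝ), (0 : ℝ × W))) ∉ codes e σ A y z := by
  have hn : ‖((3 / 2 : ℝ), (0 : ℝ × W))‖ = 3 / 2 := by
    simp [Prod.norm_def]; norm_num
  rw [D.mem_scaled he hi y z (by rw [hn]; norm_num)]
  intro h
  have := h.1
  rw [hn] at this
  norm_num at this

lemma g_ne_univ (D : Data Z ε e F τ c σ) (he : ∀ i, IsOpenEmbedding (e i)) {A : ↥(CSet X)} (hA : A ∉ Z) (y z : Iinf) : car (D.g he A y z) ≠ univ := by
  intro h
  have h1 := D.g_interior he hA y z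
  rw [h, interior_univ] at h1
  obtain ⟨i, hi⟩ := D.σa A hA
  exact D.exists_out he hi y z (interior_subset (h1 ▸ mem_univ _))

lemma nonCB_g_iff (D : Data Z ε e F τ c σ) (he : ∀ i, IsOpenEmbedding (e i)) [ConnectedSpace X] [LocallyConnectedSpace X] (huc : Unicoherent X) {A : ↥(CSet X)}
    (hA : A ∉ Z) (y z : Iinf) :
    (D.g he A y z : Hyper X) ∈ CBSet X ↔ IsPreconnected (closure (codes e σ A y z)ᶜ) := by
  rw [mem_CBSet_iff huc (D.g he A y z).2 (D.g_ne_univ he hA y z), closure_compl, closure_compl]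
  rw [show interior ((D.g he A y z : Hyper X) : Set X) = _ from D.g_interior he hA y z]

lemma codes_preconn (D : Data Z ε e F τ c σ) (he : ∀ i, IsOpenEmbedding (e i)) [ConnectedSpace X] {A : ↥(CSet X)} {y z : Iinf} (hz : ∀ i, 0 < (z i : ℝ)) :
    IsPreconnected (codes e σ A y z)ᶜ := by
  have key : ∀ T : Finset ℕ, (∀ i ∈ T, 0 < σ i A) → IsPreconnected (⋃ i ∈ T, code1 e σ A y z i)ᶜ := by
    intro T
    induction T using Finset.induction_on with
    | empty => intro _; simpa using isPreconnected_univ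
    | insert i T hiT ih =>
      intro hT
      have hi : 0 < σ i A := hT i (by simp)
      have hA := D.notZ hi
      have hS := ih fun j hj => hT j (by simp [hj])
      have heq : (⋃ j ∈ insert i T, code1 e σ A y z j)ᶜ = (⋃ j ∈ T, code1 e σ A y z j)ᶜ \ code1 e σ A y z i := by
        rw [Finset.set_biUnion_insert, compl_union, inter_comm]; rfl
      rw [heq]
      have hφ := D.scaled he hi
      have hcode : code1 e σ A y z i = (fun v => e i (σ i A • v)) '' Code W y z := by
        unfold code1; rw [image_image]
      have hb : (fun v => e i (σ i A • v)) '' ball 0 2 ⊆ e i '' closedBall 0 (c A) := by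
        rintro _ ⟨v, hv, rfl⟩
        refine ⟨_, ?_, rfl⟩
        have : ‖v‖ < 2 := by simpa using hv
        simp only [mem_closedBall, dist_zero_right, norm_smul, Real.norm_eq_abs, abs_of_pos hi]
        nlinarith [D.σs i A]
      refine preconn_remove (E := (fun v => e i (σ i A • v)) '' ball 0 2) hS (hφ.isOpenMap _ isOpen_ball) ?_
        (D.code1_compact he A y z i).isClosed ?_ ?_
      · intro x hx hx2
        simp only [mem_iUnion, exists_prop] at hx2
        obtain ⟨j, hj, hxj⟩ := hx2
        have hj' : 0 < σ j A := hT j (by simp [hj])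
        have h0 : dist A A ≤ τ A / 2 := by simp; linarith [D.τn A]
        refine disjoint_left.1 (D.cd A hA A A i j h0 h0 hi hj' (fun h => hiT (h ▸ hj))) (hb hx) ?_
        refine image_mono (closedBall_subset_closedBall ?_) (D.code1_sub A y z j hxj)
        linarith [D.σs j A, D.cp A hA]
      · rw [hcode]
        exact image_mono ((code_sub y z).trans (closedBall_subset_ball (by norm_num)))
      · rw [hcode, ← image_sdiff hφ.injective]
        exact (code_compl hz).image _ hφ.continuous.continuousOn
  have := key (D.fin A).toFinset (by simp)
  convert this using 2
  simp [codes]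

lemma codes_sep (D : Data Z ε e F τ c σ) (he : ∀ i, IsOpenEmbedding (e i)) {A : ↥(CSet X)} (hA : A ∉ Z) {y z : Iinf} {k : ℕ} (hz : (z k : ℝ) = 0) :
    ¬ IsPreconnected (closure (codes e σ A y z)ᶜ) := by
  intro hp
  obtain ⟨i, hi⟩ := D.σa A hA
  obtain ⟨U, O, hU, hO, hUO, hOb, hsub, v, hvU, hvC⟩ := code_cav (W := W) (y := y) hz
  have hφ := D.scaled he hi
  set φ := fun v => e i (σ i A • v) with hφd
  have hUc : IsClosed (φ '' U) := (hU.image hφ.continuous).isClosed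
  have hOc : IsClosed (φ '' O)ᶜ := (hφ.isOpenMap O hO).isClosed_compl
  have hO2 : ∀ w ∈ O, ‖w‖ < 1 := fun w hw => by simpa using hOb hw
  have hcov : (codes e σ A y z)ᶜ ⊆ φ '' U ∪ (φ '' O)ᶜ := by
    intro x hx
    by_cases hxO : x ∈ φ '' O
    · obtain ⟨w, hw, rfl⟩ := hxO
      left
      have : w ∉ Code W y z := fun h => hx ((D.mem_scaled he hi y z (by linarith [hO2 w hw])).2 h)
      rcases hsub this with h | h
      · exact ⟨w, h, rfl⟩
      · exact absurd hw h
    · exact Or.inr hxO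
  obtain ⟨x, hx, hxU, hxO⟩ := isPreconnected_closed_iff.1 hp (φ '' U) (φ '' O)ᶜ hUc hOc
    (closure_minimal hcov (hUc.union hOc)) ⟨φ v, subset_closure fun h =>
      hvC ((D.mem_scaled he hi y z (by linarith [hO2 v (hUO hvU)])).1 h), v, hvU, rfl⟩
    ⟨_, subset_closure (D.exists_out he hi y z), by
      rintro ⟨w, hw, h⟩
      have h1 := hφ.injective h
      have h2 := hO2 w hw
      rw [h1] at h2
      have hn : ‖((3 / 2 : ℝ), (0 : ℝ × W))‖ = 3 / 2 := by
        simp [Prod.norm_def]; norm_num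
      rw [hn] at h2
      norm_num at h2⟩
  exact hxO (image_mono hUO hxU)

lemma g_CB_iff (D : Data Z ε e F τ c σ) (he : ∀ i, IsOpenEmbedding (e i)) [ConnectedSpace X] [LocallyConnectedSpace X] (huc : Unicoherent X) {A : ↥(CSet X)}
    (hA : A ∉ Z) (y z : Iinf) :
    (D.g he A y z : Hyper X) ∉ CBSet X ↔ ∃ i, (z i : ℝ) = 0 := by
  rw [D.nonCB_g_iff he huc hA]
  constructor
  · intro h
    by_contra hn
    push Not at hn
    exact h (D.codes_preconn he fun i => lt_of_le_of_ne (z i).2.1 (hn i).symm).closure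
  · rintro ⟨k, hk⟩
    exact D.codes_sep he hA hk

lemma g_decode (D : Data Z ε e F τ c σ) (he : ∀ i, IsOpenEmbedding (e i)) {A A' : ↥(CSet X)} (hA : A ∉ Z) (hA' : A' ∉ Z) (hd : dist A' A ≤ τ A / 2) (hc : c A' ≤ c A)
    {y z y' z' : Iinf} (h : D.g he A y z = D.g he A' y' z') : y = y' := by
  have hintr : interior (codes e σ A y z) = interior (codes e σ A' y' z') := by
    rw [← D.g_interior he hA, ← D.g_interior he hA', h]
  obtain ⟨i, hi⟩ := D.σa A hA
  have hO : IsOpen (e i '' ball 0 (c A)) := (he i).isOpenMap _ isOpen_ball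
  have hOc : e i '' ball 0 (c A) ⊆ e i '' closedBall 0 (c A) := image_mono ball_subset_closedBall
  have hsubO : ∀ A1 : ↥(CSet X), c A1 ≤ c A → ∀ y z, code1 e σ A1 y z i ⊆ e i '' ball 0 (c A) := by
    intro A1 h1 y z
    refine (D.code1_sub A1 y z i).trans (image_mono (closedBall_subset_ball ?_))
    linarith [D.σs i A1, D.cp A hA]
  have e1 : codes e σ A y z ∩ e i '' ball 0 (c A) = code1 e σ A y z i := by
    ext x
    constructor
    · rintro ⟨h1, h2⟩
      exact ((D.mem_chart he hA (A' := A) (by simp; linarith [D.τn A]) le_rfl hi y z (hOc h2)).1 h1).2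
    · exact fun h1 => ⟨mem_codes.2 ⟨i, hi, h1⟩, hsubO A le_rfl y z h1⟩
  have h2 : interior (code1 e σ A y z i) = interior (codes e σ A' y' z' ∩ e i '' ball 0 (c A)) := by
    rw [← e1, interior_inter, interior_inter, hintr]
  have hne : (interior (code1 e σ A y z i)).Nonempty := by
    have hm := code_neg (W := W) (y := y) (z := z) (r := 1 / 2) (by norm_num) (by norm_num)
    have := (D.scaled he hi).isOpenMap.image_interior_subset (Code W y z) ⟨_, hm, rfl⟩
    refine ⟨e i (σ i A • ((-(1 / 2) : ℝ), (0 : ℝ × W))), ?_⟩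
    unfold code1; rw [image_image]; exact this
  have hi' : 0 < σ i A' := by
    obtain ⟨x, hx⟩ := hne
    rw [h2] at hx
    have hx := interior_subset hx
    exact ((D.mem_chart he hA hd hc hi y' z' (hOc hx.2)).1 hx.1).1
  have e2 : codes e σ A' y' z' ∩ e i '' ball 0 (c A) = code1 e σ A' y' z' i := by
    ext x
    constructor
    · rintro ⟨h1, h2⟩
      exact ((D.mem_chart he hA hd hc hi y' z' (hOc h2)).1 h1).2
    · exact fun h1 => ⟨mem_codes.2 ⟨i, hi', h1⟩, hsubO A' hc y' z' h1⟩
  rw [e2] at h2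
  have h3 := congrArg (fun s => e i ⁻¹' s) h2
  simp only [code1] at h3
  rw [(he i).isOpenMap.preimage_interior_eq_interior_preimage (he i).continuous,
    (he i).isOpenMap.preimage_interior_eq_interior_preimage (he i).continuous,
    preimage_image_eq _ (he i).injective, preimage_image_eq _ (he i).injective] at h3
  exact (code_decode hi hi' h3).2
end Data
end P8

section P9
set_option linter.unusedSectionVars false
variable {X : Type*} [MetricSpace X] [CompactSpace X]
variable {W : Type} [NormedAddCommGroup W] [NormedSpace ℝ W] [ProperSpace W]
variable {Z : Set ↥(CSet X)} {ε : ℝ} {e : ℕ → ℝ × (ℝ × W) → X} {F : ↥(CSet X) → ↥(CSet X)}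
  {τ c : ↥(CSet X) → ℝ} {σ : ℕ → ↥(CSet X) → ℝ}

lemma smul_move {E : Type*} [NormedAddCommGroup E] [NormedSpace ℝ E] {s s' ρ δ : ℝ} {v v' : E} (hv : ‖v‖ ≤ 1)
    (hs' : 0 ≤ s') (hs : |s - s'| ≤ δ) (h : s' * ρ ≤ δ) (hvv : dist v v' ≤ ρ) :
    dist (s • v) (s' • v') ≤ 2 * δ := by
  have e1 : s • v - s' • v' = (s - s') • v + s' • (v - v') := by
    rw [sub_smul, smul_sub]; abel
  rw [dist_eq_norm, e1]
  refine (norm_add_le _ _).trans ?_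
  rw [norm_smul, norm_smul, Real.norm_eq_abs, Real.norm_eq_abs, abs_of_nonneg hs', ← dist_eq_norm]
  have h1 : |s - s'| * ‖v‖ ≤ |s - s'| * 1 := by gcongr
  have h2 : s' * dist v v' ≤ s' * ρ := by gcongr
  linarith

namespace Data

lemma move1 (D : Data Z ε e F τ c σ) (he : ∀ i, IsOpenEmbedding (e i)) (hZ : IsClosed Z)
    {A0 : ↥(CSet X)} (hA : A0 ∉ Z) (p : Iinf × Iinf) (i : ℕ) {r : ℝ} (hr : 0 < r) :
    ∀ᶠ q : ↥(CSet X) × (Iinf × Iinf) in 𝓝 (A0, p),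
      (0 < σ i A0 → 0 < σ i q.1 ∧ ∀ x ∈ code1 e σ A0 p.1 p.2 i, ∃ x' ∈ code1 e σ q.1 q.2.1 q.2.2 i, dist x x' ≤ r) ∧
      (0 < σ i q.1 → ∀ x ∈ code1 e σ q.1 q.2.1 q.2.2 i, ∃ x' ∈ car (D.g he A0 p.1 p.2), dist x x' ≤ r) := by
  have c1 : ContinuousAt (fun q : ↥(CSet X) × (Iinf × Iinf) => σ i q.1) (A0, p) :=
    ((D.σc i).comp continuous_fst).continuousAt
  have cF : ContinuousAt (fun q : ↥(CSet X) × (Iinf × Iinf) => F q.1) (A0, p) :=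
    (D.Fc.comp continuous_fst).continuousAt
  have cZ : ∀ᶠ q : ↥(CSet X) × (Iinf × Iinf) in 𝓝 (A0, p), q.1 ∉ Z :=
    (continuousAt_fst (p := (A0, p))).eventually (hZ.isOpen_compl.mem_nhds hA)
  rcases (D.σn i A0).eq_or_lt with h0 | h0
  · obtain ⟨ρ, hρ, H⟩ := Metric.continuousAt_iff.1 ((he i).continuous.continuousAt (x := (0 : ℝ × (ℝ × W)))) (r / 2) (by linarith)
    have hs : ∀ᶠ q : ↥(CSet X) × (Iinf × Iinf) in 𝓝 (A0, p), σ i q.1 < ρ :=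
      c1.eventually_lt continuousAt_const (by simpa [← h0] using hρ)
    have hF := Metric.tendsto_nhds.1 cF (r / 2) (by linarith)
    filter_upwards [hs, hF, cZ] with q h1 h2 h3
    refine ⟨fun h => absurd h (by rw [← h0]; exact lt_irrefl _), fun hq x hx => ?_⟩
    obtain ⟨b, hb, hd⟩ := c_exists_lt h2 (D.σF i q.1 h3 hq)
    refine ⟨b, Or.inl hb, ?_⟩
    obtain ⟨v, hv, rfl⟩ := D.code1_sub _ _ _ _ hx
    rw [mem_closedBall] at hv
    have := H (lt_of_le_of_lt hv h1)
    linarith [dist_triangle (e i v) (e i 0) b]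
  · have huc := (isCompact_closedBall (0 : ℝ × (ℝ × W)) (σ i A0 + 1)).uniformContinuousOn_of_continuous
      (he i).continuous.continuousOn
    obtain ⟨δ, hδ, H⟩ := Metric.uniformContinuousOn_iff.1 huc r hr
    set s := σ i A0 with hsd
    have hm := (continuousAt_snd (p := (A0, p))).eventually
      (code_move (W := W) p (δ := δ / (4 * (s + 1))) (by positivity))
    have hs := Metric.tendsto_nhds.1 c1 (min (min (δ / 4) 1) s) (by positivity)
    filter_upwards [hm, hs] with q h1 h2
    rw [Real.dist_eq] at h2
    have h21 : |σ i q.1 - s| < δ / 4 := lt_of_lt_of_le h2 ((min_le_left _ _).trans (min_le_left _ _))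
    have h22 : |σ i q.1 - s| < 1 := lt_of_lt_of_le h2 ((min_le_left _ _).trans (min_le_right _ _))
    have h23 : |σ i q.1 - s| < s := lt_of_lt_of_le h2 (min_le_right _ _)
    rw [abs_lt] at h22 h23
    have hq : 0 < σ i q.1 := by linarith
    have hk : ∀ t, 0 ≤ t → t ≤ s + 1 → t * (δ / (4 * (s + 1))) ≤ δ / 4 := by
      intro t ht0 ht
      have : (s + 1) * (δ / (4 * (s + 1))) = δ / 4 := by field_simp
      rw [← this]
      gcongr
    have hin : ∀ t, 0 ≤ t → t ≤ s + 1 → ∀ v : ℝ × (ℝ × W), ‖v‖ ≤ 1 → t • v ∈ closedBall (0 : ℝ × (ℝ × W)) (s + 1) := by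
      intro t ht0 ht v hv
      rw [mem_closedBall_zero_iff, norm_smul, Real.norm_eq_abs, abs_of_nonneg ht0]
      nlinarith [norm_nonneg v]
    refine ⟨fun _ => ⟨hq, ?_⟩, fun _ => ?_⟩
    · rintro x ⟨_, ⟨v, hv, rfl⟩, rfl⟩
      obtain ⟨v', hv', hd⟩ := h1.1 v hv
      refine ⟨_, ⟨_, ⟨v', hv', rfl⟩, rfl⟩, (H _ (hin s h0.le (by linarith) v hv.1) _
        (hin _ hq.le (by linarith) v' hv'.1) ?_).le⟩
      have := smul_move (s := s) (s' := σ i q.1) (δ := δ / 4) hv.1 hq.le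
        (by rw [abs_sub_comm]; exact h21.le) (hk _ hq.le (by linarith)) hd
      show dist (s • v) (σ i q.1 • v') < δ
      linarith
    · rintro x ⟨_, ⟨v, hv, rfl⟩, rfl⟩
      obtain ⟨v', hv', hd⟩ := h1.2 v hv
      refine ⟨e i (s • v'), Or.inr (mem_codes.2 ⟨i, h0, ⟨_, ⟨v', hv', rfl⟩, rfl⟩⟩), (H _
        (hin _ hq.le (by linarith) v hv.1) _ (hin s h0.le (by linarith) v' hv'.1) ?_).le⟩
      have := smul_move (s := σ i q.1) (s' := s) (δ := δ / 4) hv.1 h0.le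
        h21.le (hk _ h0.le (by linarith)) hd
      show dist (σ i q.1 • v) (s • v') < δ
      linarith

lemma g_cont (D : Data Z ε e F τ c σ) (he : ∀ i, IsOpenEmbedding (e i)) (hZ : IsClosed Z)
    {A0 : ↥(CSet X)} (hA : A0 ∉ Z) (p : Iinf × Iinf) :
    ContinuousAt (fun q : ↥(CSet X) × (Iinf × Iinf) => D.g he q.1 q.2.1 q.2.2) (A0, p) := by
  have cF : ContinuousAt (fun q : ↥(CSet X) × (Iinf × Iinf) => F q.1) (A0, p) :=
    (D.Fc.comp continuous_fst).continuousAt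
  refine Metric.tendsto_nhds.2 fun r hr => ?_
  obtain ⟨N, hN⟩ := D.σl A0 hA
  have hN' := (continuousAt_fst (p := (A0, p))).eventually hN
  have hF := Metric.tendsto_nhds.1 cF (r / 2) (by linarith)
  have hm := (Filter.eventually_all_finset (Finset.range N)).2 fun i _ =>
    D.move1 he hZ hA p i (r := r / 2) (by linarith)
  filter_upwards [hN', hF, hm] with q h1 h2 h3
  refine lt_of_le_of_lt (c_dist_le (r := r / 2) (by linarith) ?_ ?_) (by linarith)
  · rintro x (hx | hx)
    · obtain ⟨b, hb, hd⟩ := c_exists_lt h2 hx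
      exact ⟨b, Or.inl hb, hd.le⟩
    · obtain ⟨i, hi, hx⟩ := mem_codes.1 hx
      exact (h3 i (Finset.mem_range.2 (h1 i hi))).2 hi x hx
  · rintro x (hx | hx)
    · obtain ⟨b, hb, hd⟩ := c_exists_lt (by rwa [dist_comm] at h2) hx
      exact ⟨b, Or.inl hb, hd.le⟩
    · obtain ⟨i, hi, hx⟩ := mem_codes.1 hx
      obtain ⟨h4, h5⟩ := (h3 i (Finset.mem_range.2 (hN.self_of_nhds i hi))).1 hi
      obtain ⟨x', hx', hd⟩ := h5 x hx
      exact ⟨x', Or.inr (mem_codes.2 ⟨i, h4, hx'⟩), hd⟩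
end Data
end P9

section P10
variable {X : Type*} [MetricSpace X] [CompactSpace X]

open Classical in
lemma exists_z {M : Set Iinf} (hM : IsFsigma M) {Q : Type*} [MetricSpace Q] {f : Iinf → Q} (hf : IsEmbedding f) :
    ∃ z : Iinf → Iinf, Continuous z ∧ ∀ x, (∃ i, (z x i : ℝ) = 0) ↔ x ∈ M := by
  obtain ⟨m, hm, rfl⟩ := hM
  have hcl : ∀ i, IsClosed (f '' m i) := fun i => ((hm i).isCompact.image hf.continuous).isClosed
  refine ⟨fun x i => if m i = ∅ then 1 else ⟨min 1 (infDist (f x) (f '' m i)),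
    le_min zero_le_one infDist_nonneg, min_le_left _ _⟩, ?_, ?_⟩
  · refine continuous_pi fun i => ?_
    by_cases h : m i = ∅
    · simp only [h, if_true]; exact continuous_const
    · simp only [h, if_false]
      exact Continuous.subtype_mk (continuous_const.min ((continuous_infDist_pt _).comp hf.continuous)) _
  · intro x
    rw [mem_iUnion]
    refine exists_congr fun i => ?_
    by_cases h : m i = ∅
    · simp [h]
    · have hne : (f '' m i).Nonempty := (nonempty_iff_ne_empty.2 h).image f
      simp only [h, if_false]
      rw [← hf.injective.mem_set_image (s := m i), (hcl i).mem_iff_infDist_zero hne]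
      constructor
      · intro h1
        rcases min_choice (1 : ℝ) (infDist (f x) (f '' m i)) with h2 | h2
        · rw [h2] at h1; norm_num at h1
        · rwa [h2] at h1
      · intro h1
        rw [h1]; simp

lemma strong_univ [ConnectedSpace X] [LocallyConnectedSpace X]
    (huc : Unicoherent X) {n : ℕ} (hn : 2 ≤ n) (hE : PiEuclidean X n) :
    StronglyUniversal {M : Set Iinf | IsFsigma M} {A : ↥(CSet X) | (A : Hyper X) ∉ CBSet X} := by
  intro M hM K hK f hf hfK ε hε
  have hdim : Module.finrank ℝ (ℝ × (ℝ × (Fin (n - 2) → ℝ))) = n := by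
    rw [Module.finrank_prod, Module.finrank_prod]; simp; omega
  obtain ⟨e, he, hd, -, hinj⟩ := exists_charts hE hn (ℝ × (ℝ × (Fin (n - 2) → ℝ))) hdim countable_empty
  obtain ⟨F, τ, c, σ, D⟩ := exists_data hE hn hfK.1 hε he hd hinj
  obtain ⟨z, hz, hzM⟩ := exists_z hM hf
  have hmem : ∀ {x}, f x ∈ f '' K ↔ x ∈ K := fun {x} => hf.injective.mem_set_image
  set G : Iinf → ↥(CSet X) := fun x => D.g he (f x) x (z x) with hG
  have hdist : ∀ x, dist (G x) (f x) ≤ 3 / 16 * τ (f x) := fun x => D.g_dist he _ _ _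
  have hGK : ∀ x ∈ K, G x = f x := by
    intro x hx
    have := hdist x
    rw [D.τ0 _ (hmem.2 hx), mul_zero] at this
    exact dist_le_zero.1 this
  have hcont : Continuous G := by
    rw [continuous_iff_continuousAt]
    intro x
    by_cases hx : x ∈ K
    · unfold ContinuousAt
      rw [hGK x hx]
      have h1 : Filter.Tendsto (fun x => 3 / 16 * τ (f x)) (𝓝 x) (𝓝 0) := by
        have : Continuous fun x => 3 / 16 * τ (f x) := continuous_const.mul (D.τc.comp hf.continuous)
        have := this.tendsto x
        rwa [D.τ0 _ (hmem.2 hx), mul_zero] at this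
      have h2 : Filter.Tendsto (fun x => dist (f x) (G x)) (𝓝 x) (𝓝 0) :=
        squeeze_zero (fun _ => dist_nonneg) (fun x => by rw [dist_comm]; exact hdist x) h1
      exact (hf.continuous.tendsto x).congr_dist h2
    · have h1 := D.g_cont he hfK.1 (fun h => hx (hmem.1 h)) (x, z x)
      have h2 : ContinuousAt (fun x => (f x, (x, z x))) x :=
        (hf.continuous.prodMk (continuous_id.prodMk hz)).continuousAt
      exact ContinuousAt.comp (f := fun x => (f x, (x, z x))) h1 h2
  have hmix : ∀ x x', x ∈ K → x' ∉ K → G x ≠ G x' := by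
    intro x x' hx hx' h
    have h1 := hdist x'
    rw [← h, hGK x hx] at h1
    have h2 := D.τl (f x') (f x)
    have h3 := D.τp _ (fun h => hx' (hmem.1 h))
    rw [D.τ0 _ (hmem.2 hx), dist_comm] at h2
    linarith
  have hout : ∀ x x', x ∉ K → x' ∉ K → G x = G x' → c (f x') ≤ c (f x) → x = x' := by
    intro x x' hx hx' h hc
    have h1 := hdist x
    have h2 := hdist x'
    rw [← h] at h2
    have h3 := dist_triangle (f x') (G x) (f x)
    rw [dist_comm (f x') (G x)] at h3
    have h4 := D.τl (f x') (f x)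
    have h5 := D.τn (f x)
    exact D.g_decode he (fun h => hx (hmem.1 h)) (fun h => hx' (hmem.1 h)) (by linarith) hc h
  have hinjG : Function.Injective G := by
    intro x x' h
    by_cases hx : x ∈ K <;> by_cases hx' : x' ∈ K
    · rw [hGK x hx, hGK x' hx'] at h
      exact hf.injective h
    · exact (hmix x x' hx hx' h).elim
    · exact (hmix x' x hx' hx h.symm).elim
    · rcases le_total (c (f x')) (c (f x)) with hc | hc
      · exact hout x x' hx hx' h hc
      · exact (hout x' x hx' hx h.symm hc).symm
  refine ⟨G, (hcont.isClosedEmbedding hinjG).isEmbedding, ?_, ?_, hGK, ?_⟩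
  · let Zs : ℕ → Set ↥(CSet X) := fun k => Nat.casesOn k (f '' K) fun i => {A : ↥(CSet X) | e i 0 ∈ car A}
    refine isZSet_of_subset_iUnion (isCompact_range hcont).isClosed (Z := Zs) ?_ ?_
    · rintro (_ | i)
      · exact hfK
      · exact isZSet_mem' hn hdim (he i)
    · rintro _ ⟨x, rfl⟩
      by_cases hx : x ∈ K
      · rw [hGK x hx]
        exact mem_iUnion.2 ⟨0, x, hx, rfl⟩
      · have hx2 : f x ∉ f '' K := fun h => hx (hmem.1 h)
        obtain ⟨i, hi⟩ := D.σa _ hx2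
        exact mem_iUnion.2 ⟨i + 1, Or.inl (D.σF i _ hx2 hi)⟩
  · intro x
    have := hdist x
    have h2 := D.τε (f x)
    linarith
  · ext x
    refine and_congr_left fun hx => ?_
    rw [← hzM x]
    exact D.g_CB_iff he huc (fun h => hx (hmem.1 h)) x (z x)
end P10

/-- If `X` is a nondegenerate unicoherent Peano continuum which is
π-`n`-Euclidean, `2 ≤ n < ∞`, then `C(X) \ CB(X)` is an `F_σ`-absorber in the Hilbert
cube `C(X)`: it is `F_σ`, strongly `F_σ`-universal, and contained in a `σZ`-set. -/
theorem compl_CBSet_Fsigma_absorber (X : Type*) [MetricSpace X] [CompactSpace X]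
    [ConnectedSpace X] [Nontrivial X] [LocallyConnectedSpace X]
    (huc : Unicoherent X) (n : ℕ) (hn : 2 ≤ n) (hE : PiEuclidean X n) :
    IsFsigma {A : ↥(CSet X) | (A : Hyper X) ∉ CBSet X} ∧
      StronglyUniversal {M : Set Iinf | IsFsigma M}
        {A : ↥(CSet X) | (A : Hyper X) ∉ CBSet X} ∧
      ∃ Z : Set ↥(CSet X), IsSigmaZSet Z ∧
        {A : ↥(CSet X) | (A : Hyper X) ∉ CBSet X} ⊆ Z := by
  exact ⟨isFsigma_nonCB huc, strong_univ huc hn hE, sigmaZ_cover huc hE hn⟩
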